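/- Let n, p ≥ 1 and let Y_p(gl_n) be the level p Yangian over k. Then Y_p(gl_n) is a free module over its center. -/

import Mathlib

noncomputable section

universe u

/-- The element `t_ij^(r)` of the free algebra on the generators
`t_ij^(1), …, t_ij^(p)` (`i, j = 1, …, n`), with the conventions `t_ij^(0) = δ_ij` and
`t_ij^(r) = 0` for `r ≥ p + 1`. -/
noncomputable def tGen (k : Type u) [Field k] (n p : ℕ) (i j : Fin n) (r : ℕ) :
    FreeAlgebra k (Fin n × Fin n × Fin p) :=
  if h : 1 ≤ r ∧ r ≤ p then FreeAlgebra.ι k (i, j, (⟨r - 1, by omega⟩ : Fin p))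
  else if r = 0 then (if i = j then 1 else 0) else 0

/-- The defining relations of the level `p` Yangian `Y_p(gl_n)`:
`[t_ij^(r), t_lm^(s)] = Σ_{a=1}^{min(r,s)} (t_lj^(a-1) t_im^(r+s-a) − t_lj^(r+s-a) t_im^(a-1))`
for `i, j, l, m = 1, …, n` and `r, s = 1, …, p`. -/
inductive YangianRel (k : Type u) [Field k] (n p : ℕ) :
    FreeAlgebra k (Fin n × Fin n × Fin p) → FreeAlgebra k (Fin n × Fin n × Fin p) → Prop
  | rel (i j l m : Fin n) (r s : ℕ) (hr : 1 ≤ r) (hrp : r ≤ p) (hs : 1 ≤ s) (hsp : s ≤ p) :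
      YangianRel k n p
        (tGen k n p i j r * tGen k n p l m s - tGen k n p l m s * tGen k n p i j r)
        (∑ a ∈ Finset.Icc 1 (min r s),
          (tGen k n p l j (a - 1) * tGen k n p i m (r + s - a) -
            tGen k n p l j (r + s - a) * tGen k n p i m (a - 1)))

/-- The level `p` Yangian `Y_p(gl_n)`: the quotient of the free associative `k`-algebra on
the generators `t_ij^(r)` (`1 ≤ i, j ≤ n`, `1 ≤ r ≤ p`) by the two-sided ideal generated by
the defining relations. -/
noncomputable def Yangian (k : Type u) [Field k] (n p : ℕ) : Type u :=
  RingQuot (YangianRel k n p)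

noncomputable instance (k : Type u) [Field k] (n p : ℕ) : Ring (Yangian k n p) :=
  inferInstanceAs (Ring (RingQuot (YangianRel k n p)))

noncomputable instance (k : Type u) [Field k] (n p : ℕ) : Algebra k (Yangian k n p) :=
  inferInstanceAs (Algebra k (RingQuot (YangianRel k n p)))

section

open MvPolynomial

section WordFiltration

variable {k A σ : Type*} [Field k] [Ring A] [Algebra k A] (t : σ → A) (w : σ → ℕ)

/-- The span of the words in the generators `t` of total weight less than `D`. -/
def wordFilt (k : Type*) {A σ : Type*} [Field k] [Ring A] [Algebra k A] (t : σ → A) (w : σ → ℕ)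
    (D : ℕ) : Submodule k A :=
  Submodule.span k {y | ∃ l : List σ, (l.map w).sum < D ∧ (l.map t).prod = y}

/-- The linear map sending each commutative monomial to a chosen word with the same letters. -/
def wordMap (k : Type*) {A σ : Type*} [Field k] [Ring A] [Algebra k A] (t : σ → A) :
    MvPolynomial σ k →ₗ[k] A :=
  (basisMonomials σ k).constr k fun e => ((Finsupp.toMultiset e).toList.map t).prod

variable {t w}

lemma word_mem_wordFilt {D : ℕ} (l : List σ) (h : (l.map w).sum < D) :
    (l.map t).prod ∈ wordFilt k t w D :=
  Submodule.subset_span ⟨l, h, rfl⟩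

lemma wordFilt_mono {D E : ℕ} (h : D ≤ E) : wordFilt k t w D ≤ wordFilt k t w E :=
  Submodule.span_mono fun _ ⟨l, hl, e⟩ => ⟨l, hl.trans_le h, e⟩

lemma wordFilt_zero : wordFilt k t w 0 = ⊥ := by
  simp [wordFilt]

lemma mul_mem_wordFilt {D E : ℕ} {x y : A} (hx : x ∈ wordFilt k t w D)
    (hy : y ∈ wordFilt k t w (E + 1)) : x * y ∈ wordFilt k t w (D + E) := by
  have : wordFilt k t w D * wordFilt k t w (E + 1) ≤ wordFilt k t w (D + E) := by
    rw [wordFilt, wordFilt, Submodule.span_mul_span, Submodule.span_le]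
    rintro _ ⟨_, ⟨l, hl, rfl⟩, _, ⟨l', hl', rfl⟩, rfl⟩
    refine Submodule.subset_span ⟨l ++ l', ?_, by simp⟩
    simp only [List.map_append, List.sum_append]
    omega
  exact this (Submodule.mul_mem_mul hx hy)

lemma mul_mem_wordFilt' {D E : ℕ} {x y : A} (hx : x ∈ wordFilt k t w (D + 1))
    (hy : y ∈ wordFilt k t w E) : x * y ∈ wordFilt k t w (D + E) := by
  have : wordFilt k t w (D + 1) * wordFilt k t w E ≤ wordFilt k t w (D + E) := by
    rw [wordFilt, wordFilt, Submodule.span_mul_span, Submodule.span_le]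
    rintro _ ⟨_, ⟨l, hl, rfl⟩, _, ⟨l', hl', rfl⟩, rfl⟩
    refine Submodule.subset_span ⟨l ++ l', ?_, by simp⟩
    simp only [List.map_append, List.sum_append]
    omega
  exact this (Submodule.mul_mem_mul hx hy)

lemma wordMap_monomial (e : σ →₀ ℕ) (c : k) :
    wordMap k t (monomial e c) = c • ((Finsupp.toMultiset e).toList.map t).prod := by
  have : monomial e c = c • (basisMonomials σ k e) := by
    simp [smul_monomial]
  rw [this, map_smul, wordMap, Module.Basis.constr_basis]

lemma prod_map_X [DecidableEq σ] (l : List σ) :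
    (l.map (X : σ → MvPolynomial σ k)).prod
      = monomial (Multiset.toFinsupp (l : Multiset σ)) 1 := by
  induction l with
  | nil => simp
  | cons a l ih =>
    rw [List.map_cons, List.prod_cons, ih, ← Multiset.cons_coe, ← Multiset.singleton_add, map_add,
      Multiset.toFinsupp_singleton, X, monomial_mul, one_mul]

lemma weight_toFinsupp [DecidableEq σ] (l : List σ) :
    Finsupp.weight w (Multiset.toFinsupp (l : Multiset σ)) = (l.map w).sum := by
  induction l with
  | nil => simp
  | cons a l ih =>
    rw [← Multiset.cons_coe, ← Multiset.singleton_add, map_add, map_add, ih,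
      Multiset.toFinsupp_singleton]
    simp [Finsupp.weight_single]

lemma isWeightedHomogeneous_prod_X (l : List σ) :
    IsWeightedHomogeneous w (l.map (X : σ → MvPolynomial σ k)).prod (l.map w).sum := by
  classical
  rw [prod_map_X]
  exact isWeightedHomogeneous_monomial _ _ _ (weight_toFinsupp l)

variable (hc : ∀ a b, t a * t b - t b * t a ∈ wordFilt k t w (w a + w b))

include hc in
lemma word_perm_sub_mem {l l' : List σ} (h : l.Perm l') :
    (l.map t).prod - (l'.map t).prod ∈ wordFilt k t w (l.map w).sum := by
  have hs (a : σ) : t a ∈ wordFilt k t w (w a + 1) := by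
    simpa using word_mem_wordFilt (k := k) (t := t) (w := w) [a] (D := w a + 1) (by simp)
  induction h with
  | nil => simp
  | cons a h ih =>
    simp only [List.map_cons, List.prod_cons, List.sum_cons, ← mul_sub]
    exact mul_mem_wordFilt' (hs a) ih
  | swap a b l =>
    simp only [List.map_cons, List.prod_cons, List.sum_cons, ← mul_assoc, ← sub_mul]
    rw [← add_assoc]
    exact mul_mem_wordFilt (hc b a) (word_mem_wordFilt l (Nat.lt_succ_self _))
  | trans h1 h2 ih1 ih2 =>
    rw [← sub_add_sub_cancel]
    refine add_mem ih1 ?_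
    rwa [(h1.map w).sum_eq]

/-- `f` is the symbol in degree `D` of the element `y` of filtration degree `D`. -/
def IsSymb (k : Type*) {A σ : Type*} [Field k] [Ring A] [Algebra k A] (t : σ → A) (w : σ → ℕ)
    (D : ℕ) (y : A) (f : MvPolynomial σ k) : Prop :=
  IsWeightedHomogeneous w f D ∧ y - wordMap k t f ∈ wordFilt k t w D

namespace IsSymb

variable {D E : ℕ} {y z : A} {f g : MvPolynomial σ k}

lemma add (hy : IsSymb k t w D y f) (hz : IsSymb k t w D z g) :
    IsSymb k t w D (y + z) (f + g) := by
  refine ⟨hy.1.add hz.1, ?_⟩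
  rw [map_add, add_sub_add_comm]
  exact add_mem hy.2 hz.2

lemma smul (c : k) (hy : IsSymb k t w D y f) : IsSymb k t w D (c • y) (c • f) := by
  refine ⟨(weightedHomogeneousSubmodule k w D).smul_mem c hy.1, ?_⟩
  rw [map_smul, ← smul_sub]
  exact Submodule.smul_mem _ _ hy.2

lemma sub (hy : IsSymb k t w D y f) (hz : IsSymb k t w D z g) :
    IsSymb k t w D (y - z) (f - g) := by
  have := hy.add (hz.smul (-1))
  simpa [sub_eq_add_neg] using this

lemma of_mem (hy : y ∈ wordFilt k t w D) : IsSymb k t w D y 0 :=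
  ⟨isWeightedHomogeneous_zero k w D, by simpa using hy⟩

lemma mem_of_zero (hy : IsSymb k t w D y 0) : y ∈ wordFilt k t w D := by
  simpa using hy.2

lemma zero : IsSymb k t w D 0 0 := of_mem (zero_mem _)

lemma sum {ι : Type*} (s : Finset ι) {y : ι → A} {f : ι → MvPolynomial σ k}
    (h : ∀ i ∈ s, IsSymb k t w D (y i) (f i)) :
    IsSymb k t w D (∑ i ∈ s, y i) (∑ i ∈ s, f i) := by
  classical
  induction s using Finset.induction_on with
  | empty => simpa using zero
  | insert a s ha ih =>
    rw [Finset.sum_insert ha, Finset.sum_insert ha]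
    exact (h a (by simp)).add (ih fun i hi => h i (by simp [hi]))

lemma mem (hy : IsSymb k t w D y f) : y ∈ wordFilt k t w (D + 1) := by
  rw [← sub_add_cancel y (wordMap k t f)]
  refine add_mem (wordFilt_mono (Nat.le_succ D) hy.2) ?_
  rw [f.as_sum, map_sum]
  refine sum_mem fun e he => ?_
  rw [wordMap_monomial]
  refine Submodule.smul_mem _ _ (word_mem_wordFilt _ ?_)
  classical
  rw [← weight_toFinsupp]
  simp only [Multiset.coe_toList, Finsupp.toMultiset_toFinsupp]
  rw [hy.1 (mem_support_iff.1 he)]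
  exact Nat.lt_succ_self D

include hc in
lemma word (l : List σ) : IsSymb k t w (l.map w).sum (l.map t).prod (l.map X).prod := by
  classical
  refine ⟨isWeightedHomogeneous_prod_X l, ?_⟩
  rw [prod_map_X, wordMap_monomial, one_smul]
  refine word_perm_sub_mem hc ?_
  rw [← Multiset.coe_eq_coe]
  simp

lemma wordMap_self (hf : IsWeightedHomogeneous w f D) : IsSymb k t w D (wordMap k t f) f :=
  ⟨hf, by simp⟩

include hc in
lemma mul (hy : IsSymb k t w D y f) (hz : IsSymb k t w E z g) :
    IsSymb k t w (D + E) (y * z) (f * g) := by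
  classical
  have key : IsSymb k t w (D + E) (wordMap k t f * wordMap k t g) (f * g) := by
    have hf := f.as_sum
    have hg := g.as_sum
    generalize hF : (fun e => monomial e (coeff e f)) = F at hf
    generalize hG : (fun e => monomial e (coeff e g)) = G at hg
    conv in (f * g) => rw [hf, hg]
    conv in (wordMap k t f * wordMap k t g) => rw [hf, hg]
    rw [map_sum, map_sum, Finset.sum_mul_sum, Finset.sum_mul_sum]
    refine sum _ fun e he => sum _ fun e' he' => ?_
    simp only [← hF, ← hG, wordMap_monomial, smul_mul_smul_comm]
    have h := word hc ((Finsupp.toMultiset e).toList ++ (Finsupp.toMultiset e').toList)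
    simp only [List.map_append, List.prod_append, List.sum_append] at h
    rw [← weight_toFinsupp, ← weight_toFinsupp, prod_map_X, prod_map_X] at h
    simp only [Multiset.coe_toList, Finsupp.toMultiset_toFinsupp] at h
    rw [hy.1 (mem_support_iff.1 he), hz.1 (mem_support_iff.1 he')] at h
    convert h.smul (coeff e f * coeff e' g) using 1
    simp [smul_monomial, monomial_mul]
  refine ⟨key.1, ?_⟩
  have : y * z - wordMap k t (f * g) = (y - wordMap k t f) * z
      + wordMap k t f * (z - wordMap k t g)
      + (wordMap k t f * wordMap k t g - wordMap k t (f * g)) := by noncomm_ring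
  rw [this]
  exact add_mem (add_mem (mul_mem_wordFilt hy.2 hz.mem)
    (mul_mem_wordFilt' (wordMap_self hy.1).mem hz.2)) key.2

lemma one : IsSymb k t w 0 (1 : A) 1 := by
  refine ⟨isWeightedHomogeneous_one k w, ?_⟩
  have : (1 : MvPolynomial σ k) = monomial 0 1 := rfl
  rw [this, wordMap_monomial]
  simp

lemma of_lt (h : D < E) (hy : IsSymb k t w D y f) : IsSymb k t w E y 0 :=
  of_mem (wordFilt_mono h hy.mem)

end IsSymb

include hc in
lemma isSymb_gen (a : σ) : IsSymb k t w (w a) (t a) (X a) := by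
  simpa using IsSymb.word hc [a]

include hc in
lemma exists_isSymb {D : ℕ} {y : A} (hy : y ∈ wordFilt k t w (D + 1)) :
    ∃ f, IsSymb k t w D y f := by
  refine Submodule.span_induction ?_ ⟨0, IsSymb.zero⟩ ?_ ?_ hy
  · rintro _ ⟨l, hl, rfl⟩
    rcases Nat.lt_succ_iff_lt_or_eq.1 hl with h | h
    · exact ⟨0, IsSymb.of_mem (word_mem_wordFilt l h)⟩
    · exact ⟨_, h ▸ IsSymb.word hc l⟩
  · rintro x y _ _ ⟨f, hf⟩ ⟨g, hg⟩
    exact ⟨_, hf.add hg⟩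
  · rintro c x _ ⟨f, hf⟩
    exact ⟨_, hf.smul c⟩

include hc in
lemma exists_wordMap_eq {D : ℕ} {y : A} (hy : y ∈ wordFilt k t w D) :
    ∃ g : MvPolynomial σ k, wordMap k t g = y ∧ ∀ E, D ≤ E →
      weightedHomogeneousComponent w E g = 0 := by
  induction D generalizing y with
  | zero =>
    rw [wordFilt_zero, Submodule.mem_bot] at hy
    exact ⟨0, by simp [hy], by simp⟩
  | succ D ih =>
    obtain ⟨f, hf⟩ := exists_isSymb hc hy
    obtain ⟨g, hg, hg'⟩ := ih hf.2
    refine ⟨g + f, by rw [map_add, hg, sub_add_cancel], fun E hE => ?_⟩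
    rw [map_add, hg' E (by omega), zero_add, hf.1.weightedHomogeneousComponent_ne E (by omega)]

include hc in
/-- Uniqueness of symbols, given that the words attached to monomials are independent. -/
lemma IsSymb.eq_zero_of_mem (hinj : Function.Injective (wordMap k t)) {D : ℕ} {y : A}
    {f : MvPolynomial σ k} (h : IsSymb k t w D y f) (hy : y ∈ wordFilt k t w D) : f = 0 := by
  have : wordMap k t f ∈ wordFilt k t w D := by
    simpa using sub_mem hy h.2
  obtain ⟨g, hg, hg'⟩ := exists_wordMap_eq hc this
  rw [hinj hg] at hg'
  rw [← h.1.weightedHomogeneousComponent_same, hg' D le_rfl]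

lemma exists_mem_wordFilt (hgen : Algebra.adjoin k (Set.range t) = ⊤) (y : A) :
    ∃ D, y ∈ wordFilt k t w D := by
  have hy : y ∈ Algebra.adjoin k (Set.range t) := hgen ▸ Algebra.mem_top
  induction hy using Algebra.adjoin_induction with
  | mem x hx =>
    obtain ⟨a, rfl⟩ := hx
    exact ⟨w a + 1, by simpa using word_mem_wordFilt (k := k) (t := t) [a] (by simp)⟩
  | algebraMap r =>
    refine ⟨1, ?_⟩
    rw [Algebra.algebraMap_eq_smul_one]
    exact Submodule.smul_mem _ _ (by simpa using word_mem_wordFilt (k := k) (t := t) [] (by simp))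
  | add x y _ _ hx hy =>
    obtain ⟨D, hD⟩ := hx
    obtain ⟨E, hE⟩ := hy
    exact ⟨max D E, add_mem (wordFilt_mono (le_max_left _ _) hD)
      (wordFilt_mono (le_max_right _ _) hE)⟩
  | mul x y _ _ hx hy =>
    obtain ⟨D, hD⟩ := hx
    obtain ⟨E, hE⟩ := hy
    exact ⟨D + E, mul_mem_wordFilt hD (wordFilt_mono (Nat.le_succ _) hE)⟩

include hc in
lemma wordMap_surjective (hgen : Algebra.adjoin k (Set.range t) = ⊤) :
    Function.Surjective (wordMap k t) := fun y => by
  obtain ⟨D, hD⟩ := exists_mem_wordFilt (w := w) hgen y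
  obtain ⟨g, hg, -⟩ := exists_wordMap_eq hc hD
  exact ⟨g, hg⟩

end WordFiltration

end

section

open MvPolynomial

section SymbolBasis

variable {k A σ : Type*} [Field k] [Ring A] [Algebra k A] {t : σ → A} {w : σ → ℕ}
variable (hc : ∀ a b, t a * t b - t b * t a ∈ wordFilt k t w (w a + w b))

include hc in
/-- Elements whose symbols are linearly independent are linearly independent. -/
lemma linearIndependent_of_isSymb (hinj : Function.Injective (wordMap k t)) {ι : Type*}
    {e : ι → MvPolynomial σ k} (he : LinearIndependent k e) {d : ι → ℕ} {y : ι → A}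
    (h : ∀ i, IsSymb k t w (d i) (y i) (e i)) : LinearIndependent k y := by
  classical
  rw [linearIndependent_iff']
  intro s c hs i hi
  by_contra hne
  obtain ⟨m, hm, hmax⟩ := (s.filter (fun j => c j ≠ 0)).exists_max_image d
    ⟨i, Finset.mem_filter.2 ⟨hi, hne⟩⟩
  rw [Finset.mem_filter] at hm
  have hsym : IsSymb k t w (d m) (∑ j ∈ s, c j • y j)
      (∑ j ∈ s, (if d j = d m then c j else 0) • e j) := by
    refine IsSymb.sum _ fun j hj => ?_
    rcases lt_trichotomy (d j) (d m) with hlt | heq | hgt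
    · rw [if_neg hlt.ne, zero_smul]
      exact ((h j).smul (c j)).of_lt hlt
    · rw [if_pos heq, ← heq]
      exact (h j).smul (c j)
    · have : c j = 0 := by
        by_contra hcj
        exact absurd (hmax j (Finset.mem_filter.2 ⟨hj, hcj⟩)) (not_le.2 hgt)
      simpa [this] using IsSymb.zero
  rw [hs] at hsym
  have h0 := hsym.eq_zero_of_mem hc hinj (zero_mem _)
  have := linearIndependent_iff'.1 he s _ h0 m hm.1
  simp only [if_true] at this
  exact hm.2 this

include hc in
/-- Elements whose symbols span span. -/
lemma span_eq_top_of_isSymb (hgen : Algebra.adjoin k (Set.range t) = ⊤) {ι : Type*}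
    {e : ι → MvPolynomial σ k} (he : Submodule.span k (Set.range e) = ⊤) {d : ι → ℕ} {y : ι → A}
    (h : ∀ i, IsSymb k t w (d i) (y i) (e i)) : Submodule.span k (Set.range y) = ⊤ := by
  classical
  rw [eq_top_iff]
  rintro x -
  obtain ⟨D, hD⟩ := exists_mem_wordFilt (w := w) hgen x
  induction D generalizing x with
  | zero =>
    rw [wordFilt_zero, Submodule.mem_bot] at hD
    simp [hD]
  | succ D ih =>
    obtain ⟨f, hf⟩ := exists_isSymb hc hD
    have hfm : f ∈ Submodule.span k (Set.range e) := he ▸ Submodule.mem_top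
    obtain ⟨c, rfl⟩ := (Finsupp.mem_span_range_iff_exists_finsupp).1 hfm
    have hsym : IsSymb k t w D (∑ i ∈ c.support, (if d i = D then c i else 0) • y i)
        (∑ i ∈ c.support, (if d i = D then c i else 0) • e i) := by
      refine IsSymb.sum _ fun i _ => ?_
      split_ifs with hi
      · exact hi ▸ (h i).smul (c i)
      · simpa using IsSymb.zero
    have heq : (c.sum fun i a => a • e i)
        = ∑ i ∈ c.support, (if d i = D then c i else 0) • e i := by
      rw [← hf.1.weightedHomogeneousComponent_same, Finsupp.sum, map_sum]
      refine Finset.sum_congr rfl fun i _ => ?_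
      rw [map_smul]
      split_ifs with hi
      · subst hi
        rw [(h i).1.weightedHomogeneousComponent_same]
      · rw [(h i).1.weightedHomogeneousComponent_ne D (Ne.symm hi), smul_zero, zero_smul]
    rw [heq] at hf
    have := hf.sub hsym
    rw [sub_self] at this
    have := ih this.mem_of_zero
    rw [← sub_add_cancel x (∑ i ∈ c.support, (if d i = D then c i else 0) • y i)]
    refine add_mem this (sum_mem fun i _ => Submodule.smul_mem _ _ (Submodule.subset_span ⟨i, rfl⟩))

end SymbolBasis

section SymbolDerivation

variable {k A σ : Type*} [Field k] [Ring A] [Algebra k A] {t : σ → A} {w : σ → ℕ}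
variable (hc : ∀ a b, t a * t b - t b * t a ∈ wordFilt k t w (w a + w b))
variable {x : A} {v : ℕ} {lam : σ → MvPolynomial σ k}
  (hx : ∀ b, IsSymb k t w (v + w b) (x * t b - t b * x) (lam b))

include hc hx in
lemma isSymb_commutator_word (l : List σ) :
    IsSymb k t w (v + (l.map w).sum) (x * (l.map t).prod - (l.map t).prod * x)
      (mkDerivation k lam (l.map X).prod) := by
  induction l with
  | nil => simpa using IsSymb.zero
  | cons b l ih =>
    simp only [List.map_cons, List.prod_cons, List.sum_cons, Derivation.leibniz, mkDerivation_X,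
      smul_eq_mul]
    have h1 := (hx b).mul hc (IsSymb.word hc l)
    have h2 := (isSymb_gen hc b).mul hc ih
    rw [show w b + (v + (l.map w).sum) = v + w b + (l.map w).sum by ring] at h2
    have := h2.add h1
    rw [← add_assoc]
    convert this using 1
    · noncomm_ring
    · ring

include hc hx in
lemma commutator_mem_wordFilt {E : ℕ} {y : A} (hy : y ∈ wordFilt k t w E) :
    x * y - y * x ∈ wordFilt k t w (v + E) := by
  refine Submodule.span_induction ?_ (by simp) ?_ ?_ hy
  · rintro _ ⟨l, hl, rfl⟩
    exact wordFilt_mono (by omega) (isSymb_commutator_word hc hx l).mem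
  · intro a b _ _ ha hb
    convert add_mem ha hb using 1
    noncomm_ring
  · intro c a _ ha
    convert Submodule.smul_mem _ c ha using 1
    simp [smul_sub]

include hc hx in
/-- The symbol of a commutator with `x` is given by a derivation. -/
lemma IsSymb.commutator {E : ℕ} {y : A} {f : MvPolynomial σ k} (hy : IsSymb k t w E y f) :
    IsSymb k t w (v + E) (x * y - y * x) (mkDerivation k lam f) := by
  classical
  have h1 : IsSymb k t w (v + E) (x * wordMap k t f - wordMap k t f * x)
      (mkDerivation k lam f) := by
    have hf := f.as_sum
    generalize hF : (fun e => monomial e (coeff e f)) = F at hf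
    conv in (mkDerivation k lam f) => rw [hf]
    conv in (x * wordMap k t f) => rw [hf]
    conv in (wordMap k t f * x) => rw [hf]
    rw [map_sum, map_sum, Finset.mul_sum, Finset.sum_mul, ← Finset.sum_sub_distrib]
    refine IsSymb.sum _ fun e he => ?_
    have h := isSymb_commutator_word hc hx (Finsupp.toMultiset e).toList
    rw [← weight_toFinsupp, prod_map_X] at h
    simp only [Multiset.coe_toList, Finsupp.toMultiset_toFinsupp] at h
    rw [hy.1 (mem_support_iff.1 he)] at h
    have h := h.smul (coeff e f)
    rw [← Derivation.map_smul, smul_monomial, smul_eq_mul, mul_one] at h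
    simpa only [← hF, wordMap_monomial, mul_smul_comm, smul_mul_assoc, ← smul_sub] using h
  have h2 := IsSymb.of_mem (commutator_mem_wordFilt hc hx hy.2)
  convert h1.add h2 using 1
  · noncomm_ring
  · simp

end SymbolDerivation

section SymbolAdjoin

variable {k A σ : Type*} [Field k] [Ring A] [Algebra k A] {t : σ → A} {w : σ → ℕ}
variable (hc : ∀ a b, t a * t b - t b * t a ∈ wordFilt k t w (w a + w b))

include hc in
lemma exists_isSymb_of_mem_adjoin {ι : Type*} {z : ι → A} {ζ : ι → MvPolynomial σ k} {W : ι → ℕ}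
    (hz : ∀ i, IsSymb k t w (W i) (z i) (ζ i)) {f : MvPolynomial σ k}
    (hf : f ∈ Algebra.adjoin k (Set.range ζ)) (D : ℕ) :
    ∃ y ∈ Algebra.adjoin k (Set.range z),
      IsSymb k t w D y (weightedHomogeneousComponent w D f) := by
  rw [← Subalgebra.mem_toSubmodule, Algebra.adjoin_eq_span] at hf
  induction hf using Submodule.span_induction with
  | zero => exact ⟨0, zero_mem _, by simpa using IsSymb.zero⟩
  | add f g _ _ hf hg =>
    obtain ⟨y, hy, hy'⟩ := hf
    obtain ⟨y₁, hy₁, hy₁'⟩ := hg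
    exact ⟨y + y₁, add_mem hy hy₁, by simpa using hy'.add hy₁'⟩
  | smul c f _ hf =>
    obtain ⟨y, hy, hy'⟩ := hf
    exact ⟨c • y, Subalgebra.smul_mem _ hy c, by simpa using hy'.smul c⟩
  | mem f hf =>
    have : ∃ E, ∃ y ∈ Algebra.adjoin k (Set.range z), IsSymb k t w E y f := by
      induction hf using Submonoid.closure_induction with
      | mem f hf =>
        obtain ⟨i, rfl⟩ := hf
        exact ⟨W i, z i, Algebra.subset_adjoin ⟨i, rfl⟩, hz i⟩
      | one => exact ⟨0, 1, one_mem _, IsSymb.one⟩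
      | mul f g _ _ hf hg =>
        obtain ⟨E, y, hy, hy'⟩ := hf
        obtain ⟨E₁, y₁, hy₁, hy₁'⟩ := hg
        exact ⟨E + E₁, y * y₁, mul_mem hy hy₁, hy'.mul hc hy₁'⟩
    obtain ⟨E, y, hy, hy'⟩ := this
    by_cases h : D = E
    · subst h
      exact ⟨y, hy, by rwa [hy'.1.weightedHomogeneousComponent_same]⟩
    · refine ⟨0, zero_mem _, ?_⟩
      rw [hy'.1.weightedHomogeneousComponent_ne D h]
      exact IsSymb.zero

include hc in
/-- A subalgebra whose elements have symbols in the algebra generated by the symbols of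
some of its elements is generated by these elements. -/
lemma le_adjoin_of_isSymb (hgen : Algebra.adjoin k (Set.range t) = ⊤)
    {ι : Type*} {z : ι → A} {ζ : ι → MvPolynomial σ k} {W : ι → ℕ}
    (hz : ∀ i, IsSymb k t w (W i) (z i) (ζ i)) (S : Subalgebra k A) (hzS : ∀ i, z i ∈ S)
    (hS : ∀ y ∈ S, ∀ D f, IsSymb k t w D y f → f ∈ Algebra.adjoin k (Set.range ζ)) :
    S ≤ Algebra.adjoin k (Set.range z) := by
  intro y hy
  obtain ⟨D, hD⟩ := exists_mem_wordFilt (w := w) hgen y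
  induction D generalizing y with
  | zero =>
    rw [wordFilt_zero, Submodule.mem_bot] at hD
    simp [hD]
  | succ D ih =>
    obtain ⟨f, hf⟩ := exists_isSymb hc hD
    obtain ⟨y₁, hy₁, hs⟩ := exists_isSymb_of_mem_adjoin hc hz (hS y hy D f hf) D
    rw [hf.1.weightedHomogeneousComponent_same] at hs
    have hle : Algebra.adjoin k (Set.range z) ≤ S :=
      Algebra.adjoin_le (by rintro _ ⟨i, rfl⟩; exact hzS i)
    have h0 := hf.sub hs
    rw [sub_self] at h0
    have := ih (sub_mem hy (hle hy₁)) h0.mem_of_zero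
    simpa using add_mem this hy₁

end SymbolAdjoin

end

section

section RTT

variable {B : Type*} [Ring B] {n : ℕ}

/-- The `RTT` relation between two matrices, with spectral coefficients `w` and `e`. -/
def IsRTT (w e : B) (U V : Matrix (Fin n) (Fin n) B) : Prop :=
  ∀ i j k l, w * (U i j * V k l - V k l * U i j) = e * (U k j * V i l - V k j * U i l)

lemma IsRTT.mul {w e : B} {U V U' V' : Matrix (Fin n) (Fin n) B}
    (hw : ∀ b, Commute w b) (he : ∀ b, Commute e b) (h : IsRTT w e U V) (h' : IsRTT w e U' V')
    (h₁ : ∀ i j k l, Commute (U' i j) (V k l)) (h₂ : ∀ i j k l, Commute (U i j) (V' k l)) :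
    IsRTT w e (U * U') (V * V') := by
  intro i j k l
  have term (a b : Fin n) :
      w * ((U i a * U' a j) * (V k b * V' b l) - (V k b * V' b l) * (U i a * U' a j))
        = e * ((U k a * U' a j) * (V i b * V' b l)) - e * (V k a * U i b * (U' a j * V' b l))
          + e * (V k b * U i a * (U' b j * V' a l))
          - e * ((V k b * V' b j) * (U i a * U' a l)) := by
    have e1 : (U i a * U' a j) * (V k b * V' b l) = U i a * V k b * (U' a j * V' b l) := by
      rw [mul_assoc, ← mul_assoc (U' a j), (h₁ a j k b).eq]; simp only [mul_assoc]
    have e2 : (V k b * V' b l) * (U i a * U' a j) = V k b * U i a * (V' b l * U' a j) := by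
      rw [mul_assoc, ← mul_assoc (V' b l), ← (h₂ i a b l).eq]; simp only [mul_assoc]
    have e3 : (U k a * U' a j) * (V i b * V' b l) = U k a * V i b * (U' a j * V' b l) := by
      rw [mul_assoc, ← mul_assoc (U' a j), (h₁ a j i b).eq]; simp only [mul_assoc]
    have e4 : (V k b * V' b j) * (U i a * U' a l) = V k b * U i a * (V' b j * U' a l) := by
      rw [mul_assoc, ← mul_assoc (V' b j), ← (h₂ i a b j).eq]; simp only [mul_assoc]
    rw [e1, e2, e3, e4]
    have s1 : w * (U i a * V k b * (U' a j * V' b l) - V k b * U i a * (V' b l * U' a j))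
        = w * (U i a * V k b - V k b * U i a) * (U' a j * V' b l)
          + V k b * U i a * (w * (U' a j * V' b l - V' b l * U' a j)) := by
      rw [← mul_assoc (V k b * U i a) w, ← (hw (V k b * U i a)).eq]
      noncomm_ring
    rw [s1, h, h', ← mul_assoc (V k b * U i a) e, ← (he (V k b * U i a)).eq]
    noncomm_ring
  simp only [Matrix.mul_apply, Finset.sum_mul_sum]
  rw [Finset.sum_comm (f := fun b a => V k b * V' b l * (U i a * U' a j)),
    ← Finset.sum_sub_distrib, Finset.mul_sum]
  simp_rw [← Finset.sum_sub_distrib, Finset.mul_sum, term]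
  simp_rw [Finset.sum_sub_distrib, Finset.sum_add_distrib, Finset.sum_sub_distrib]
  rw [Finset.sum_comm (f := fun a b => e * (V k b * U i a * (U' b j * V' a l))), sub_add_cancel,
    Finset.sum_comm (f := fun a b => e * (V k b * V' b j * (U i a * U' a l)))]
  simp only [mul_sub, Finset.sum_sub_distrib]

lemma isRTT_one (w e : B) : IsRTT w e (1 : Matrix (Fin n) (Fin n) B) 1 := by
  intro i j k l
  simp only [Matrix.one_apply]
  split_ifs <;> simp

/-- The relations of the generators of `gl_n`. -/
def IsGl (E : Matrix (Fin n) (Fin n) B) : Prop :=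
  ∀ i j k l, E i j * E k l - E k l * E i j
    = (if k = j then E i l else 0) - (if i = l then E k j else 0)

lemma isRTT_one_add {x y : B} (hx : ∀ b, Commute x b) (hy : ∀ b, Commute y b)
    {E : Matrix (Fin n) (Fin n) B} (hE : IsGl E) :
    IsRTT (y - x) (x * y) (1 + x • E) (1 + y • E) := by
  intro i j k l
  have key : (1 + x • E) i j * (1 + y • E) k l - (1 + y • E) k l * (1 + x • E) i j
      = (x * y) * (E i j * E k l - E k l * E i j) := by
    have h1 : x * E i j * (y * E k l) = x * y * (E i j * E k l) := by
      rw [mul_assoc, ← mul_assoc (E i j), ← (hy (E i j)).eq]; simp only [mul_assoc]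
    have h2 : y * E k l * (x * E i j) = x * y * (E k l * E i j) := by
      rw [mul_assoc, ← mul_assoc (E k l), ← (hx (E k l)).eq, (hx y).eq]; simp only [mul_assoc]
    simp only [Matrix.add_apply, Matrix.smul_apply, smul_eq_mul, Matrix.one_apply, add_mul,
      mul_add, h1, h2]
    split_ifs <;> noncomm_ring
  have key2 : (1 + x • E) k j * (1 + y • E) i l - (1 + y • E) k j * (1 + x • E) i l
      = (y - x) * ((if k = j then E i l else 0) - (if i = l then E k j else 0)) := by
    have h1 : x * E k j * (y * E i l) = y * E k j * (x * E i l) := by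
      rw [mul_assoc, ← mul_assoc (E k j), ← (hy (E k j)).eq, mul_assoc, mul_assoc,
        ← mul_assoc (E k j), ← (hx (E k j)).eq, ← mul_assoc, ← mul_assoc, ← mul_assoc,
        (hx y).eq]
      simp only [mul_assoc]
    simp only [Matrix.add_apply, Matrix.smul_apply, smul_eq_mul, Matrix.one_apply, add_mul,
      mul_add, h1]
    split_ifs <;> noncomm_ring
  have hc : Commute (y - x) (x * y) := ((hy _).sub_left (hx _))
  rw [key, key2, hE, ← mul_assoc (y - x), hc.eq, mul_assoc]

end RTT

section Coefficients

variable {A : Type*} [Ring A] {n : ℕ}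

/-- The difference form of the Yangian relations implies the standard one. -/
lemma commutator_eq_sum {c : ℕ → Matrix (Fin n) (Fin n) A} (hc0 : c 0 = 1)
    (hc : ∀ r s i j k l,
      (c (r + 1) i j * c s k l - c s k l * c (r + 1) i j)
        - (c r i j * c (s + 1) k l - c (s + 1) k l * c r i j)
        = c r k j * c s i l - c s k j * c r i l) (r s : ℕ) (i j k l : Fin n) :
    c r i j * c s k l - c s k l * c r i j
      = ∑ a ∈ Finset.Icc 1 (min r s),
        (c (a - 1) k j * c (r + s - a) i l - c (r + s - a) k j * c (a - 1) i l) := by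
  rcases le_total r s with h | h
  · rw [min_eq_left h]
    clear h
    induction r generalizing s with
    | zero =>
      rw [hc0, Matrix.one_apply]
      split_ifs <;> simp
    | succ r ih =>
      rw [Finset.sum_Icc_succ_top (by omega), ← sub_add_cancel (c (r + 1) i j * c s k l - _)
        (c r i j * c (s + 1) k l - c (s + 1) k l * c r i j), hc, ih, add_comm]
      congr 1
      · refine Finset.sum_congr rfl fun a _ => ?_
        rw [show r + (s + 1) - a = r + 1 + s - a by omega]
      · rw [show r + 1 - 1 = r by omega, show r + 1 + s - (r + 1) = s by omega]
  · rw [min_eq_right h]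
    clear h
    induction s generalizing r with
    | zero =>
      rw [hc0, Matrix.one_apply]
      split_ifs <;> simp
    | succ s ih =>
      rw [Finset.sum_Icc_succ_top (by omega)]
      have h1 := hc r s i j k l
      rw [ih (r + 1)] at h1
      rw [sub_eq_iff_eq_add, ← sub_eq_iff_eq_add'] at h1
      rw [← h1, sub_eq_add_neg, neg_sub]
      congr 1
      · refine Finset.sum_congr rfl fun a _ => ?_
        rw [show r + 1 + s - a = r + (s + 1) - a by omega]
      · rw [show s + 1 - 1 = s by omega, show r + (s + 1) - (s + 1) = r by omega]

open Polynomial in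
/-- Extraction of coefficients from the `RTT` relation. -/
lemma coeff_of_isRTT {T : Matrix (Fin n) (Fin n) A[X]}
    (h : IsRTT (X - C X : A[X][X]) (C X * X) (T.map C) (T.map (mapRingHom C))) (r s : ℕ)
    (i j k l : Fin n) :
    ((T i j).coeff (r + 1) * (T k l).coeff s - (T k l).coeff s * (T i j).coeff (r + 1))
        - ((T i j).coeff r * (T k l).coeff (s + 1) - (T k l).coeff (s + 1) * (T i j).coeff r)
      = (T k j).coeff r * (T i l).coeff s - (T k j).coeff s * (T i l).coeff r := by
  have := congrArg (fun f => (f.coeff (s + 1)).coeff (r + 1)) (h i j k l)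
  simpa [sub_mul, mul_assoc, coeff_X_mul] using this

end Coefficients

end

section

section MonodromyMatrix

variable {A : Type*} [Ring A] {n : ℕ}

/-- The coefficients of the product `(u + E (q - 1)) ⋯ (u + E 0)`. -/
def monodromyCoeff (E : ℕ → Matrix (Fin n) (Fin n) A) : ℕ → ℕ → Matrix (Fin n) (Fin n) A
  | 0, 0 => 1
  | 0, _ + 1 => 0
  | q + 1, 0 => monodromyCoeff E q 0
  | q + 1, r + 1 => monodromyCoeff E q (r + 1) + E q * monodromyCoeff E q r

variable (E : ℕ → Matrix (Fin n) (Fin n) A)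

@[simp]
lemma monodromyCoeff_zero_right (q : ℕ) : monodromyCoeff E q 0 = 1 := by
  induction q with
  | zero => rfl
  | succ q ih => exact ih

lemma monodromyCoeff_succ_succ (q r : ℕ) : monodromyCoeff E (q + 1) (r + 1)
    = monodromyCoeff E q (r + 1) + E q * monodromyCoeff E q r := rfl

lemma monodromyCoeff_of_lt {q r : ℕ} (h : q < r) : monodromyCoeff E q r = 0 := by
  induction q generalizing r with
  | zero =>
    obtain ⟨r, rfl⟩ := Nat.exists_eq_succ_of_ne_zero h.ne'
    rfl
  | succ q ih =>
    obtain ⟨r, rfl⟩ := Nat.exists_eq_succ_of_ne_zero (Nat.ne_of_gt (Nat.zero_lt_of_lt h))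
    rw [Nat.succ_eq_add_one, monodromyCoeff_succ_succ, ih (by omega), ih (by omega), mul_zero,
      add_zero]

open Polynomial

/-- The matrix `(1 + X E (q - 1)) ⋯ (1 + X E 0)`. -/
def monodromyRev : ℕ → Matrix (Fin n) (Fin n) A[X]
  | 0 => 1
  | q + 1 => (1 + (X : A[X]) • (E q).map C) * monodromyRev q

lemma coeff_monodromyRev (q r : ℕ) (i j : Fin n) :
    (monodromyRev E q i j).coeff r = monodromyCoeff E q r i j := by
  induction q generalizing r i j with
  | zero =>
    cases r with
    | zero => simp [monodromyRev, Matrix.one_apply]; split_ifs <;> simp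
    | succ r =>
      simp only [monodromyRev, monodromyCoeff, Matrix.one_apply, Matrix.zero_apply]
      split_ifs <;> simp [coeff_one]
  | succ q ih =>
    have h : monodromyRev E (q + 1) i j = monodromyRev E q i j
        + X * ∑ a, C (E q i a) * monodromyRev E q a j := by
      rw [monodromyRev, add_mul, one_mul, Matrix.add_apply, Matrix.smul_mul, Matrix.smul_apply,
        smul_eq_mul, Matrix.mul_apply]
      simp
    cases r with
    | zero => rw [h]; simp [ih]
    | succ r =>
      rw [h, monodromyCoeff_succ_succ, Matrix.add_apply, Matrix.mul_apply]
      simp [ih, coeff_X_mul]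

variable {E}

lemma commute_monodromyCoeff {x : A} {q : ℕ} (h : ∀ q' < q, ∀ i j, Commute x (E q' i j))
    (r : ℕ) (i j : Fin n) : Commute x (monodromyCoeff E q r i j) := by
  induction q generalizing r i j with
  | zero =>
    cases r with
    | zero =>
      rw [monodromyCoeff, Matrix.one_apply]
      split_ifs <;> simp
    | succ r => simp [monodromyCoeff]
  | succ q ih =>
    cases r with
    | zero =>
      rw [monodromyCoeff_zero_right, Matrix.one_apply]
      split_ifs <;> simp
    | succ r =>
      rw [monodromyCoeff_succ_succ, Matrix.add_apply, Matrix.mul_apply]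
      have h' : ∀ q' < q, ∀ i j, Commute x (E q' i j) := fun q' hq' => h q' (by omega)
      exact (ih h' _ _ _).add_right (Commute.sum_right _ _ _ fun a _ =>
        (h q (by omega) i a).mul_right (ih h' _ _ _))

lemma isGl_map {B : Type*} [Ring B] {M : Matrix (Fin n) (Fin n) A} (h : IsGl M) (φ : A →+* B) :
    IsGl (M.map φ) := by
  intro i j k l
  have := congrArg φ (h i j k l)
  simp only [map_sub, map_mul, apply_ite φ, map_zero] at this
  simpa using this

lemma monodromyCoeff_eq_sum (hE : ∀ q, IsGl (E q))
    (hE' : ∀ q q', q ≠ q' → ∀ i j k l, Commute (E q i j) (E q' k l)) (p r s : ℕ)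
    (i j k l : Fin n) :
    monodromyCoeff E p r i j * monodromyCoeff E p s k l
        - monodromyCoeff E p s k l * monodromyCoeff E p r i j
      = ∑ a ∈ Finset.Icc 1 (min r s),
        (monodromyCoeff E p (a - 1) k j * monodromyCoeff E p (r + s - a) i l
          - monodromyCoeff E p (r + s - a) k j * monodromyCoeff E p (a - 1) i l) := by
  refine commutator_eq_sum (monodromyCoeff_zero_right E p) ?_ r s i j k l
  intro r s i j k l
  simp only [← coeff_monodromyRev]
  refine coeff_of_isRTT ?_ r s i j k l
  clear r s i j k l
  have hX : ∀ b : A[X][X], Commute X b := fun b => Polynomial.commute_X b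
  have hCX : ∀ b : A[X][X], Commute (C X) b := fun b => by
    ext1 m
    rw [coeff_C_mul, coeff_mul_C]
    exact Polynomial.commute_X _
  induction p with
  | zero =>
    have h1 : (monodromyRev E 0).map C = (1 : Matrix (Fin n) (Fin n) A[X][X]) := by
      simp [monodromyRev]
    have h2 : (monodromyRev E 0).map (mapRingHom C) = (1 : Matrix (Fin n) (Fin n) A[X][X]) := by
      simp [monodromyRev, -coe_mapRingHom]
    rw [h1, h2]
    exact isRTT_one _ _
  | succ p ih =>
    have hcomm (i j k l : Fin n) (m : ℕ) :
        Commute ((monodromyRev E p i j).coeff m) (E p k l) := by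
      rw [coeff_monodromyRev]
      exact (commute_monodromyCoeff (fun q' hq' i j => hE' p q' (by omega) k l i j) m i j).symm
    have h1 : (monodromyRev E (p + 1)).map C
        = (1 + (C X : A[X][X]) • ((E p).map C).map C) * (monodromyRev E p).map C := by
      refine Matrix.ext fun i j => ?_
      simp [monodromyRev, Matrix.mul_apply, Matrix.add_apply, Matrix.one_apply,
        apply_ite (C : A[X] →+* A[X][X])]
      exact Finset.sum_congr rfl fun a _ => by rw [(hCX (C (C (E p i a)))).eq]
    have h2 : (monodromyRev E (p + 1)).map (mapRingHom C)
        = (1 + (X : A[X][X]) • ((E p).map C).map C)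
          * (monodromyRev E p).map (mapRingHom C) := by
      refine Matrix.ext fun i j => ?_
      simp only [monodromyRev, Matrix.mul_apply, Matrix.add_apply, Matrix.one_apply,
        Matrix.map_apply, Matrix.smul_apply, map_sum, map_mul, map_add, smul_eq_mul]
      refine Finset.sum_congr rfl fun a _ => ?_
      simp [apply_ite (mapRingHom (C : A →+* A[X]))]
    rw [h1, h2]
    refine IsRTT.mul (fun b => (hX b).sub_left (hCX b)) (fun b => (hCX b).mul_left (hX b))
      (isRTT_one_add hCX hX (isGl_map (isGl_map (hE p) C) C)) ih ?_ ?_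
    · intro i j k l
      simp only [Matrix.add_apply, Matrix.one_apply, Matrix.map_apply, Matrix.smul_apply,
        smul_eq_mul]
      refine Commute.add_right (by split_ifs <;> simp) (((hX _).symm).mul_right ?_)
      rw [Commute, SemiconjBy, ← C_mul, ← C_mul]
      congr 1
      ext m
      rw [coeff_mul_C, coeff_C_mul]
      exact hcomm i j k l m
    · intro i j k l
      simp only [Matrix.add_apply, Matrix.one_apply, Matrix.map_apply, Matrix.smul_apply,
        smul_eq_mul]
      refine Commute.add_left (by split_ifs <;> simp) ((hCX _).mul_left ?_)
      ext m m'
      simp only [coe_mapRingHom, coeff_C_mul, coeff_mul_C, coeff_map, coeff_C]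
      split_ifs
      · rw [(hcomm k l i j m).eq]
      · simp

end MonodromyMatrix

namespace Yangian

variable {k : Type*} [Field k] {n p : ℕ}

/-- The generator `t_ij^(r)`, for all `r`. -/
def gen (k : Type*) [Field k] (n p : ℕ) (i j : Fin n) (r : ℕ) : Yangian k n p :=
  RingQuot.mkAlgHom k (YangianRel k n p) (tGen k n p i j r)

lemma gen_zero (i j : Fin n) : gen k n p i j 0 = if i = j then 1 else 0 := by
  rw [gen, tGen, dif_neg (by simp), if_pos rfl]
  split_ifs
  · exact map_one _
  · exact map_zero _

lemma gen_of_lt (i j : Fin n) {r : ℕ} (h : p < r) : gen k n p i j r = 0 := by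
  rw [gen, tGen, dif_neg (by omega), if_neg (by omega)]
  exact map_zero _

lemma commutator_gen (i j l m : Fin n) (r s : ℕ) (hr : 1 ≤ r) (hrp : r ≤ p) (hs : 1 ≤ s)
    (hsp : s ≤ p) :
    gen k n p i j r * gen k n p l m s - gen k n p l m s * gen k n p i j r
      = ∑ a ∈ Finset.Icc 1 (min r s), (gen k n p l j (a - 1) * gen k n p i m (r + s - a)
        - gen k n p l j (r + s - a) * gen k n p i m (a - 1)) := by
  have h := RingQuot.mkAlgHom_rel k (YangianRel.rel (k := k) i j l m r s hr hrp hs hsp)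
  simp only [map_sub, map_mul, map_sum] at h
  exact h

/-- The chosen generators. -/
def letter (k : Type*) [Field k] (n p : ℕ) (a : Fin n × Fin n × Fin p) : Yangian k n p :=
  gen k n p a.1 a.2.1 (a.2.2 + 1)

lemma letter_eq (a : Fin n × Fin n × Fin p) :
    letter k n p a = RingQuot.mkAlgHom k (YangianRel k n p) (FreeAlgebra.ι k a) := by
  rw [letter, gen, tGen, dif_pos ⟨by omega, by omega⟩]
  rfl

lemma adjoin_letter : Algebra.adjoin k (Set.range (letter k n p)) = ⊤ := by
  have h1 : Set.range (letter k n p)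
      = (RingQuot.mkAlgHom k (YangianRel k n p)) '' (Set.range (FreeAlgebra.ι k)) := by
    rw [← Set.range_comp]
    exact congrArg Set.range (funext letter_eq)
  rw [h1]
  refine (AlgHom.map_adjoin (RingQuot.mkAlgHom k (YangianRel k n p)) _).symm.trans ?_
  rw [FreeAlgebra.adjoin_range_ι, Algebra.map_top]
  exact (AlgHom.range_eq_top _).2 (RingQuot.mkAlgHom_surjective _ _)

variable {A : Type*} [Ring A] [Algebra k A] {E : ℕ → Matrix (Fin n) (Fin n) A}

/-- The homomorphism defined by `p` commuting copies of `gl_n`. -/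
def monodromyHom (p : ℕ) (hE : ∀ q, IsGl (E q))
    (hE' : ∀ q q', q ≠ q' → ∀ i j k l, Commute (E q i j) (E q' k l)) :
    Yangian k n p →ₐ[k] A :=
  RingQuot.liftAlgHom k ⟨FreeAlgebra.lift k
    fun a : Fin n × Fin n × Fin p => monodromyCoeff E p (a.2.2 + 1) a.1 a.2.1, by
      have key (i j : Fin n) (r : ℕ) : FreeAlgebra.lift k
          (fun a : Fin n × Fin n × Fin p => monodromyCoeff E p (a.2.2 + 1) a.1 a.2.1)
            (tGen k n p i j r) = monodromyCoeff E p r i j := by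
        rw [tGen]
        split_ifs with h1 h2 h3
        · rw [FreeAlgebra.lift_ι_apply]
          simp [Nat.sub_add_cancel h1.1]
        · subst h2 h3
          simp
        · subst h2
          simp [h3]
        · rw [monodromyCoeff_of_lt E (by omega), map_zero, Matrix.zero_apply]
      rintro _ _ ⟨i, j, l, m, r, s, -, -, -, -⟩
      simp only [map_sub, map_mul, map_sum, key]
      exact monodromyCoeff_eq_sum hE hE' p r s i j l m⟩

lemma monodromyHom_gen (hE : ∀ q, IsGl (E q))
    (hE' : ∀ q q', q ≠ q' → ∀ i j k l, Commute (E q i j) (E q' k l)) (i j : Fin n) (r : ℕ) :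
    monodromyHom (k := k) p hE hE' (gen k n p i j r) = monodromyCoeff E p r i j := by
  rcases Nat.eq_zero_or_pos r with h | h
  · subst h
    rw [gen_zero, monodromyCoeff_zero_right, Matrix.one_apply]
    split_ifs <;> simp
  rcases Nat.lt_or_ge p r with h' | h'
  · rw [gen_of_lt _ _ h', monodromyCoeff_of_lt E h', map_zero, Matrix.zero_apply]
  · rw [gen, tGen, dif_pos ⟨h, h'⟩]
    refine (RingQuot.liftAlgHom_mkAlgHom_apply _ _ _ _).trans ?_
    rw [FreeAlgebra.lift_ι_apply]
    simp [Nat.sub_add_cancel h]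

end Yangian

end

section

section QuantumDeterminant

open Equiv

variable {B : Type*} [Ring B] {n : ℕ}

lemma exists_prod_ofFn_eq (f₀ : Fin (n + 1) → B) (i : Fin n) :
    ∃ L R : B, ∀ f : Fin (n + 1) → B, (∀ j, j ≠ i.castSucc → j ≠ i.succ → f j = f₀ j) →
      (List.ofFn f).prod = L * (f i.castSucc * f i.succ) * R := by
  induction n with
  | zero => exact i.elim0
  | succ n ih =>
    rcases Fin.eq_zero_or_eq_succ i with rfl | ⟨i, rfl⟩
    · refine ⟨1, (List.ofFn fun j : Fin n => f₀ j.succ.succ).prod, fun f hf => ?_⟩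
      rw [List.ofFn_succ, List.prod_cons, List.ofFn_succ, List.prod_cons]
      have : (fun j : Fin n => f j.succ.succ) = fun j : Fin n => f₀ j.succ.succ :=
        funext fun j => hf _ (by simp [Fin.ext_iff]) (by simp [Fin.ext_iff])
      rw [this]
      simp [mul_assoc]
    · obtain ⟨L, R, h⟩ := ih (fun j => f₀ j.succ) i
      refine ⟨f₀ 0 * L, R, fun f hf => ?_⟩
      rw [List.ofFn_succ, List.prod_cons, h (fun j => f j.succ), hf 0]
      · simp only [mul_assoc, Fin.castSucc_succ]
      · simp [Fin.ext_iff]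
      · simp [Fin.ext_iff]
      · intro j h1 h2
        exact hf _ (by simpa [Fin.ext_iff] using h1) (by simpa [Fin.ext_iff] using h2)

lemma prod_ofFn_mul {f g : Fin n → B} (h : ∀ i j, Commute (g i) (f j)) :
    (List.ofFn fun i => f i * g i).prod = (List.ofFn f).prod * (List.ofFn g).prod := by
  induction n with
  | zero => simp
  | succ n ih =>
    simp only [List.ofFn_succ, List.prod_cons]
    rw [ih fun i j => h i.succ j.succ]
    have : Commute (g 0) (List.ofFn fun i => f i.succ).prod := by
      refine Commute.list_prod_right _ _ fun x hx => ?_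
      obtain ⟨i, rfl⟩ := (List.mem_ofFn' _ _).1 hx
      exact h 0 i.succ
    rw [mul_assoc, ← mul_assoc (g 0), this.eq]
    simp only [mul_assoc]

lemma prod_ofFn_sum {ι : Type*} [Fintype ι] (f : Fin n → ι → B) :
    (List.ofFn fun i => ∑ a, f i a).prod = ∑ b : Fin n → ι, (List.ofFn fun i => f i (b i)).prod := by
  classical
  have := (MultilinearMap.mkPiAlgebraFin ℤ n B).map_sum (fun i a => f i a)
  simpa using this

lemma prod_ofFn_commutator (x : B) (f : Fin n → B) :
    x * (List.ofFn f).prod - (List.ofFn f).prod * x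
      = ∑ i, (List.ofFn (Function.update f i (x * f i - f i * x))).prod := by
  induction n with
  | zero => simp
  | succ n ih =>
    rw [Fin.sum_univ_succ]
    simp only [List.ofFn_succ, List.prod_cons, Function.update_self]
    have h1 : (fun i : Fin n => Function.update f 0 (x * f 0 - f 0 * x) i.succ)
        = fun i => f i.succ := funext fun i => by simp
    have h2 (i : Fin n) : (fun j : Fin n =>
        Function.update f i.succ (x * f i.succ - f i.succ * x) j.succ)
        = Function.update (fun j => f j.succ) i (x * f i.succ - f i.succ * x) := funext fun j => by
      by_cases h : j = i
      · subst h; simp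
      · simp [h, Function.update_of_ne]
    have h3 (i : Fin n) : Function.update f i.succ (x * f i.succ - f i.succ * x) 0 = f 0 :=
      Function.update_of_ne (Fin.succ_ne_zero i).symm _ _
    rw [h1]
    simp_rw [h2, h3]
    rw [← Finset.mul_sum, ← ih fun j => f j.succ]
    noncomm_ring

/-- Column version of the quantum determinant, with columns listed by `b`. -/
def qdetCol (V : Fin n → Matrix (Fin n) (Fin n) B) (b : Fin n → Fin n) : B :=
  ∑ σ : Perm (Fin n), (Perm.sign σ : ℤ) • (List.ofFn fun i => V i (σ i) (b i)).prod

/-- The quantum determinant of a sequence of matrices. -/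
def qdet (V : Fin n → Matrix (Fin n) (Fin n) B) : B := qdetCol V id

/-- The two-column antisymmetry of neighbouring matrices. -/
def IsQAlt (V : Fin n → Matrix (Fin n) (Fin n) B) : Prop :=
  ∀ i j : Fin n, (i : ℕ) + 1 = j → ∀ a c k l,
    V i a k * V j c l - V i c k * V j a l + (V i a l * V j c k - V i c l * V j a k) = 0

lemma isQAlt_of_isGl {E : Matrix (Fin n) (Fin n) B} (hE : IsGl E) {v : Fin n → B}
    (hv : ∀ i b, Commute (v i) b) (hv1 : ∀ i j : Fin n, (i : ℕ) + 1 = j → v i = v j + 1) :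
    IsQAlt fun i => v i • (1 : Matrix (Fin n) (Fin n) B) + E := by
  intro i j hij a c k l
  have h1 := hE a k c l
  have h2 := hE a l c k
  have h3 (x : B) : x * v j = v j * x := (hv j x).eq.symm
  simp only [Matrix.add_apply, Matrix.smul_apply, smul_eq_mul, Matrix.one_apply, hv1 i j hij]
  generalize E a k = e₁ at *
  generalize E c l = e₂ at *
  generalize E a l = e₃ at *
  generalize E c k = e₄ at *
  generalize v j = u at *
  split_ifs at * <;>
  simp only [mul_one, mul_zero, one_mul, mul_add, add_mul, h3, zero_add] <;>
  linear_combination (norm := noncomm_ring) h1 + h2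

lemma qdetCol_comp_swap {V : Fin (n + 1) → Matrix (Fin (n + 1)) (Fin (n + 1)) B} (hV : IsQAlt V)
    (b : Fin (n + 1) → Fin (n + 1)) (i : Fin n) :
    qdetCol V (b ∘ swap i.castSucc i.succ) = - qdetCol V b := by
  rw [eq_neg_iff_add_eq_zero, qdetCol, qdetCol, ← Finset.sum_add_distrib]
  have hne : i.castSucc ≠ i.succ := (Fin.castSucc_lt_succ (i := i)).ne
  set s := swap i.castSucc i.succ with hs
  have hs1 : s i.castSucc = i.succ := swap_apply_left _ _
  have hs2 : s i.succ = i.castSucc := swap_apply_right _ _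
  have hs3 : ∀ j, j ≠ i.castSucc → j ≠ i.succ → s j = j := fun j h1 h2 =>
    swap_apply_of_ne_of_ne h1 h2
  refine Finset.sum_involution (fun σ _ => σ * s) ?_ ?_ (by simp) ?_
  · intro σ _
    obtain ⟨L, R, h⟩ := exists_prod_ofFn_eq (fun j => V j (σ j) (b j)) i
    rw [h, h, h, h]
    · simp only [Function.comp, Perm.mul_apply, Perm.sign_mul, hs, Perm.sign_swap hne]
      have := hV i.castSucc i.succ (by simp) (σ i.castSucc) (σ i.succ) (b i.succ) (b i.castSucc)
      simp only [← hs, hs1, hs2]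
      have key : ∀ (ε : ℤ) (P Q R' S : B), P - R' + (Q - S) = 0 →
          ε • (L * P * R) + ε • (L * Q * R) + ((-ε) • (L * R' * R) + (-ε) • (L * S * R)) = 0 := by
        intro ε P Q R' S h0
        have : ε • (L * P * R) + ε • (L * Q * R) + ((-ε) • (L * R' * R) + (-ε) • (L * S * R))
            = ε • (L * (P - R' + (Q - S)) * R) := by
          simp only [neg_smul, mul_add, mul_sub, add_mul, sub_mul, smul_add, smul_sub]
          abel
        rw [this, h0]
        simp
      convert key (Perm.sign σ : ℤ) _ _ _ _ this using 3 <;> simp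
    · intro j h1 h2
      simp [hs3 j h1 h2]
    · intro j h1 h2
      simp [hs3 j h1 h2]
    · intro j h1 h2
      simp
    · intro j h1 h2
      simp [hs3 j h1 h2]
  · intro σ _ _ h
    have : s = 1 := by simpa using h
    exact hne (by rw [← hs1, this]; rfl)
  · intro σ _
    rw [mul_assoc, hs, swap_mul_self, mul_one]

lemma qdetCol_comp {V : Fin n → Matrix (Fin n) (Fin n) B} (hV : IsQAlt V)
    (b : Fin n → Fin n) (τ : Perm (Fin n)) :
    qdetCol V (b ∘ τ) = (Perm.sign τ : ℤ) • qdetCol V b := by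
  cases n with
  | zero =>
    rw [Subsingleton.elim τ 1]
    simp
  | succ n =>
    have hτ : τ ∈ Submonoid.closure
        (Set.range fun i : Fin n => swap i.castSucc i.succ) := by
      rw [Perm.mclosure_swap_castSucc_succ]
      trivial
    induction hτ using Submonoid.closure_induction generalizing b with
    | mem τ hτ =>
      obtain ⟨i, rfl⟩ := hτ
      simp only
      rw [qdetCol_comp_swap hV, Perm.sign_swap (Fin.castSucc_lt_succ (i := i)).ne]
      simp
    | one => simp
    | mul τ τ' _ _ h h' =>
      have : b ∘ ⇑(τ * τ') = (b ∘ τ) ∘ τ' := rfl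
      rw [this, h', h, Perm.sign_mul, smul_smul]
      congr 1
      simp [mul_comm]

lemma qdetCol_perm {V : Fin n → Matrix (Fin n) (Fin n) B} (hV : IsQAlt V) (τ : Perm (Fin n)) :
    qdetCol V τ = (Perm.sign τ : ℤ) • qdet V :=
  qdetCol_comp hV id τ

lemma qdetCol_of_not_injective (h2 : ∀ x : B, x + x = 0 → x = 0)
    {V : Fin n → Matrix (Fin n) (Fin n) B} (hV : IsQAlt V)
    {b : Fin n → Fin n} (hb : ¬ Function.Injective b) : qdetCol V b = 0 := by
  simp only [Function.Injective, not_forall] at hb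
  obtain ⟨i, j, hij, hne⟩ := hb
  have h := qdetCol_comp hV b (swap i j)
  have hbs : b ∘ swap i j = b := by
    ext x
    rcases eq_or_ne x i with rfl | hx
    · simp [hij]
    rcases eq_or_ne x j with rfl | hx'
    · simp [hij]
    · simp [swap_apply_of_ne_of_ne hx hx']
  rw [hbs, Perm.sign_swap hne] at h
  refine h2 _ ?_
  nth_rewrite 1 [h]
  simp

lemma qdet_mul (h2 : ∀ x : B, x + x = 0 → x = 0) {V W : Fin n → Matrix (Fin n) (Fin n) B}
    (hV : IsQAlt V) (hVW : ∀ i a b j c d, Commute (W i a b) (V j c d)) :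
    qdet (fun i => V i * W i) = qdet V * qdet W := by
  classical
  have h1 : qdet (fun i => V i * W i)
      = ∑ b : Fin n → Fin n, qdetCol V b * (List.ofFn fun i => W i (b i) i).prod := by
    simp only [qdet, qdetCol, Matrix.mul_apply, prod_ofFn_sum, Finset.smul_sum, id]
    rw [Finset.sum_comm]
    refine Finset.sum_congr rfl fun b _ => ?_
    rw [Finset.sum_mul]
    refine Finset.sum_congr rfl fun σ _ => ?_
    rw [prod_ofFn_mul fun i j => hVW _ _ _ _ _ _, smul_mul_assoc]
  rw [h1, ← Finset.sum_subset (Finset.subset_univ (Finset.univ.image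
    fun σ : Perm (Fin n) => (σ : Fin n → Fin n)))]
  · rw [Finset.sum_image fun _ _ _ _ h => Equiv.coe_fn_injective h]
    simp_rw [qdetCol_perm hV]
    rw [show qdet W = qdetCol W id from rfl, qdetCol, Finset.mul_sum]
    refine Finset.sum_congr rfl fun σ _ => ?_
    rw [smul_mul_assoc, mul_smul_comm]
    rfl
  · intro b _ hb
    rw [qdetCol_of_not_injective h2 hV, zero_mul]
    intro hinj
    refine hb (Finset.mem_image.2 ⟨Equiv.ofBijective b (Finite.injective_iff_bijective.1 hinj),
      Finset.mem_univ _, rfl⟩)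

/-- The quantum determinant is invariant. -/
lemma commute_qdet (h2 : ∀ x : B, x + x = 0 → x = 0) {V : Fin n → Matrix (Fin n) (Fin n) B}
    (hV : IsQAlt V) {x : B} {k l : Fin n}
    (hx : ∀ i a b, x * V i a b - V i a b * x
      = (if a = l then V i k b else 0) - (if k = b then V i a l else 0)) :
    Commute x (qdet V) := by
  classical
  rw [Commute, SemiconjBy, ← sub_eq_zero, qdet, qdetCol, Finset.mul_sum, Finset.sum_mul,
    ← Finset.sum_sub_distrib]
  have hz (f : Fin n → B) (i : Fin n) : (List.ofFn (Function.update f i 0)).prod = 0 :=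
    List.prod_eq_zero ((List.mem_ofFn' _ _).2 ⟨i, by simp⟩)
  have hsub (f : Fin n → B) (i : Fin n) (u v : B) : (List.ofFn (Function.update f i (u - v))).prod
      = (List.ofFn (Function.update f i u)).prod - (List.ofFn (Function.update f i v)).prod := by
    have := (MultilinearMap.mkPiAlgebraFin ℤ n B).map_update_sub f i u v
    simpa only [MultilinearMap.mkPiAlgebraFin_apply] using this
  set φ : Fin n → Fin n := Function.update id l k with hφ
  have term (σ : Perm (Fin n)) :
      x * ((Perm.sign σ : ℤ) • (List.ofFn fun i => V i (σ i) (id i)).prod)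
        - ((Perm.sign σ : ℤ) • (List.ofFn fun i => V i (σ i) (id i)).prod) * x
      = (Perm.sign σ : ℤ) • (List.ofFn fun i => V i (φ (σ i)) i).prod
        - (Perm.sign σ : ℤ) • (List.ofFn fun i => V i (σ i) (Function.update id k l i)).prod := by
    rw [mul_smul_comm, smul_mul_assoc, ← smul_sub, ← smul_sub, prod_ofFn_commutator]
    congr 1
    simp_rw [hx, hsub, id]
    rw [Finset.sum_sub_distrib]
    congr 1
    · rw [Finset.sum_eq_single (σ.symm l)]
      · congr 2
        ext i
        by_cases h : i = σ.symm l
        · subst h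
          simp [hφ]
        · have h' : σ i ≠ l := fun h' => h (by simp [← h'])
          rw [Function.update_of_ne h, hφ, Function.update_of_ne h']
          rfl
      · intro i _ hi
        rw [if_neg (fun h => hi (by simp [← h])), hz]
      · simp
    · rw [Finset.sum_eq_single k]
      · congr 2
        ext i
        by_cases h : i = k
        · subst h
          simp
        · simp [Function.update_of_ne h]
      · intro i _ hi
        rw [if_neg hi.symm, hz]
      · simp
  simp_rw [term]
  rw [Finset.sum_sub_distrib]
  change _ - qdetCol V (Function.update id k l) = 0
  rcases eq_or_ne k l with rfl | hkl
  · have : φ = id := by rw [hφ, Function.update_eq_self_iff]; rfl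
    rw [← hφ, this, sub_eq_zero]
    rfl
  · have h1 : qdetCol V (Function.update id k l) = 0 := by
      refine qdetCol_of_not_injective h2 hV fun hinj => hkl (hinj ?_)
      simp [Function.update_of_ne hkl.symm]
    rw [h1, sub_zero]
    refine Finset.sum_involution (fun σ _ => swap k l * σ) ?_ ?_ (by simp) ?_
    · intro σ _
      have hφs (a : Fin n) : φ (swap k l a) = φ a := by
        rcases eq_or_ne a k with rfl | ha
        · simp [hφ, Function.update_of_ne hkl]
        rcases eq_or_ne a l with rfl | ha'
        · simp [hφ, Function.update_of_ne hkl]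
        · rw [swap_apply_of_ne_of_ne ha ha']
      simp [Perm.sign_swap hkl, hφs]
    · intro σ _ _ h
      have : swap k l = 1 := by simpa using h
      exact hkl (by simpa using (congrArg (fun τ : Perm (Fin n) => τ l) this))
    · intro σ _
      rw [← mul_assoc, swap_mul_self, one_mul]

end QuantumDeterminant

end

section

open Polynomial

section QdetLemmas

variable {B : Type*} [Ring B] {n : ℕ}

lemma commute_qdet_of_entries {V : Fin n → Matrix (Fin n) (Fin n) B} {x : B}
    (h : ∀ i a b, Commute x (V i a b)) : Commute x (qdet V) := by
  refine Commute.sum_right _ _ _ fun σ _ => Commute.smul_right ?_ _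
  refine Commute.list_prod_right _ _ fun y hy => ?_
  obtain ⟨i, rfl⟩ := (List.mem_ofFn' _ _).1 hy
  exact h _ _ _

lemma map_qdet {B' : Type*} [Ring B'] (φ : B →+* B') (V : Fin n → Matrix (Fin n) (Fin n) B) :
    φ (qdet V) = qdet fun i => (V i).map φ := by
  rw [qdet, qdetCol, map_sum]
  refine Finset.sum_congr rfl fun σ _ => ?_
  rw [map_zsmul, map_list_prod, List.map_ofFn]
  rfl

lemma IsGl.commutator_smul_one_add {E : Matrix (Fin n) (Fin n) B} (hE : IsGl E) {v : B}
    (hv : ∀ b, Commute v b) (k l a b : Fin n) :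
    E k l * (v • (1 : Matrix (Fin n) (Fin n) B) + E) a b
        - (v • (1 : Matrix (Fin n) (Fin n) B) + E) a b * E k l
      = (if a = l then (v • (1 : Matrix (Fin n) (Fin n) B) + E) k b else 0)
        - (if k = b then (v • (1 : Matrix (Fin n) (Fin n) B) + E) a l else 0) := by
  have hS (a b : Fin n) : (v • (1 : Matrix (Fin n) (Fin n) B) + E) a b
      = (if a = b then v else 0) + E a b := by
    simp [Matrix.one_apply]
  have hcomm : E k l * (if a = b then v else 0) = (if a = b then v else 0) * E k l := by
    split_ifs
    · exact (hv _).eq.symm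
    · simp
  rw [hS a b, hS k b, hS a l, mul_add, add_mul, hcomm, add_sub_add_left_eq_sub, hE]
  by_cases h1 : a = l <;> by_cases h2 : k = b <;> simp [h1, h2]

end QdetLemmas

section ShiftedMonodromy

variable {A : Type*} [Ring A] {n : ℕ} (E : ℕ → Matrix (Fin n) (Fin n) A)

/-- The matrix `(u + E (q - 1)) ⋯ (u + E 0)` at `u = X - i`. -/
def monodromyShift (i : ℕ) : ℕ → Matrix (Fin n) (Fin n) A[X]
  | 0 => 1
  | q + 1 => ((X - (i : A[X])) • (1 : Matrix (Fin n) (Fin n) A[X]) + (E q).map C)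
      * monodromyShift i q

lemma commute_X_sub_natCast (i : ℕ) (b : A[X]) : Commute (X - (i : A[X])) b :=
  (Polynomial.commute_X b).sub_left (Nat.cast_commute i b)

lemma monodromyShift_apply (i q : ℕ) (a b : Fin n) : monodromyShift E i q a b
    = ∑ r ∈ Finset.range (q + 1), C (monodromyCoeff E q r a b) * (X - (i : A[X])) ^ (q - r) := by
  induction q generalizing a b with
  | zero => 
    simp only [monodromyShift, zero_add, Finset.range_one, Finset.sum_singleton,
      monodromyCoeff_zero_right, Matrix.one_apply]
    split_ifs <;> simp
  | succ q ih =>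
    have h : monodromyShift E i (q + 1) a b = (X - (i : A[X])) * monodromyShift E i q a b
        + ∑ x, C (E q a x) * monodromyShift E i q x b := by
      rw [monodromyShift, add_mul, Matrix.add_apply, Matrix.smul_mul, one_mul, Matrix.smul_apply,
        smul_eq_mul, Matrix.mul_apply]
      rfl
    rw [h, Finset.sum_range_succ']
    simp only [monodromyCoeff_succ_succ, Matrix.add_apply, map_add, add_mul, Nat.add_sub_add_right,
      Finset.sum_add_distrib]
    have h1 : ∑ r ∈ Finset.range (q + 1), C (monodromyCoeff E q (r + 1) a b)
          * (X - (i : A[X])) ^ (q - r)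
        + C (monodromyCoeff E (q + 1) 0 a b) * (X - (i : A[X])) ^ (q + 1 - 0)
        = (X - (i : A[X])) * monodromyShift E i q a b := by
      have := (Finset.sum_range_succ' (fun r => C (monodromyCoeff E q r a b)
        * (X - (i : A[X])) ^ (q + 1 - r)) (q + 1))
      simp only [Nat.add_sub_add_right] at this
      rw [monodromyCoeff_zero_right, ← monodromyCoeff_zero_right E q, ← this,
        Finset.sum_range_succ, monodromyCoeff_of_lt E (Nat.lt_succ_self q), Matrix.zero_apply,
        map_zero, zero_mul, add_zero, ih, Finset.mul_sum]
      refine Finset.sum_congr rfl fun r hr => ?_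
      rw [← mul_assoc, (commute_X_sub_natCast i _).eq, mul_assoc, ← pow_succ',
        Nat.sub_add_comm (Finset.mem_range_succ_iff.1 hr)]
    have h2 : ∑ r ∈ Finset.range (q + 1), C ((E q * monodromyCoeff E q r) a b)
          * (X - (i : A[X])) ^ (q - r)
        = ∑ x, C (E q a x) * monodromyShift E i q x b := by
      simp only [Matrix.mul_apply, map_sum, map_mul, Finset.sum_mul, ih, Finset.mul_sum]
      rw [Finset.sum_comm]
      simp only [mul_assoc]
    rw [← h1, ← h2]
    abel

variable {E}

lemma commute_qdet_monodromyShift (h2 : ∀ x : A, x + x = 0 → x = 0) (hE : ∀ q, IsGl (E q))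
    (hE' : ∀ q q', q ≠ q' → ∀ i j k l, Commute (E q i j) (E q' k l)) (p q : ℕ) (k l : Fin n) :
    Commute (C (E q k l)) (qdet fun i : Fin n => monodromyShift E i p) := by
  have h2' : ∀ x : A[X], x + x = 0 → x = 0 := fun x hx => by
    ext m
    exact h2 _ (by simpa using congrArg (fun f => f.coeff m) hx)
  have hCC {x y : A} (h : Commute x y) : Commute (C x) (C y) := by
    rw [Commute, SemiconjBy, ← C_mul, h.eq, C_mul]
  induction p with
  | zero =>
    refine commute_qdet_of_entries fun i a b => ?_
    rw [monodromyShift, Matrix.one_apply]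
    split_ifs <;> simp
  | succ p ih =>
    have hgl := isGl_map (hE p) (C : A →+* A[X])
    have hV := isQAlt_of_isGl hgl (v := fun i : Fin n => X - ((i : ℕ) : A[X]))
      (fun i b => commute_X_sub_natCast i b) (fun i j h => by rw [← h]; push_cast; abel)
    have hmul : (qdet fun i : Fin n => monodromyShift E i (p + 1))
        = qdet (fun i : Fin n => (X - ((i : ℕ) : A[X])) • (1 : Matrix (Fin n) (Fin n) A[X])
          + (E p).map C) * qdet fun i : Fin n => monodromyShift E i p := by
      refine qdet_mul h2' hV ?_
      intro i a b j c d
      rw [monodromyShift_apply]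
      refine Commute.sum_left _ _ _ fun r _ => Commute.mul_left ?_
        ((commute_X_sub_natCast _ _).pow_left _)
      simp only [Matrix.add_apply, Matrix.smul_apply, smul_eq_mul, Matrix.one_apply,
        Matrix.map_apply]
      refine Commute.add_right ((commute_X_sub_natCast _ _).symm.mul_right
        (by split_ifs <;> simp)) (hCC ?_)
      exact (commute_monodromyCoeff (fun q' hq' i j => hE' p q' (by omega) c d i j) r a b).symm
    rw [hmul]
    refine Commute.mul_right ?_ ih
    by_cases hq : q = p
    · subst hq
      refine commute_qdet h2' hV (k := k) (l := l) fun i a b => ?_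
      exact hgl.commutator_smul_one_add (commute_X_sub_natCast i) k l a b
    · refine commute_qdet_of_entries fun i a b => ?_
      simp only [Matrix.add_apply, Matrix.smul_apply, smul_eq_mul, Matrix.one_apply,
        Matrix.map_apply]
      exact Commute.add_right ((commute_X_sub_natCast _ _).symm.mul_right
        (by split_ifs <;> simp)) (hCC (hE' _ _ hq _ _ _ _))

end ShiftedMonodromy

namespace Yangian

variable {k : Type*} [Field k] {n p : ℕ}

/-- The generating matrix of the Yangian at `u = X - i`. -/
def shiftMatrix (k : Type*) [Field k] (n p i : ℕ) : Matrix (Fin n) (Fin n) (Yangian k n p)[X] :=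
  Matrix.of fun a b => ∑ r ∈ Finset.range (p + 1),
    C (gen k n p a b r) * (X - (i : (Yangian k n p)[X])) ^ (p - r)

/-- The coefficients of the quantum determinant. -/
def casimir (k : Type*) [Field k] (n p m : ℕ) : Yangian k n p :=
  (qdet fun i : Fin n => shiftMatrix k n p i).coeff (n * p - m)

lemma casimir_mem_center [CharZero k] {A : Type*} [Ring A] [Algebra k A]
    {E : ℕ → Matrix (Fin n) (Fin n) A} (hE : ∀ q, IsGl (E q))
    (hE' : ∀ q q', q ≠ q' → ∀ i j k l, Commute (E q i j) (E q' k l))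
    (hinj : Function.Injective (monodromyHom (k := k) p hE hE')) (m : ℕ) :
    casimir k n p m ∈ Subalgebra.center k (Yangian k n p) := by
  have h2 : ∀ x : A, x + x = 0 → x = 0 := fun x hx => by
    rw [← two_smul k, smul_eq_zero] at hx
    exact hx.resolve_left two_ne_zero
  set ρ := monodromyHom (k := k) p hE hE' with hρ
  have hmap : mapRingHom (ρ : Yangian k n p →+* A) (qdet fun i : Fin n => shiftMatrix k n p i)
      = qdet fun i : Fin n => monodromyShift E i p := by
    rw [map_qdet]
    congr 1
    ext1 i
    refine Matrix.ext fun a b => ?_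
    rw [monodromyShift_apply, Matrix.map_apply, shiftMatrix, Matrix.of_apply, map_sum]
    refine Finset.sum_congr rfl fun r _ => ?_
    rw [← monodromyHom_gen (k := k) hE hE']
    simp [hρ]
  have hρc : ρ (casimir k n p m)
      = (qdet fun i : Fin n => monodromyShift E i p).coeff (n * p - m) := by
    rw [← hmap, casimir]
    simp
  have hcomm (q : ℕ) (a b : Fin n) : Commute (ρ (casimir k n p m)) (E q a b) := by
    rw [hρc]
    have := congrArg (fun f => f.coeff (n * p - m)) (commute_qdet_monodromyShift h2 hE hE' p q a b)
    simp only [coeff_C_mul, coeff_mul_C] at this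
    exact this.symm
  rw [Subalgebra.mem_center_iff]
  intro y
  have hy : y ∈ Algebra.adjoin k (Set.range (letter k n p)) := adjoin_letter (k := k) ▸ trivial
  have hle : Algebra.adjoin k (Set.range (letter k n p))
      ≤ Subalgebra.centralizer k {casimir k n p m} := by
    refine Algebra.adjoin_le ?_
    rintro _ ⟨a, rfl⟩
    rw [SetLike.mem_coe, Subalgebra.mem_centralizer_iff]
    rintro _ rfl
    refine hinj ?_
    rw [map_mul, map_mul, letter, hρ, monodromyHom_gen]
    exact commute_monodromyCoeff (fun q _ i j => hcomm q i j) _ _ _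
  have := Subalgebra.mem_centralizer_iff k |>.1 (hle hy) _ rfl
  exact this.symm

end Yangian

end

section

open MvPolynomial

section OperatorSymbol

variable {k τ : Type*} [Field k] {W : τ → ℕ}

/-- The operator `φ` agrees with multiplication by `g` up to terms of lower degree. -/
def HasSym (W : τ → ℕ) (d : ℕ) (φ : Module.End k (MvPolynomial τ k)) (g : MvPolynomial τ k) :
    Prop :=
  g ∈ wordFilt k X W (d + 1) ∧
    ∀ e, ∀ h ∈ wordFilt k X W (e + 1), φ h - g * h ∈ wordFilt k X W (d + e)

namespace HasSym

variable {d d' : ℕ} {φ ψ : Module.End k (MvPolynomial τ k)} {g g' : MvPolynomial τ k}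

lemma apply_mem (h : HasSym W d φ g) {e : ℕ} {x : MvPolynomial τ k}
    (hx : x ∈ wordFilt k X W (e + 1)) : φ x ∈ wordFilt k X W (d + e + 1) := by
  rw [← sub_add_cancel (φ x) (g * x)]
  exact add_mem (wordFilt_mono (Nat.le_succ _) (h.2 e x hx))
    (wordFilt_mono (by omega) (mul_mem_wordFilt h.1 hx))

lemma mul (h : HasSym W d φ g) (h' : HasSym W d' ψ g') :
    HasSym W (d + d') (φ * ψ) (g * g') := by
  refine ⟨wordFilt_mono (by omega) (mul_mem_wordFilt h.1 h'.1), fun e x hx => ?_⟩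
  have : (φ * ψ) x - g * g' * x = (φ (ψ x) - g * ψ x) + g * (ψ x - g' * x) := by
    rw [Module.End.mul_apply]; ring
  rw [this]
  refine add_mem ?_ (wordFilt_mono (by omega) (mul_mem_wordFilt' h.1 (h'.2 e x hx)))
  rw [add_assoc]
  exact h.2 _ _ (h'.apply_mem hx)

lemma add (h : HasSym W d φ g) (h' : HasSym W d ψ g') : HasSym W d (φ + ψ) (g + g') := by
  refine ⟨add_mem h.1 h'.1, fun e x hx => ?_⟩
  rw [LinearMap.add_apply, add_mul, add_sub_add_comm]
  exact add_mem (h.2 e x hx) (h'.2 e x hx)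

lemma zero : HasSym W d (0 : Module.End k (MvPolynomial τ k)) 0 :=
  ⟨zero_mem _, fun e x _ => by simp⟩

lemma one : HasSym W 0 (1 : Module.End k (MvPolynomial τ k)) 1 :=
  ⟨by simpa using word_mem_wordFilt (k := k) (t := X) (w := W) [] (D := 1) (by simp),
    fun e x _ => by simp⟩

lemma sum {ι : Type*} (s : Finset ι) {φ : ι → Module.End k (MvPolynomial τ k)}
    {g : ι → MvPolynomial τ k} (h : ∀ i ∈ s, HasSym W d (φ i) (g i)) :
    HasSym W d (∑ i ∈ s, φ i) (∑ i ∈ s, g i) := by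
  classical
  induction s using Finset.induction_on with
  | empty => simpa using zero
  | insert a s ha ih =>
    rw [Finset.sum_insert ha, Finset.sum_insert ha]
    exact (h a (by simp)).add (ih fun i hi => h i (by simp [hi]))

lemma of_lt (h : HasSym W d φ g) (hd : d < d') : HasSym W d' φ 0 :=
  ⟨zero_mem _, fun e x hx => by
    simpa using wordFilt_mono (by omega) (h.apply_mem hx)⟩

lemma list_prod {σ : Type*} {w : σ → ℕ} {t : σ → Module.End k (MvPolynomial τ k)}
    {q : σ → MvPolynomial τ k} (h : ∀ a, HasSym W (w a) (t a) (q a)) (l : List σ) :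
    HasSym W (l.map w).sum (l.map t).prod (l.map q).prod := by
  induction l with
  | nil => simpa using one
  | cons a l ih => simpa using (h a).mul ih

end HasSym

lemma X_mem_wordFilt (a : τ) : (X a : MvPolynomial τ k) ∈ wordFilt k X W (W a + 1) := by
  simpa using word_mem_wordFilt (k := k) (t := (X : τ → MvPolynomial τ k)) (w := W) [a]
    (D := W a + 1) (by simp)

lemma derivation_mem_wordFilt {lam : τ → MvPolynomial τ k}
    (hl : ∀ a, lam a ∈ wordFilt k X W (W a + 1)) {d : ℕ} {x : MvPolynomial τ k}
    (hx : x ∈ wordFilt k X W d) : mkDerivation k lam x ∈ wordFilt k X W d := by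
  refine Submodule.span_induction ?_ (by simp) ?_ ?_ hx
  · rintro _ ⟨l, hl', rfl⟩
    refine wordFilt_mono hl' ?_
    clear hl'
    induction l with
    | nil => simp
    | cons a l ih =>
      simp only [List.map_cons, List.prod_cons, List.sum_cons, Derivation.leibniz, smul_eq_mul,
        mkDerivation_X]
      have h1 := mul_mem_wordFilt' (X_mem_wordFilt a) ih
      rw [Nat.succ_eq_add_one, ← add_assoc] at h1
      refine add_mem h1 ?_
      have hw : (l.map X).prod ∈ wordFilt k (X : τ → MvPolynomial τ k) W ((l.map W).sum + 1) :=
        word_mem_wordFilt l (Nat.lt_succ_self _)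
      have := mul_mem_wordFilt' (hl a) hw
      rwa [mul_comm (lam a), ← add_assoc] at this
  · intro a b _ _ ha hb
    rw [map_add]
    exact add_mem ha hb
  · intro c a _ ha
    rw [Derivation.map_smul]
    exact Submodule.smul_mem _ _ ha

lemma weightedHomogeneousComponent_eq_zero_of_mem {d e : ℕ} (h : d ≤ e) {x : MvPolynomial τ k}
    (hx : x ∈ wordFilt k X W d) : weightedHomogeneousComponent W e x = 0 := by
  refine Submodule.span_induction ?_ (by simp) ?_ ?_ hx
  · rintro _ ⟨l, hl, rfl⟩
    exact (isWeightedHomogeneous_prod_X l).weightedHomogeneousComponent_ne e (by omega)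
  · intro a b _ _ ha hb
    rw [map_add, ha, hb, add_zero]
  · intro c a _ ha
    rw [map_smul, ha, smul_zero]

/-- A family of operators whose symbols are algebraically independent satisfies no relation
between ordered monomials. -/
lemma wordMap_injective_of_hasSym {σ : Type*} {w : σ → ℕ}
    {t : σ → Module.End k (MvPolynomial τ k)}
    {q : σ → MvPolynomial τ k} (h : ∀ a, HasSym W (w a) (t a) (q a))
    (hq : ∀ a, IsWeightedHomogeneous W (q a) (w a))
    (hinj : Function.Injective (aeval q : MvPolynomial σ k →ₐ[k] MvPolynomial τ k)) :
    Function.Injective (wordMap k t) := by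
  classical
  rw [injective_iff_map_eq_zero]
  intro f hf
  by_contra hne
  obtain ⟨e₀, he₀, hmax⟩ := f.support.exists_max_image (fun e => Finsupp.weight w e)
    (support_nonempty.2 hne)
  set D := Finsupp.weight w e₀ with hD
  have hprod (e : σ →₀ ℕ) : ((Finsupp.toMultiset e).toList.map q).prod
      = aeval q (monomial e (1 : k)) := by
    have := congrArg (aeval q) (prod_map_X (k := k) (Finsupp.toMultiset e).toList)
    rw [map_list_prod, List.map_map] at this
    simp only [Multiset.coe_toList, Finsupp.toMultiset_toFinsupp] at this
    rw [← this]
    congr 2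
    ext1 a
    simp
  have hsum (e : σ →₀ ℕ) : ((Finsupp.toMultiset e).toList.map w).sum = Finsupp.weight w e := by
    rw [← weight_toFinsupp]
    simp
  have key : (wordMap k t f) 1 - aeval q (weightedHomogeneousComponent w D f)
      ∈ wordFilt k X W D := by
    conv in (wordMap k t f) => rw [f.as_sum]
    rw [weightedHomogeneousComponent_apply, map_sum, map_sum, LinearMap.sum_apply,
      Finset.sum_filter, ← Finset.sum_sub_distrib]
    refine sum_mem fun e he => ?_
    have h1 := HasSym.list_prod h (Finsupp.toMultiset e).toList
    rw [hprod, hsum] at h1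
    have h0 : (1 : MvPolynomial τ k) ∈ wordFilt k X W (0 + 1) := HasSym.one.1
    rw [wordMap_monomial, LinearMap.smul_apply]
    split_ifs with hw
    · have h2 := h1.2 0 1 h0
      rw [hw, add_zero, mul_one] at h2
      rw [show monomial e (coeff e f) = coeff e f • monomial e (1 : k) by simp [smul_monomial],
        map_smul, ← smul_sub]
      exact Submodule.smul_mem _ _ h2
    · rw [sub_zero]
      refine Submodule.smul_mem _ _ (wordFilt_mono ?_ (h1.apply_mem h0))
      have := hmax e he
      omega
  rw [hf, LinearMap.zero_apply, zero_sub, neg_mem_iff] at key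
  have hhom : IsWeightedHomogeneous W (aeval q (weightedHomogeneousComponent w D f)) D := by
    rw [weightedHomogeneousComponent_apply, map_sum]
    refine IsWeightedHomogeneous.sum _ _ _ fun e he => ?_
    rw [show monomial e (coeff e f) = coeff e f • monomial e (1 : k) by simp [smul_monomial],
      map_smul]
    refine (weightedHomogeneousSubmodule k W D).smul_mem _ ?_
    rw [← hprod, ← (Finset.mem_filter.1 he).2, ← hsum]
    generalize (Finsupp.toMultiset e).toList = l
    change IsWeightedHomogeneous W _ _
    induction l with
    | nil => simpa using isWeightedHomogeneous_one k W
    | cons a l ih => simpa using (hq a).mul ih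
  have h0 := weightedHomogeneousComponent_eq_zero_of_mem le_rfl key
  rw [hhom.weightedHomogeneousComponent_same] at h0
  have h0 := hinj (h0.trans (map_zero _).symm)
  have h3 : coeff e₀ (weightedHomogeneousComponent w D f) = coeff e₀ f := by
    rw [coeff_weightedHomogeneousComponent, if_pos hD.symm]
  rw [h0, coeff_zero] at h3
  exact mem_support_iff.1 he₀ h3.symm

end OperatorSymbol

end

section

open MvPolynomial

section GlOperators

variable (k : Type*) [Field k] {n : ℕ}

/-- The vector field by which a matrix unit acts on the `q`-th generic matrix. -/
def glDer (q : ℕ) (i j : Fin n) :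
    Derivation k (MvPolynomial (ℕ × Fin n × Fin n) k) (MvPolynomial (ℕ × Fin n × Fin n) k) :=
  mkDerivation k fun b => if b.1 = q ∧ b.2.1 = j then X (q, i, b.2.2) else 0

/-- The sum of the vector field `glDer` and the multiplication by a coordinate. -/
def glOp (q : ℕ) : Matrix (Fin n) (Fin n) (Module.End k (MvPolynomial (ℕ × Fin n × Fin n) k)) :=
  Matrix.of fun i j => LinearMap.mulLeft k (X (q, i, j)) + (glDer k q i j).toLinearMap

variable {k}

lemma glDer_X (q : ℕ) (i j : Fin n) (b : ℕ × Fin n × Fin n) :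
    glDer k q i j (X b) = if b.1 = q ∧ b.2.1 = j then X (q, i, b.2.2) else 0 :=
  mkDerivation_X _ _ _

lemma glOp_apply (q : ℕ) (i j : Fin n) (x : MvPolynomial (ℕ × Fin n × Fin n) k) :
    glOp k q i j x = X (q, i, j) * x + glDer k q i j x := rfl

lemma glDer_lie (q : ℕ) (i j a b : Fin n) :
    ⁅glDer k q i j, glDer k q a b⁆
      = (if a = j then glDer k q i b else 0) - (if i = b then glDer k q a j else 0) := by
  refine MvPolynomial.derivation_ext fun c => ?_
  obtain ⟨q', c, d⟩ := c
  rw [Derivation.commutator_apply, glDer_X, glDer_X]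
  by_cases hq : q' = q
  · subst hq
    by_cases h1 : c = b <;> by_cases h2 : c = j <;> by_cases h3 : a = j <;> by_cases h4 : i = b <;>
      simp_all [glDer_X]
  · by_cases h3 : a = j <;> by_cases h4 : i = b <;> simp [hq, h3, h4, glDer_X]

lemma glDer_lie_of_ne {q q' : ℕ} (h : q ≠ q') (i j a b : Fin n) :
    ⁅glDer k q i j, glDer k q' a b⁆ = 0 := by
  refine MvPolynomial.derivation_ext fun c => ?_
  obtain ⟨q'', c, d⟩ := c
  rw [Derivation.commutator_apply, glDer_X, glDer_X]
  by_cases hq : q'' = q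
  · subst hq
    by_cases h2 : c = j <;> simp [h, h2, glDer_X]
  · by_cases hq' : q'' = q'
    · subst hq'
      by_cases h2 : c = b <;> simp [h.symm, h2, glDer_X]
    · simp [hq, hq']

lemma glOp_commutator_apply (q q' : ℕ) (i j a b : Fin n)
    (x : MvPolynomial (ℕ × Fin n × Fin n) k) :
    (glOp k q i j * glOp k q' a b - glOp k q' a b * glOp k q i j) x
      = glDer k q i j (X (q', a, b)) * x - glDer k q' a b (X (q, i, j)) * x
        + ⁅glDer k q i j, glDer k q' a b⁆ x := by
  simp only [LinearMap.sub_apply, Module.End.mul_apply, glOp_apply, map_add, Derivation.leibniz,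
    smul_eq_mul, Derivation.commutator_apply]
  ring

lemma isGl_glOp (q : ℕ) : IsGl (glOp k q (n := n)) := by
  intro i j a b
  refine LinearMap.ext fun x => ?_
  rw [glOp_commutator_apply, glDer_lie, glDer_X, glDer_X]
  by_cases h3 : a = j <;> by_cases h4 : i = b <;>
    simp [h3, h4, glOp_apply, LinearMap.sub_apply]
  all_goals abel

lemma commute_glOp (q q' : ℕ) (h : q ≠ q') (i j a b : Fin n) :
    Commute (glOp k q i j) (glOp k q' a b) := by
  rw [Commute, SemiconjBy, ← sub_eq_zero]
  refine LinearMap.ext fun x => ?_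
  rw [glOp_commutator_apply, glDer_lie_of_ne h, glDer_X, glDer_X]
  simp [h, h.symm]

/-- The leading weight of a monodromy coefficient. -/
def monodromyWeight (p r : ℕ) : ℕ := ∑ q ∈ Finset.range r, (p - q)

/-- The weight of the coordinates of the generic matrices. -/
def coordWeight (n p : ℕ) (b : ℕ × Fin n × Fin n) : ℕ := p - b.1

variable (k) in
/-- The product of the first `r` generic matrices. -/
def genericProd (n : ℕ) : ℕ → Matrix (Fin n) (Fin n) (MvPolynomial (ℕ × Fin n × Fin n) k)
  | 0 => 1
  | r + 1 => (Matrix.of fun i j => X (r, i, j)) * genericProd n r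

lemma isWeightedHomogeneous_genericProd (p r : ℕ) (i j : Fin n) :
    IsWeightedHomogeneous (coordWeight n p) (genericProd k n r i j) (monodromyWeight p r) := by
  induction r generalizing i j with
  | zero =>
    rw [genericProd, monodromyWeight, Finset.sum_range_zero, Matrix.one_apply]
    split_ifs
    · exact isWeightedHomogeneous_one _ _
    · exact isWeightedHomogeneous_zero _ _ _
  | succ r ih =>
    rw [genericProd, Matrix.mul_apply, monodromyWeight, Finset.sum_range_succ, add_comm]
    refine IsWeightedHomogeneous.sum _ _ _ fun a _ => ?_
    exact (isWeightedHomogeneous_X k (coordWeight n p) (r, i, a)).mul (ih a j)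

lemma hasSym_glOp {p q : ℕ} (h : q < p) (i j : Fin n) :
    HasSym (coordWeight n p) (p - q) (glOp k q i j) (X (q, i, j)) := by
  refine ⟨X_mem_wordFilt (q, i, j), fun e x hx => ?_⟩
  rw [glOp_apply, add_sub_cancel_left]
  refine wordFilt_mono (by omega) (derivation_mem_wordFilt (fun b => ?_) hx)
  split_ifs with hb
  · have := X_mem_wordFilt (k := k) (W := coordWeight n p) (q, i, b.2.2)
    rwa [show coordWeight n p (q, i, b.2.2) = coordWeight n p b by simp [coordWeight, hb.1]] at this
  · exact zero_mem _

lemma monodromyWeight_succ (p r : ℕ) :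
    monodromyWeight p (r + 1) = (p - r) + monodromyWeight p r := by
  rw [monodromyWeight, Finset.sum_range_succ, add_comm]; rfl

lemma hasSym_monodromyCoeff {p q r : ℕ} (hq : q ≤ p) (hr : r ≤ q) (i j : Fin n) :
    HasSym (coordWeight n p) (monodromyWeight p r) (monodromyCoeff (glOp k) q r i j)
      (genericProd k n r i j) := by
  induction q generalizing r i j with
  | zero =>
    obtain rfl : r = 0 := by omega
    rw [monodromyCoeff_zero_right, genericProd, Matrix.one_apply, Matrix.one_apply]
    split_ifs
    · exact HasSym.one
    · exact HasSym.zero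
  | succ q ih =>
    cases r with
    | zero =>
      have := ih (by omega) (Nat.zero_le q) i j
      rwa [monodromyCoeff_zero_right] at this ⊢
    | succ r =>
      rw [monodromyCoeff_succ_succ, Matrix.add_apply, Matrix.mul_apply]
      have h2 : HasSym (coordWeight n p) ((p - q) + monodromyWeight p r)
          (∑ a, glOp k q i a * monodromyCoeff (glOp k) q r a j)
          (∑ a, X (q, i, a) * genericProd k n r a j) :=
        HasSym.sum _ fun a _ => (hasSym_glOp (by omega) i a).mul (ih (by omega) (by omega) a j)
      rcases (Nat.lt_succ_iff_lt_or_eq.1 (Nat.lt_of_succ_le hr)) with h | h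
      · have h1 := ih (by omega) (Nat.succ_le_of_lt h) i j
        have := h1.add (h2.of_lt (d' := monodromyWeight p (r + 1))
          (by rw [monodromyWeight_succ]; omega))
        rwa [add_zero] at this
      · subst h
        rw [monodromyCoeff_of_lt _ (Nat.lt_succ_self r), Matrix.zero_apply, zero_add,
          monodromyWeight_succ, genericProd, Matrix.mul_apply]
        exact h2

open Matrix in
/-- Generic products of matrices are algebraically independent. -/
lemma aeval_genericProd_injective [Infinite k] (n p : ℕ) : Function.Injective
    (aeval (fun a : Fin n × Fin n × Fin p => genericProd k n (a.2.2 + 1) a.1 a.2.1) :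
      MvPolynomial (Fin n × Fin n × Fin p) k →ₐ[k] MvPolynomial (ℕ × Fin n × Fin n) k) := by
  classical
  rw [injective_iff_map_eq_zero]
  intro f hf
  let M (r : Fin p) : Matrix (Fin n) (Fin n) (MvPolynomial (Fin n × Fin n × Fin p) k) :=
    Matrix.of fun i j => X (i, j, r)
  have hM : ∏ r, (M r).det ≠ 0 := by
    refine Finset.prod_ne_zero_iff.2 fun r _ h => ?_
    have := congrArg (eval fun a : Fin n × Fin n × Fin p => if a.1 = a.2.1 then (1 : k) else 0) h
    rw [RingHom.map_det, map_zero] at this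
    have h1 : (eval fun a : Fin n × Fin n × Fin p => if a.1 = a.2.1 then (1 : k) else 0).mapMatrix
        (M r) = 1 := by
      ext i j
      simp [M, Matrix.one_apply]
    rw [h1, det_one] at this
    exact one_ne_zero this
  have key : f * ∏ r, (M r).det = 0 := by
    refine MvPolynomial.funext fun b => ?_
    rw [map_mul, map_zero]
    by_cases hb : eval b (∏ r, (M r).det) = 0
    · rw [hb, mul_zero]
    refine mul_eq_zero_of_left ?_ _
    rw [map_prod, ← ne_eq, Finset.prod_ne_zero_iff] at hb
    let N (r : ℕ) : Matrix (Fin n) (Fin n) k :=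
      if h : r < p then Matrix.of fun i j => b (i, j, ⟨r, h⟩) else 1
    have hN (r : ℕ) : IsUnit (N r).det := by
      by_cases h : r < p
      · have h1 := hb ⟨r, h⟩ (Finset.mem_univ _)
        rw [RingHom.map_det] at h1
        rw [isUnit_iff_ne_zero]
        convert h1
        simp only [N, dif_pos h]
        ext i j
        simp [M]
      · simp [N, h]
    let Y : ℕ → Matrix (Fin n) (Fin n) k
      | 0 => N 0
      | r + 1 => N (r + 1) * (N r)⁻¹
    let y : ℕ × Fin n × Fin n → k := fun c => Y c.1 c.2.1 c.2.2
    have hY (r : ℕ) (i j : Fin n) : eval y (genericProd k n (r + 1) i j) = N r i j := by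
      have hstep (r : ℕ) : (eval y).mapMatrix (genericProd k n (r + 1))
          = Y r * (eval y).mapMatrix (genericProd k n r) := by
        rw [genericProd, map_mul]
        congr 1
        ext i j
        simp [y]
      have : (eval y).mapMatrix (genericProd k n (r + 1)) = N r := by
        induction r with
        | zero =>
          rw [hstep, genericProd, map_one, mul_one]
        | succ r ih =>
          rw [hstep, ih, Matrix.mul_assoc, Matrix.nonsing_inv_mul _ (hN r), Matrix.mul_one]
      exact congrFun (congrFun this i) j
    have h2 : eval y (aeval (fun a : Fin n × Fin n × Fin p =>
        genericProd k n (a.2.2 + 1) a.1 a.2.1) f) = eval b f := by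
      clear hf
      induction f using MvPolynomial.induction_on with
      | C c => simp
      | add f g hf hg => rw [map_add, map_add, map_add, hf, hg]
      | mul_X f a hf =>
        rw [map_mul, map_mul, map_mul, hf, aeval_X, eval_X, hY]
        simp [N]
    rw [← h2, hf, map_zero]
  exact (mul_eq_zero.1 key).resolve_right hM

end GlOperators

namespace Yangian

variable {k : Type*} [Field k]

/-- The matrices of differential operators `glOp` give a representation of the Yangian. -/
def glHom (n p : ℕ) :
    Yangian k n p →ₐ[k] Module.End k (MvPolynomial (ℕ × Fin n × Fin n) k) :=
  monodromyHom p (isGl_glOp (k := k)) commute_glOp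

lemma glHom_wordMap (n p : ℕ) (f : MvPolynomial (Fin n × Fin n × Fin p) k) :
    glHom n p (wordMap k (letter k n p) f)
      = wordMap k (fun a : Fin n × Fin n × Fin p =>
        monodromyCoeff (glOp k) p (a.2.2 + 1) a.1 a.2.1) f := by
  induction f using MvPolynomial.induction_on' with
  | monomial e c =>
    rw [wordMap_monomial, wordMap_monomial, map_smul, map_list_prod, List.map_map]
    congr 3
    ext1 a
    exact monodromyHom_gen _ _ _ _ _
  | add f g hf hg => rw [map_add, map_add, map_add, hf, hg]

lemma glHom_comp_wordMap_injective [Infinite k] (n p : ℕ) :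
    Function.Injective fun f => glHom (k := k) n p (wordMap k (letter k n p) f) := by
  have h1 := wordMap_injective_of_hasSym (k := k)
    (t := fun a : Fin n × Fin n × Fin p => monodromyCoeff (glOp k) p (a.2.2 + 1) a.1 a.2.1)
    (fun a => hasSym_monodromyCoeff le_rfl (by omega) a.1 a.2.1)
    (fun a => isWeightedHomogeneous_genericProd p _ _ _) (aeval_genericProd_injective n p)
  simpa only [glHom_wordMap] using h1

/-- The ordered monomials in the generators of the Yangian are linearly independent. -/
lemma wordMap_injective [Infinite k] (n p : ℕ) :
    Function.Injective (wordMap k (letter k n p)) :=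
  Function.Injective.of_comp (f := glHom n p) (glHom_comp_wordMap_injective n p)

end Yangian

end

section

open MvPolynomial

namespace Yangian

variable {k : Type*} [Field k] {n p : ℕ}

/-- The Kazhdan-type weight, in which diagonal generators dominate. -/
def diagWeight (n p : ℕ) (a : Fin n × Fin n × Fin p) : ℕ :=
  3 * a.2.2 + (if a.1 = a.2.1 then 3 else 2)

/-- The weight whose associated graded Lie algebra is the current algebra. -/
def loopWeight (n p : ℕ) (a : Fin n × Fin n × Fin p) : ℕ := 2 * a.2.2 + 1

lemma gen_eq_letter (i j : Fin n) (r : ℕ) (h : r < p) :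
    gen k n p i j (r + 1) = letter k n p (i, j, ⟨r, h⟩) := rfl

lemma one_mem_wordFilt {A σ : Type*} [Ring A] [Algebra k A] {t : σ → A} {w : σ → ℕ} {D : ℕ}
    (hD : 0 < D) : (1 : A) ∈ wordFilt k t w D := by
  simpa using word_mem_wordFilt (k := k) (t := t) (w := w) [] (D := D) (by simpa using hD)

lemma letter_mem_wordFilt {A σ : Type*} [Ring A] [Algebra k A] (t : σ → A) (w : σ → ℕ) (a : σ) :
    t a ∈ wordFilt k t w (w a + 1) := by
  simpa using word_mem_wordFilt (k := k) (t := t) (w := w) [a] (D := w a + 1) (by simp)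

lemma gen_mem_diagWeight (i j : Fin n) (r : ℕ) :
    gen k n p i j r
      ∈ wordFilt k (letter k n p) (diagWeight n p) (3 * r + (if i = j then 1 else 0)) := by
  rcases r with _ | r
  · rw [gen_zero]
    split_ifs
    · exact one_mem_wordFilt (by simp)
    · exact zero_mem _
  by_cases h : r < p
  · rw [gen_eq_letter i j r h]
    refine wordFilt_mono ?_ (letter_mem_wordFilt _ _ _)
    simp only [diagWeight]
    split_ifs <;> omega
  · rw [gen_of_lt _ _ (by omega)]
    exact zero_mem _

lemma gen_mem_loopWeight_succ (i j : Fin n) (r : ℕ) :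
    gen k n p i j (r + 1) ∈ wordFilt k (letter k n p) (loopWeight n p) (2 * (r + 1)) := by
  by_cases h : r < p
  · rw [gen_eq_letter i j r h]
    exact wordFilt_mono (by simp [loopWeight]; omega) (letter_mem_wordFilt _ _ _)
  · rw [gen_of_lt _ _ (by omega)]
    exact zero_mem _

lemma diagWeight_commutator (a b : Fin n × Fin n × Fin p) :
    letter k n p a * letter k n p b - letter k n p b * letter k n p a
      ∈ wordFilt k (letter k n p) (diagWeight n p) (diagWeight n p a + diagWeight n p b) := by
  obtain ⟨i, j, r⟩ := a
  obtain ⟨l, m, s⟩ := b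
  have h := commutator_gen (k := k) (p := p) i j l m (r + 1) (s + 1) (by omega) (by omega)
    (by omega) (by omega)
  refine h ▸ sum_mem fun a ha => ?_
  rw [Finset.mem_Icc] at ha
  have hle : 3 * ((r : ℕ) + 1 + (s + 1) - a) + 3 * (a - 1) + 1
      ≤ diagWeight n p (i, j, r) + diagWeight n p (l, m, s) := by
    simp only [diagWeight]
    split_ifs <;> omega
  have hg (i j : Fin n) (r : ℕ) : gen k n p i j r
      ∈ wordFilt k (letter k n p) (diagWeight n p) (3 * r + 1) :=
    wordFilt_mono (by split_ifs <;> omega) (gen_mem_diagWeight i j r)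
  exact sub_mem (wordFilt_mono (by omega) (mul_mem_wordFilt (hg _ _ _) (hg _ _ _)))
    (wordFilt_mono (by omega) (mul_mem_wordFilt (hg _ _ _) (hg _ _ _)))

/-- The coordinate function `x_ij^(u+1)`, which is zero for large `u`. -/
def coordX (k : Type*) [Field k] (n p : ℕ) (i j : Fin n) (u : ℕ) :
    MvPolynomial (Fin n × Fin n × Fin p) k :=
  if h : u < p then X (i, j, ⟨u, h⟩) else 0

/-- The values on coordinates of the coadjoint vector fields. -/
def coadValue (k : Type*) [Field k] (n p : ℕ) (a b : Fin n × Fin n × Fin p) :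
    MvPolynomial (Fin n × Fin n × Fin p) k :=
  (if b.1 = a.2.1 then coordX k n p a.1 b.2.1 (a.2.2 + b.2.2) else 0)
    - (if a.1 = b.2.1 then coordX k n p b.1 a.2.1 (a.2.2 + b.2.2) else 0)

lemma loopWeight_commutator_sub (a b : Fin n × Fin n × Fin p) :
    letter k n p a * letter k n p b - letter k n p b * letter k n p a
      - ((if b.1 = a.2.1 then gen k n p a.1 b.2.1 (a.2.2 + b.2.2 + 1) else 0)
        - (if a.1 = b.2.1 then gen k n p b.1 a.2.1 (a.2.2 + b.2.2 + 1) else 0))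
      ∈ wordFilt k (letter k n p) (loopWeight n p) (2 * a.2.2 + loopWeight n p b) := by
  obtain ⟨i, j, r⟩ := a
  obtain ⟨l, m, s⟩ := b
  have h := commutator_gen (k := k) (p := p) i j l m (r + 1) (s + 1) (by omega) (by omega)
    (by omega) (by omega)
  have h1 : (1 : ℕ) ∈ Finset.Icc 1 (min ((r : ℕ) + 1) (s + 1)) := by simp
  rw [← Finset.add_sum_erase _ _ h1, Nat.sub_self, gen_zero, gen_zero,
    show (r : ℕ) + 1 + (s + 1) - 1 = r + s + 1 by omega, ite_mul, mul_ite, one_mul, mul_one,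
    zero_mul, mul_zero] at h
  have h2 := sub_eq_of_eq_add' h
  refine h2 ▸ sum_mem fun a ha => ?_
  rw [Finset.mem_erase, Finset.mem_Icc] at ha
  obtain ⟨b, rfl⟩ : ∃ b, a = b + 2 := ⟨a - 2, by omega⟩
  obtain ⟨c, hc⟩ : ∃ c, (r : ℕ) + 1 + (s + 1) - (b + 2) = c + 1 :=
    ⟨r + s - b - 1, by omega⟩
  have hle : (2 * (b + 1) + (2 * c + 1)) ≤ 2 * r + loopWeight n p (l, m, s) := by
    simp only [loopWeight]; omega
  rw [hc, show b + 2 - 1 = b + 1 by omega]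
  exact sub_mem
    (wordFilt_mono hle (mul_mem_wordFilt (gen_mem_loopWeight_succ _ _ _)
      (gen_mem_loopWeight_succ _ _ _)))
    (wordFilt_mono (le_trans (by omega) hle) (mul_mem_wordFilt (E := 2 * b + 1) (gen_mem_loopWeight_succ _ _ _)
      (gen_mem_loopWeight_succ _ _ _)))

lemma loopWeight_commutator (a b : Fin n × Fin n × Fin p) :
    letter k n p a * letter k n p b - letter k n p b * letter k n p a
      ∈ wordFilt k (letter k n p) (loopWeight n p) (loopWeight n p a + loopWeight n p b) := by
  have h := loopWeight_commutator_sub (k := k) a b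
  rw [← sub_add_cancel (letter k n p a * _ - _) ((if b.1 = a.2.1 then _ else 0) - _)]
  refine add_mem (wordFilt_mono (by simp [loopWeight]) h) ?_
  have hg (i j : Fin n) : gen k n p i j (a.2.2 + b.2.2 + 1)
      ∈ wordFilt k (letter k n p) (loopWeight n p) (loopWeight n p a + loopWeight n p b) :=
    wordFilt_mono (by simp [loopWeight]; omega) (gen_mem_loopWeight_succ _ _ _)
  refine sub_mem ?_ ?_ <;> split_ifs
  exacts [hg _ _, zero_mem _, hg _ _, zero_mem _]

lemma isSymb_gen_succ (i j : Fin n) (u : ℕ) :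
    IsSymb k (letter k n p) (loopWeight n p) (2 * u + 1) (gen k n p i j (u + 1))
      (coordX k n p i j u) := by
  rw [coordX]
  split_ifs with h
  · exact isSymb_gen loopWeight_commutator (i, j, ⟨u, h⟩)
  · rw [gen_of_lt _ _ (by omega)]
    exact IsSymb.zero

lemma isSymb_commutator_letter (a b : Fin n × Fin n × Fin p) :
    IsSymb k (letter k n p) (loopWeight n p) (2 * a.2.2 + loopWeight n p b)
      (letter k n p a * letter k n p b - letter k n p b * letter k n p a)
      (coadValue k n p a b) := by
  have h := IsSymb.of_mem (loopWeight_commutator_sub (k := k) a b)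
  have hs (i j : Fin n) : IsSymb k (letter k n p) (loopWeight n p) (2 * a.2.2 + loopWeight n p b)
      (gen k n p i j (a.2.2 + b.2.2 + 1)) (coordX k n p i j (a.2.2 + b.2.2)) := by
    have := isSymb_gen_succ (k := k) (p := p) i j (a.2.2 + b.2.2)
    rwa [show 2 * ((a.2.2 : ℕ) + b.2.2) + 1 = 2 * a.2.2 + loopWeight n p b by
      simp [loopWeight]; omega] at this
  have h1 : IsSymb k (letter k n p) (loopWeight n p) (2 * a.2.2 + loopWeight n p b)
      ((if b.1 = a.2.1 then gen k n p a.1 b.2.1 (a.2.2 + b.2.2 + 1) else 0)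
        - (if a.1 = b.2.1 then gen k n p b.1 a.2.1 (a.2.2 + b.2.2 + 1) else 0))
      (coadValue k n p a b) := by
    refine IsSymb.sub ?_ ?_ <;> split_ifs
    exacts [hs _ _, IsSymb.zero, hs _ _, IsSymb.zero]
  simpa using h.add h1

/-- The coadjoint vector fields. -/
def coadDer (k : Type*) [Field k] (n p : ℕ) (a : Fin n × Fin n × Fin p) :
    Derivation k (MvPolynomial (Fin n × Fin n × Fin p) k)
      (MvPolynomial (Fin n × Fin n × Fin p) k) :=
  mkDerivation k (coadValue k n p a)

/-- The symbol of a central element is invariant. -/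
lemma coadDer_eq_zero [Infinite k] {y : Yangian k n p}
    (hy : y ∈ Subalgebra.center k (Yangian k n p)) {D : ℕ}
    {f : MvPolynomial (Fin n × Fin n × Fin p) k}
    (hf : IsSymb k (letter k n p) (loopWeight n p) D y f) (a : Fin n × Fin n × Fin p) :
    coadDer k n p a f = 0 := by
  have h := IsSymb.commutator loopWeight_commutator (isSymb_commutator_letter (k := k) a) hf
  refine h.eq_zero_of_mem loopWeight_commutator (wordMap_injective n p) ?_
  rw [Subalgebra.mem_center_iff.1 hy, sub_self]
  exact zero_mem _

lemma glHom_injective [Infinite k] : Function.Injective (glHom (k := k) n p) := by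
  intro x y hxy
  obtain ⟨f, rfl⟩ := wordMap_surjective loopWeight_commutator adjoin_letter x
  obtain ⟨g, rfl⟩ := wordMap_surjective loopWeight_commutator adjoin_letter y
  exact congrArg _ (glHom_comp_wordMap_injective n p hxy)

lemma casimir_mem_center' [CharZero k] (m : ℕ) :
    casimir k n p m ∈ Subalgebra.center k (Yangian k n p) :=
  casimir_mem_center _ _ glHom_injective m

end Yangian

end

section

section GradedRelation

variable {B C : Type*} [Ring B] [CommRing C]

/-- A relation compatible with the operations of a ring, graded by natural numbers. -/
structure IsGradedRel (R : ℕ → B → C → Prop) : Prop where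
  one : R 0 1 1
  zero : ∀ N, R N 0 0
  add : ∀ {N x x' y y'}, R N x y → R N x' y' → R N (x + x') (y + y')
  neg : ∀ {N x y}, R N x y → R N (-x) (-y)
  mul : ∀ {N N' x x' y y'}, R N x y → R N' x' y' → R (N + N') (x * x') (y * y')

namespace IsGradedRel

variable {R : ℕ → B → C → Prop} (hR : IsGradedRel R)

include hR

lemma sum {ι : Type*} (s : Finset ι) {N : ℕ} {x : ι → B} {y : ι → C}
    (h : ∀ i ∈ s, R N (x i) (y i)) : R N (∑ i ∈ s, x i) (∑ i ∈ s, y i) := by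
  classical
  induction s using Finset.induction_on with
  | empty => simpa using hR.zero N
  | insert a s ha ih =>
    rw [Finset.sum_insert ha, Finset.sum_insert ha]
    exact hR.add (h a (by simp)) (ih fun i hi => h i (by simp [hi]))

lemma pow {N : ℕ} {x : B} {y : C} (h : R N x y) (m : ℕ) : R (m * N) (x ^ m) (y ^ m) := by
  induction m with
  | zero => simpa using hR.one
  | succ m ih =>
    rw [pow_succ, pow_succ, add_mul, one_mul]
    exact hR.mul ih h

lemma prod_ofFn {q n : ℕ} {x : Fin n → B} {y : Fin n → C} (h : ∀ i, R q (x i) (y i)) :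
    R (n * q) (List.ofFn x).prod (∏ i, y i) := by
  induction n with
  | zero => simpa using hR.one
  | succ n ih =>
    rw [List.ofFn_succ, List.prod_cons, Fin.prod_univ_succ, add_mul, one_mul, add_comm]
    exact hR.mul (h 0) (ih fun i => h i.succ)

lemma qdet {q n : ℕ} {V : Fin n → Matrix (Fin n) (Fin n) B} {F : Matrix (Fin n) (Fin n) C}
    (h : ∀ i a b, R q (V i a b) (F a b)) : R (n * q) (qdet V) F.det := by
  rw [_root_.qdet, Matrix.det_apply]
  refine hR.sum _ fun σ _ => ?_
  have h1 : R (n * q) (List.ofFn fun i => V i (σ i) (id i)).prod (∏ i, F (σ i) i) :=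
    hR.prod_ofFn fun i => h i (σ i) i
  rcases Int.units_eq_one_or (Equiv.Perm.sign σ) with hs | hs
  · rw [hs]
    simpa using h1
  · rw [hs]
    simpa [Units.smul_def] using hR.neg h1

end IsGradedRel

end GradedRelation

namespace Yangian

variable {k : Type*} [Field k] {n p : ℕ}

section Diag

open Polynomial

/-- Coefficientwise symbols of polynomials, for the weight `diagWeight`. -/
def DiagRel (k : Type*) [Field k] (n p N : ℕ) (P : (Yangian k n p)[X])
    (F : (MvPolynomial (Fin n × Fin n × Fin p) k)[X]) : Prop :=
  (∀ d, N < d → P.coeff d = 0 ∧ F.coeff d = 0) ∧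
    ∀ d e, d + e = N →
      IsSymb k (letter k n p) (diagWeight n p) (3 * e) (P.coeff d) (F.coeff d)

lemma isGradedRel_diagRel : IsGradedRel (DiagRel k n p) where
  one := by
    refine ⟨fun d hd => ?_, fun d e h => ?_⟩
    · simp [coeff_one, hd.ne']
    · obtain ⟨rfl, rfl⟩ : d = 0 ∧ e = 0 := by omega
      simpa using IsSymb.one
  zero N := ⟨fun d hd => by simp, fun d e h => by simpa using IsSymb.zero⟩
  add h h' := by
    refine ⟨fun d hd => ?_, fun d e hd => ?_⟩
    · rw [coeff_add, coeff_add, (h.1 d hd).1, (h.1 d hd).2, (h'.1 d hd).1, (h'.1 d hd).2]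
      simp
    · rw [coeff_add, coeff_add]
      exact (h.2 d e hd).add (h'.2 d e hd)
  neg h := by
    refine ⟨fun d hd => ?_, fun d e hd => ?_⟩
    · rw [coeff_neg, coeff_neg, (h.1 d hd).1, (h.1 d hd).2]
      simp
    · rw [coeff_neg, coeff_neg]
      simpa using (h.2 d e hd).smul (-1)
  mul {N N' x x' y y'} h h' := by
    refine ⟨fun d hd => ?_, fun d e hd => ?_⟩
    · rw [coeff_mul, coeff_mul]
      refine ⟨Finset.sum_eq_zero fun a ha => ?_, Finset.sum_eq_zero fun a ha => ?_⟩ <;>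
        rw [Finset.HasAntidiagonal.mem_antidiagonal] at ha <;>
        rcases (by omega : N < a.1 ∨ N' < a.2) with h1 | h1
      · rw [(h.1 _ h1).1, zero_mul]
      · rw [(h'.1 _ h1).1, mul_zero]
      · rw [(h.1 _ h1).2, zero_mul]
      · rw [(h'.1 _ h1).2, mul_zero]
    · rw [coeff_mul, coeff_mul]
      refine IsSymb.sum _ fun a ha => ?_
      rw [Finset.HasAntidiagonal.mem_antidiagonal] at ha
      rcases Nat.lt_or_ge N a.1 with h1 | h1
      · rw [(h.1 _ h1).1, zero_mul, (h.1 _ h1).2, zero_mul]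
        exact IsSymb.zero
      rcases Nat.lt_or_ge N' a.2 with h2 | h2
      · rw [(h'.1 _ h2).1, mul_zero, (h'.1 _ h2).2, mul_zero]
        exact IsSymb.zero
      have := (h.2 a.1 (N - a.1) (by omega)).mul diagWeight_commutator
        (h'.2 a.2 (N' - a.2) (by omega))
      rwa [show 3 * (N - a.1) + 3 * (N' - a.2) = 3 * e by omega] at this

lemma diagRel_X_sub (i : ℕ) : DiagRel k n p 1 (X - (i : (Yangian k n p)[X])) X := by
  refine ⟨fun d hd => ?_, fun d e hd => ?_⟩
  · rw [coeff_sub, coeff_X, coeff_X, coeff_natCast_ite]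
    simp [show 1 ≠ d by omega, show d ≠ 0 by omega]
  · rw [coeff_sub, coeff_X, coeff_X, coeff_natCast_ite]
    rcases (by omega : d = 0 ∧ e = 1 ∨ d = 1 ∧ e = 0) with ⟨rfl, rfl⟩ | ⟨rfl, rfl⟩
    · simp only [one_ne_zero, if_false, if_true, zero_sub]
      have h := (IsSymb.one (k := k) (t := letter k n p) (w := diagWeight n p)).smul (-(i : k))
      have := h.of_lt (E := 3 * 1) (by omega)
      rwa [show -(i : k) • (1 : Yangian k n p) = -(i : Yangian k n p) by
        rw [neg_smul, Nat.cast_smul_eq_nsmul, nsmul_one]] at this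
    · simpa using IsSymb.one

/-- The leading part of the generator `gen i j r`. -/
def diagSymbol (k : Type*) [Field k] (n p : ℕ) (i j : Fin n) (r : ℕ) :
    MvPolynomial (Fin n × Fin n × Fin p) k :=
  if i = j then (if r = 0 then 1 else coordX k n p i j (r - 1)) else 0

lemma isSymb_gen_diagSymbol (i j : Fin n) (r : ℕ) :
    IsSymb k (letter k n p) (diagWeight n p) (3 * r) (gen k n p i j r)
      (diagSymbol k n p i j r) := by
  by_cases h : i = j
  · subst h
    rcases r with _ | r
    · rw [gen_zero, if_pos rfl, diagSymbol, if_pos rfl, if_pos rfl]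
      exact IsSymb.one
    · rw [diagSymbol, if_pos rfl, if_neg (Nat.succ_ne_zero r), Nat.add_sub_cancel, coordX]
      split_ifs with hr
      · have := isSymb_gen (k := k) diagWeight_commutator (i, i, (⟨r, hr⟩ : Fin p))
        simp only [diagWeight] at this
        exact this
      · rw [gen_of_lt _ _ (by omega)]
        exact IsSymb.zero
  · rw [diagSymbol, if_neg h]
    have := gen_mem_diagWeight (k := k) (p := p) i j r
    rw [if_neg h] at this
    exact IsSymb.of_mem this

lemma diagRel_C (i j : Fin n) (r : ℕ) :
    DiagRel k n p r (C (gen k n p i j r)) (C (diagSymbol k n p i j r)) := by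
  refine ⟨fun d hd => ?_, fun d e hd => ?_⟩
  · simp [coeff_C, show d ≠ 0 by omega]
  · rw [coeff_C, coeff_C]
    split_ifs with h
    · obtain rfl : e = r := by omega
      exact isSymb_gen_diagSymbol i j e
    · exact IsSymb.zero

/-- The symbol of a diagonal entry of the generating matrix. -/
def diagPoly (k : Type*) [Field k] (n p : ℕ) (i : Fin n) :
    (MvPolynomial (Fin n × Fin n × Fin p) k)[X] :=
  X ^ p + ∑ r : Fin p, C (MvPolynomial.X (i, i, r)) * X ^ (p - 1 - r)

lemma diagRel_shiftMatrix (i : ℕ) (a b : Fin n) :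
    DiagRel k n p p (shiftMatrix k n p i a b) (Matrix.diagonal (diagPoly k n p) a b) := by
  have h : DiagRel k n p p (shiftMatrix k n p i a b)
      (∑ r ∈ Finset.range (p + 1), C (diagSymbol k n p a b r) * X ^ (p - r)) := by
    rw [shiftMatrix, Matrix.of_apply]
    refine (isGradedRel_diagRel (k := k)).sum _ fun r hr => ?_
    have := (isGradedRel_diagRel (k := k)).mul (diagRel_C (k := k) (p := p) a b r)
      ((isGradedRel_diagRel (k := k)).pow (diagRel_X_sub (k := k) (n := n) (p := p) i) (p - r))
    rwa [mul_one, Nat.add_sub_of_le (Finset.mem_range_succ_iff.1 hr)] at this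
  convert h using 1
  by_cases hab : a = b
  · subst hab
    rw [Matrix.diagonal_apply_eq, Finset.sum_range_succ', diagPoly, add_comm,
      ← Fin.sum_univ_eq_sum_range
        (fun r => C (diagSymbol k n p a a (r + 1)) * (X ^ (p - (r + 1)) : _[X])) p]
    simp [diagSymbol, coordX, Nat.sub_sub, add_comm]
  · rw [Matrix.diagonal_apply_ne _ hab]
    simp [diagSymbol, hab]

/-- The symbol of a central element for the weight `diagWeight`. -/
lemma isSymb_casimir_diagWeight (m : ℕ) (hm : m ≤ n * p) :
    IsSymb k (letter k n p) (diagWeight n p) (3 * m) (casimir k n p m)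
      ((∏ i, diagPoly k n p i).coeff (n * p - m)) := by
  have h := (isGradedRel_diagRel (k := k)).qdet (R := DiagRel k n p)
    (V := fun i => shiftMatrix k n p i) fun i a b => diagRel_shiftMatrix i a b
  rw [Matrix.det_diagonal] at h
  exact h.2 _ _ (by omega)

end Diag

end Yangian

end

section

namespace Yangian

open Polynomial

variable {k : Type*} [Field k] {n p : ℕ}

/-- Coefficientwise symbols of polynomials in two variables, for the weight `loopWeight`. The outer
variable counts generators. -/
structure LoopRel (k : Type*) [Field k] (n p N : ℕ) (P : (Yangian k n p)[X][X])
    (F : (MvPolynomial (Fin n × Fin n × Fin p) k)[X][X]) : Prop where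
  eq_zero : ∀ j d, N < d + j → (P.coeff j).coeff d = 0 ∧ (F.coeff j).coeff d = 0
  mem : ∀ j d, (P.coeff j).coeff d
    ∈ wordFilt k (letter k n p) (loopWeight n p) (j * (2 * p - 1) + 1)
  isSymb : ∀ j d e, d + e = N → j ≤ e → IsSymb k (letter k n p) (loopWeight n p) (2 * e - j)
    ((P.coeff j).coeff d) ((F.coeff j).coeff d)

lemma coeff_coeff_mul {A : Type*} [Ring A] (P Q : A[X][X]) (j d : ℕ) :
    ((P * Q).coeff j).coeff d = ∑ a ∈ Finset.HasAntidiagonal.antidiagonal j,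
      ∑ b ∈ Finset.HasAntidiagonal.antidiagonal d,
        (P.coeff a.1).coeff b.1 * (Q.coeff a.2).coeff b.2 := by
  rw [coeff_mul, finsetSum_coeff]
  exact Finset.sum_congr rfl fun a _ => coeff_mul _ _ _

lemma isGradedRel_loopRel : IsGradedRel (LoopRel k n p) where
  one := by
    refine ⟨fun j d hd => ?_, fun j d => ?_, fun j d e h hj => ?_⟩
    · rw [coeff_one, coeff_one]
      split_ifs with h
      · simp [coeff_one, show d ≠ 0 by omega]
      · simp
    · rw [coeff_one]
      split_ifs with h
      · rw [coeff_one]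
        split_ifs
        · exact one_mem_wordFilt (by omega)
        · exact zero_mem _
      · exact zero_mem _
    · obtain ⟨rfl, rfl, rfl⟩ : d = 0 ∧ e = 0 ∧ j = 0 := by omega
      simpa using IsSymb.one
  zero N := ⟨fun j d hd => by simp, fun j d => zero_mem _,
    fun j d e h _ => by simpa using IsSymb.zero⟩
  add h h' := by
    refine ⟨fun j d hd => ?_, fun j d => ?_, fun j d e hd hj => ?_⟩ <;>
      rw [coeff_add, coeff_add]
    · rw [(h.1 j d hd).1, (h'.1 j d hd).1, coeff_add, coeff_add, (h.1 j d hd).2, (h'.1 j d hd).2]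
      simp
    · exact add_mem (h.2 j d) (h'.2 j d)
    · rw [coeff_add, coeff_add]
      exact (h.3 j d e hd hj).add (h'.3 j d e hd hj)
  neg h := by
    refine ⟨fun j d hd => ?_, fun j d => ?_, fun j d e hd hj => ?_⟩ <;>
      rw [coeff_neg, coeff_neg]
    · rw [(h.1 j d hd).1, coeff_neg, coeff_neg, (h.1 j d hd).2]
      simp
    · exact neg_mem (h.2 j d)
    · rw [coeff_neg, coeff_neg]
      simpa using (h.3 j d e hd hj).smul (-1)
  mul {N N' x x' y y'} h h' := by
    refine ⟨fun j d hd => ?_, fun j d => ?_, fun j d e hd hj => ?_⟩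
    · rw [coeff_coeff_mul, coeff_coeff_mul]
      refine ⟨Finset.sum_eq_zero fun a ha => Finset.sum_eq_zero fun b hb => ?_,
        Finset.sum_eq_zero fun a ha => Finset.sum_eq_zero fun b hb => ?_⟩ <;>
        rw [Finset.HasAntidiagonal.mem_antidiagonal] at ha hb <;>
        rcases (by omega : N < b.1 + a.1 ∨ N' < b.2 + a.2) with h1 | h1
      · rw [(h.1 _ _ h1).1, zero_mul]
      · rw [(h'.1 _ _ h1).1, mul_zero]
      · rw [(h.1 _ _ h1).2, zero_mul]
      · rw [(h'.1 _ _ h1).2, mul_zero]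
    · rw [coeff_coeff_mul]
      refine sum_mem fun a ha => sum_mem fun b hb => ?_
      rw [Finset.HasAntidiagonal.mem_antidiagonal] at ha
      have := mul_mem_wordFilt (h.2 a.1 b.1) (h'.2 a.2 b.2)
      rwa [add_right_comm, ← add_mul, ha] at this
    · rw [coeff_coeff_mul, coeff_coeff_mul]
      refine IsSymb.sum _ fun a ha => IsSymb.sum _ fun b hb => ?_
      rw [Finset.HasAntidiagonal.mem_antidiagonal] at ha hb
      rcases Nat.lt_or_ge N (b.1 + a.1) with h1 | h1
      · rw [(h.1 _ _ h1).1, zero_mul, (h.1 _ _ h1).2, zero_mul]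
        exact IsSymb.zero
      rcases Nat.lt_or_ge N' (b.2 + a.2) with h2 | h2
      · rw [(h'.1 _ _ h2).1, mul_zero, (h'.1 _ _ h2).2, mul_zero]
        exact IsSymb.zero
      have := (h.3 a.1 b.1 (N - b.1) (by omega) (by omega)).mul loopWeight_commutator
        (h'.3 a.2 b.2 (N' - b.2) (by omega) (by omega))
      rwa [show 2 * (N - b.1) - a.1 + (2 * (N' - b.2) - a.2) = 2 * e - j by omega] at this

lemma loopRel_X_sub (i : ℕ) : LoopRel k n p 1 (C (X - (i : (Yangian k n p)[X]))) (C X) := by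
  have hi : (i : Yangian k n p) ∈ wordFilt k (letter k n p) (loopWeight n p) 1 := by
    have := Submodule.smul_mem _ (i : k)
      (one_mem_wordFilt (k := k) (t := letter k n p) (w := loopWeight n p) (Nat.zero_lt_one))
    rwa [Nat.cast_smul_eq_nsmul, nsmul_one] at this
  refine ⟨fun j d hd => ?_, fun j d => ?_, fun j d e hd hj => ?_⟩ <;>
    rw [coeff_C]
  · rw [coeff_C]
    split_ifs
    · rw [coeff_sub, coeff_X, coeff_X, coeff_natCast_ite]
      simp [show 1 ≠ d by omega, show d ≠ 0 by omega]
    · simp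
  · split_ifs with h
    · rw [coeff_sub, coeff_X, coeff_natCast_ite, h, zero_mul]
      refine sub_mem ?_ ?_
      · split_ifs
        · exact one_mem_wordFilt (by omega)
        · exact zero_mem _
      · rw [zero_add]
        split_ifs
        · exact hi
        · rw [Nat.cast_zero]
          exact zero_mem _
    · exact zero_mem _
  · rw [coeff_C]
    split_ifs with h
    · rw [coeff_sub, coeff_X, coeff_X, coeff_natCast_ite]
      rcases (by omega : d = 0 ∧ e = 1 ∨ d = 1 ∧ e = 0) with ⟨rfl, rfl⟩ | ⟨rfl, rfl⟩
      · simp only [one_ne_zero, if_false, if_true, zero_sub]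
        exact IsSymb.of_mem (neg_mem (wordFilt_mono (by omega) hi))
      · subst h
        simpa using IsSymb.one
    · exact IsSymb.zero

lemma coeff_coeff_X_mul_C_C {A : Type*} [Ring A] (x : A) (j d : ℕ) :
    (((X : A[X][X]) * C (C x)).coeff j).coeff d = if j = 1 ∧ d = 0 then x else 0 := by
  rw [coeff_mul_C, coeff_X, ite_mul, one_mul, zero_mul, ite_and, eq_comm]
  by_cases h : j = 1 <;> by_cases h' : d = 0 <;> simp [h, h', coeff_C, eq_comm]

lemma loopRel_letter (a : Fin n × Fin n × Fin p) :
    LoopRel k n p (a.2.2 + 1) (X * C (C (letter k n p a)))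
      (X * C (C (MvPolynomial.X a))) := by
  refine ⟨fun j d hd => ?_, fun j d => ?_, fun j d e hd hj => ?_⟩ <;>
    rw [coeff_coeff_X_mul_C_C]
  · rw [coeff_coeff_X_mul_C_C, if_neg (by omega), if_neg (by omega)]
    exact ⟨rfl, rfl⟩
  · split_ifs with h
    · refine wordFilt_mono ?_ (letter_mem_wordFilt _ _ _)
      rw [loopWeight, h.1]
      omega
    · exact zero_mem _
  · rw [coeff_coeff_X_mul_C_C]
    split_ifs with h
    · have := isSymb_gen (k := k) loopWeight_commutator a
      rwa [show loopWeight n p a = 2 * e - j by rw [loopWeight]; omega] at this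
    · exact IsSymb.zero

/-- The shifted generating matrix with an extra variable counting generators. -/
def loopShiftMatrix (k : Type*) [Field k] (n p i : ℕ) :
    Matrix (Fin n) (Fin n) (Yangian k n p)[X][X] :=
  Matrix.of fun a b => (if a = b then C (X - (i : (Yangian k n p)[X])) ^ p else 0)
    + ∑ r : Fin p, (X * C (C (letter k n p (a, b, r))))
      * C (X - (i : (Yangian k n p)[X])) ^ (p - 1 - r)

/-- The generic element of the truncated current algebra. -/
def currentMatrix (k : Type*) [Field k] (n p : ℕ) :
    Matrix (Fin n) (Fin n) (MvPolynomial (Fin n × Fin n × Fin p) k)[X] :=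
  Matrix.of fun a b => ∑ r : Fin p, C (MvPolynomial.X (a, b, r)) * X ^ (p - 1 - r)

/-- The symbol of the matrix `loopShiftMatrix`. -/
def loopSymbolMatrix (k : Type*) [Field k] (n p : ℕ) :
    Matrix (Fin n) (Fin n) (MvPolynomial (Fin n × Fin n × Fin p) k)[X][X] :=
  (C (X ^ p) : (MvPolynomial (Fin n × Fin n × Fin p) k)[X][X]) • 1
    + (X : (MvPolynomial (Fin n × Fin n × Fin p) k)[X][X]) • (currentMatrix k n p).map C

lemma loopRel_loopShiftMatrix (i : ℕ) (a b : Fin n) :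
    LoopRel k n p p (loopShiftMatrix k n p i a b) (loopSymbolMatrix k n p a b) := by
  have h : LoopRel k n p p (loopShiftMatrix k n p i a b)
      ((if a = b then C X ^ p else 0) + ∑ r : Fin p, (X * C (C (MvPolynomial.X (a, b, r))))
        * C X ^ (p - 1 - r)) := by
    rw [loopShiftMatrix, Matrix.of_apply]
    have hX (r : ℕ) := (isGradedRel_loopRel (k := k)).pow
      (loopRel_X_sub (k := k) (n := n) (p := p) i) r
    refine (isGradedRel_loopRel (k := k)).add ?_
      ((isGradedRel_loopRel (k := k)).sum _ fun r hr => ?_)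
    · split_ifs
      · simpa using hX p
      · exact (isGradedRel_loopRel (k := k)).zero p
    · have := (isGradedRel_loopRel (k := k)).mul (loopRel_letter (k := k) (a, b, r)) (hX (p - 1 - r))
      rwa [mul_one, show (r : ℕ) + 1 + (p - 1 - r) = p by omega] at this
  convert h using 1
  simp only [loopSymbolMatrix, Matrix.add_apply, Matrix.smul_apply, Matrix.one_apply, Matrix.map_apply,
    currentMatrix, Matrix.of_apply, map_sum, map_mul, map_pow, smul_eq_mul, mul_ite, mul_one,
    mul_zero, Finset.mul_sum, mul_assoc]

/-- Coefficients of `det (u + X * A)` are coefficients of a characteristic polynomial. -/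
lemma coeff_det_smul_one_add {R : Type*} [CommRing R] [IsDomain R] (A : Matrix (Fin n) (Fin n) R)
    {u : R} (hu : u ≠ 0) {d : ℕ} (hd : d ≤ n) :
    (C u • (1 : Matrix (Fin n) (Fin n) R[X]) + (X : R[X]) • A.map C).det.coeff d
      = u ^ (n - d) * (-A).charpoly.coeff (n - d) := by
  have h1 : ((C u • (1 : Matrix (Fin n) (Fin n) R[X]) + (X : R[X]) • A.map C).det).comp (C u * X)
      = C (u ^ n) * (-A).charpolyRev := by
    have : (C u • (1 : Matrix (Fin n) (Fin n) R[X]) + (X : R[X]) • A.map C).map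
        (compRingHom (C u * X)) = C u • (1 - (X : R[X]) • (-A).map C) := by
      ext1 i j
      by_cases hij : i = j
      · simp [hij, mul_add]
        ring
      · simp [hij]
        ring
    rw [← coe_compRingHom_apply, RingHom.map_det, RingHom.mapMatrix_apply, this, Matrix.det_smul,
      Matrix.charpolyRev, C_pow, Fintype.card_fin]
  have h2 := congrArg (fun f => f.coeff d) h1
  simp only [comp_C_mul_X_coeff, coeff_C_mul] at h2
  have h3 : (-A).charpolyRev.coeff d = (-A).charpoly.coeff (n - d) := by
    rw [← Matrix.reverse_charpoly, coeff_reverse, Matrix.charpoly_natDegree_eq_dim,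
      Fintype.card_fin, revAt_le hd]
  have h4 : u ^ n = u ^ (n - d) * u ^ d := by rw [← pow_add, Nat.sub_add_cancel hd]
  rw [h3, h4, mul_right_comm] at h2
  exact mul_right_cancel₀ (pow_ne_zero d hu) h2

lemma isSymb_casimir_loopWeight {m d : ℕ} (hm : m ≤ n * p) (hd : d ≤ n) (hd0 : 0 < d)
    (h1 : (d - 1) * p < m) (h2 : m ≤ d * p) :
    IsSymb k (letter k n p) (loopWeight n p) (2 * m - d) (casimir k n p m)
      (((-currentMatrix k n p).charpoly.coeff (n - d)).coeff (d * p - m)) := by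
  set Q := qdet fun i : Fin n => loopShiftMatrix k n p i with hQ
  have hrel := (isGradedRel_loopRel (k := k)).qdet (R := LoopRel k n p)
    (V := fun i => loopShiftMatrix k n p i) (F := loopSymbolMatrix k n p)
    fun i a b => loopRel_loopShiftMatrix i a b
  rw [← hQ] at hrel
  have hev : casimir k n p m
      = ∑ j ∈ Finset.range (Q.natDegree + d + 1), (Q.coeff j).coeff (n * p - m) := by
    let φ : (Yangian k n p)[X][X] →+* (Yangian k n p)[X] :=
      eval₂RingHom' (RingHom.id _) 1 fun a => Commute.one_right _
    have hφ : φ Q = qdet fun i : Fin n => shiftMatrix k n p i := by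
      rw [hQ, map_qdet]
      congr 1
      ext1 i
      refine Matrix.ext fun a b => ?_
      rw [Matrix.map_apply, loopShiftMatrix, shiftMatrix, Matrix.of_apply, Matrix.of_apply,
        Finset.sum_range_succ', map_add, map_sum, gen_zero, add_comm,
        ← Fin.sum_univ_eq_sum_range (fun r => C (gen k n p a b (r + 1))
          * (X - ((i : ℕ) : (Yangian k n p)[X])) ^ (p - (r + 1))) p]
      have hφC (x : (Yangian k n p)[X]) : φ (C x) = x := by simp [φ]
      have hφX : φ X = 1 := by simp [φ]
      congr 1
      · refine Finset.sum_congr rfl fun r _ => ?_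
        rw [map_mul, map_mul, map_pow, hφC, hφC, hφX, one_mul, Nat.sub_sub, add_comm 1]
        rfl
      · split_ifs
        · rw [map_pow, hφC, C_1, one_mul, Nat.sub_zero]
        · simp
    rw [casimir, ← hφ]
    have : φ Q = ∑ j ∈ Finset.range (Q.natDegree + d + 1), Q.coeff j := by
      refine (eval₂_eq_sum_range' _ (n := Q.natDegree + d + 1) (by omega) _).trans ?_
      simp
    rw [this, finsetSum_coeff]
  have hF : (((-currentMatrix k n p).charpoly.coeff (n - d)).coeff (d * p - m))
      = ((loopSymbolMatrix k n p).det.coeff d).coeff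
        (n * p - m) := by
    rw [loopSymbolMatrix, coeff_det_smul_one_add _ (pow_ne_zero p X_ne_zero) hd, ← pow_mul]
    have : n * p - m = (d * p - m) + p * (n - d) := by
      obtain ⟨c, rfl⟩ := Nat.exists_eq_add_of_le hd
      rw [add_mul, Nat.add_sub_cancel_left, mul_comm p]
      omega
    rw [this, coeff_X_pow_mul]
  have hsum : (((-currentMatrix k n p).charpoly.coeff (n - d)).coeff (d * p - m))
      = ∑ j ∈ Finset.range (Q.natDegree + d + 1), if j = d then
        ((loopSymbolMatrix k n p).det.coeff j).coeff
          (n * p - m) else 0 := by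
    rw [Finset.sum_ite_eq', if_pos (Finset.mem_range.2 (by omega)), hF]
  have hdm : d ≤ m := by
    obtain ⟨c, rfl⟩ := Nat.exists_eq_add_of_le' hd0
    rcases Nat.eq_zero_or_pos p with rfl | hp
    · omega
    · have := Nat.le_mul_of_pos_right c hp
      rw [Nat.add_sub_cancel] at h1
      omega
  rw [hev, hsum]
  refine IsSymb.sum _ fun j _ => ?_
  split_ifs with hj
  · subst hj
    exact hrel.3 _ _ _ (by omega) hdm
  rcases Nat.lt_or_gt_of_ne hj with hj | hj
  · refine IsSymb.of_mem (wordFilt_mono ?_ (hrel.2 j _))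
    obtain ⟨c, rfl⟩ := Nat.exists_eq_add_of_le' hd0
    rw [Nat.add_sub_cancel] at h1
    have hjc : j ≤ c := by omega
    have h3 := Nat.mul_le_mul_right (2 * p - 1) hjc
    have h4 : c * (2 * p - 1) = 2 * (c * p) - c := by
      rw [Nat.mul_sub, mul_one]
      congr 1
      ring
    omega
  · rcases Nat.lt_or_ge m j with hmj | hmj
    · rw [(hrel.1 j _ (by omega)).1]
      exact IsSymb.zero
    · have := (hrel.3 j (n * p - m) m (by omega) hmj).of_lt (E := 2 * m - d) (by omega)
      exact this

end Yangian

end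

section

namespace Yangian

open Polynomial

variable {k : Type*} [Field k] {n p : ℕ} {Q : Type*} [CommRing Q] [Algebra k Q]

/-- Evaluation of functions on the truncated current algebra at the matrix `-B`. -/
def coordEval (k : Type*) [Field k] (p : ℕ) [Algebra k Q] (B : Matrix (Fin n) (Fin n) Q[X]) :
    MvPolynomial (Fin n × Fin n × Fin p) k →ₐ[k] Q :=
  MvPolynomial.aeval fun a => -(B a.1 a.2.1).coeff (p - 1 - a.2.2)

lemma coordEval_X (B : Matrix (Fin n) (Fin n) Q[X]) (a : Fin n × Fin n × Fin p) :
    coordEval k p B (MvPolynomial.X a) = -(B a.1 a.2.1).coeff (p - 1 - a.2.2) :=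
  MvPolynomial.aeval_X _ _

lemma coordEval_coordX (B : Matrix (Fin n) (Fin n) Q[X]) (i j : Fin n) (u : ℕ) :
    coordEval k p B (coordX k n p i j u) = if u < p then -(B i j).coeff (p - 1 - u) else 0 := by
  rw [coordX]
  split_ifs with h
  · exact coordEval_X _ _
  · exact map_zero _

lemma map_coordEval {Q' : Type*} [CommRing Q'] [Algebra k Q'] (φ : Q →ₐ[k] Q')
    (B : Matrix (Fin n) (Fin n) Q[X]) (f : MvPolynomial (Fin n × Fin n × Fin p) k) :
    φ (coordEval k p B f) = coordEval k p (B.map (Polynomial.map (φ : Q →+* Q'))) f := by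
  have : φ.comp (coordEval k p B) = coordEval k p (B.map (Polynomial.map (φ : Q →+* Q'))) := by
    refine MvPolynomial.algHom_ext fun a => ?_
    simp [coordEval_X]
  exact DFunLike.congr_fun this f

lemma sum_coeff_mul_truncated (q b : Q[X]) (s : Fin p) :
    ∑ r : Fin p, q.coeff r * (if (r : ℕ) + s < p then -b.coeff (p - 1 - (r + s)) else 0)
      = -(q * b).coeff (p - 1 - s) := by
  rw [coeff_mul, Finset.Nat.sum_antidiagonal_eq_sum_range_succ_mk, ← Finset.sum_neg_distrib,
    Fin.sum_univ_eq_sum_range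
      (fun r => q.coeff r * (if r + s < p then -b.coeff (p - 1 - (r + s)) else 0)) p]
  have hs := s.2
  symm
  refine (Finset.sum_congr rfl fun r hr => ?_).trans
    (Finset.sum_subset (Finset.range_mono (by omega)) fun r _ hr => ?_)
  · rw [Finset.mem_range] at hr
    rw [if_pos (by omega), mul_neg, show p - 1 - (r + s) = p - 1 - s - r by omega]
  · rw [Finset.mem_range] at hr
    rw [if_neg (by omega), mul_zero]

/-- A derivation moving `B` along a commutator acts through the coadjoint vector fields. -/
lemma derivation_coordEval (d : Derivation k Q Q) (B H : Matrix (Fin n) (Fin n) Q[X])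
    (hB : ∀ i j e, d ((B i j).coeff e) = ((H * B - B * H) i j).coeff e)
    (f : MvPolynomial (Fin n × Fin n × Fin p) k) :
    d (coordEval k p B f) = ∑ a : Fin n × Fin n × Fin p,
      (H a.2.1 a.1).coeff a.2.2 * coordEval k p B (coadDer k n p a f) := by
  induction f using MvPolynomial.induction_on with
  | C c =>
    rw [← MvPolynomial.algebraMap_eq, AlgHom.commutes, Derivation.map_algebraMap]
    simp
  | add f g hf hg => simp only [map_add, hf, hg, mul_add, Finset.sum_add_distrib]
  | mul_X f b hf =>
    have hb : d (coordEval k p B (MvPolynomial.X b)) = ∑ a : Fin n × Fin n × Fin p,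
        (H a.2.1 a.1).coeff a.2.2
          * coordEval k p B (coadDer k n p a (MvPolynomial.X b)) := by
      obtain ⟨x, y, s⟩ := b
      simp only [coordEval_X, map_neg, hB, coadDer, MvPolynomial.mkDerivation_X, coadValue, map_sub,
        apply_ite (coordEval k p B), coordEval_coordX, map_zero, mul_sub, Finset.sum_sub_distrib,
        Matrix.sub_apply, coeff_sub, Matrix.mul_apply, finsetSum_coeff, neg_sub]
      have h1 : ∑ a : Fin n × Fin n × Fin p, (H a.2.1 a.1).coeff a.2.2 * (if x = a.2.1 then
          (if (a.2.2 : ℕ) + s < p then -(B a.1 y).coeff (p - 1 - (a.2.2 + s)) else 0) else 0)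
          = -∑ i, (H x i * B i y).coeff (p - 1 - s) := by
        rw [Fintype.sum_prod_type, ← Finset.sum_neg_distrib]
        refine Finset.sum_congr rfl fun i _ => ?_
        rw [Fintype.sum_prod_type, Finset.sum_eq_single x]
        · simpa using sum_coeff_mul_truncated (H x i) (B i y) s
        · intro j _ hj
          simp [hj.symm]
        · simp
      have h2 : ∑ a : Fin n × Fin n × Fin p, (H a.2.1 a.1).coeff a.2.2 * (if a.1 = y then
          (if (a.2.2 : ℕ) + s < p then -(B x a.2.1).coeff (p - 1 - (a.2.2 + s)) else 0) else 0)
          = -∑ j, (B x j * H j y).coeff (p - 1 - s) := by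
        rw [Fintype.sum_prod_type, Finset.sum_eq_single y]
        · rw [Fintype.sum_prod_type, ← Finset.sum_neg_distrib]
          refine Finset.sum_congr rfl fun j _ => ?_
          rw [mul_comm (B x j)]
          simpa using sum_coeff_mul_truncated (H j y) (B x j) s
        · intro j _ hj
          simp [hj]
        · simp
      rw [h1, h2]
      ring
    simp only [map_mul, Derivation.leibniz, hf, hb, smul_eq_mul, map_add, mul_add,
      Finset.sum_add_distrib, Finset.mul_sum]
    congr 1 <;> exact Finset.sum_congr rfl fun a _ => by ring

/-- Differentiation of the coefficients of a polynomial is a derivation. -/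
lemma exists_coeff_derivative (Q : Type*) [CommRing Q] : ∃ D : Q[X][X] →+ Q[X][X],
    (∀ f g, D (f * g) = D f * g + f * D g) ∧ ∀ f e, (D f).coeff e = derivative (f.coeff e) := by
  refine ⟨((Bivariate.swap (R := Q)).toAddEquiv.toAddMonoidHom.comp
    ((derivative (R := Q[X])).toAddMonoidHom)).comp
      (Bivariate.swap (R := Q)).toAddEquiv.toAddMonoidHom, fun f g => ?_, fun f e => ?_⟩
  · change Bivariate.swap (derivative (Bivariate.swap (f * g)))
      = Bivariate.swap (derivative (Bivariate.swap f)) * g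
        + f * Bivariate.swap (derivative (Bivariate.swap g))
    simp only [map_mul, derivative_mul, map_add, Bivariate.swap_swap_apply]
  · change (Bivariate.swap (derivative (Bivariate.swap f))).coeff e = derivative (f.coeff e)
    induction f using Polynomial.induction_on' with
    | add f g hf hg => simp only [map_add, coeff_add, hf, hg]
    | monomial i q =>
      induction q using Polynomial.induction_on' with
      | add f g hf hg => simp only [map_add, coeff_add, hf, hg]
      | monomial j r =>
        rw [Bivariate.swap_monomial_monomial, derivative_monomial, ← C_eq_natCast,
          monomial_mul_C, Bivariate.swap_monomial_monomial, coeff_monomial, coeff_monomial]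
        split_ifs
        · rw [derivative_monomial]
        · rw [derivative_zero]

lemma conj_deriv_identity {A : Type*} [Ring A] {u v : A} (huv : u * v = 1) (b w : A) :
    -(v * w * v) * b * u + v * b * w = -(v * w) * (v * b * u) - v * b * u * -(v * w) := by
  have h : v * b * u * -(v * w) = -(v * b * (u * v) * w) := by noncomm_ring
  rw [h, huv]
  noncomm_ring

lemma isAddTorsionFree_of_algebra (k Q : Type*) [Field k] [CharZero k] [CommRing Q] [Algebra k Q] :
    IsAddTorsionFree Q :=
  have : Module ℚ Q := Module.compHom Q (algebraMap ℚ k)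
  .of_module_rat Q

/-- An invariant function does not change along a nilpotent conjugation. -/
lemma coordEval_eq_of_nilpotent_conj [CharZero k] {f : MvPolynomial (Fin n × Fin n × Fin p) k}
    (hf : ∀ a, coadDer k n p a f = 0) {c : Q} (hc : IsNilpotent c)
    (G B B' : Matrix (Fin n) (Fin n) Q[X])
    (hG : (1 + C c • G) * B = B' * (1 + C c • G)) :
    coordEval k p B f = coordEval k p B' f := by
  let ι : Matrix (Fin n) (Fin n) Q[X] →+* Matrix (Fin n) (Fin n) Q[X][X] :=
    (mapRingHom (C : Q →+* Q[X])).mapMatrix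
  obtain ⟨D, hDL, hD⟩ := exists_coeff_derivative Q
  have hDmul (M N : Matrix (Fin n) (Fin n) Q[X][X]) :
      (M * N).map D = M.map D * N + M * N.map D := by
    ext1 i j
    simp only [Matrix.map_apply, Matrix.mul_apply, Matrix.add_apply, map_sum, hDL,
      Finset.sum_add_distrib]
  have hDι (M : Matrix (Fin n) (Fin n) Q[X]) : (ι M).map D = 0 := by
    ext i j : 2
    refine Polynomial.ext fun e => ?_
    rw [Matrix.map_apply, hD]
    simp [ι]
  have hnil : IsNilpotent ((C (X * C c) : Q[X][X]) • ι G) := by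
    obtain ⟨N, hN⟩ := hc
    refine ⟨N, ?_⟩
    rw [_root_.smul_pow, ← C_pow, mul_pow, ← C_pow, hN]
    simp
  obtain ⟨v, huv, hvu⟩ := isUnit_iff_exists.1 hnil.isUnit_one_add
  set u : Matrix (Fin n) (Fin n) Q[X][X] := 1 + (C (X * C c) : Q[X][X]) • ι G with hu
  have hDX : D (C (X * C c)) = C (C c) := by
    refine Polynomial.ext fun e => ?_
    rw [hD, coeff_C, coeff_C]
    split_ifs <;> simp
  have hDu : u.map D = (C (C c) : Q[X][X]) • ι G := by
    ext1 i j
    have h1 := congrFun (congrFun (hDι 1) i) j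
    have h2 := congrFun (congrFun (hDι G) i) j
    rw [map_one, Matrix.map_apply, Matrix.zero_apply] at h1
    rw [Matrix.map_apply, Matrix.zero_apply] at h2
    rw [hu, Matrix.map_apply, Matrix.add_apply, map_add, h1, Matrix.smul_apply, smul_eq_mul, hDL,
      h2, hDX, Matrix.smul_apply, smul_eq_mul]
    ring
  have hDv : v.map D
      = -(v * ((C (C c) : Q[X][X]) • ι G) * v) := by
    have h1 := hDι 1
    rw [map_one, ← hvu, hDmul, hDu] at h1
    have h2 := congrArg (· * v) h1
    simp only [add_mul, mul_assoc, huv, mul_one, zero_mul] at h2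
    rw [mul_assoc]
    exact eq_neg_of_add_eq_zero_left h2
  set H : Matrix (Fin n) (Fin n) Q[X][X] := v * ((C (C c) : Q[X][X]) • ι G) with hH
  set Bs : Matrix (Fin n) (Fin n) Q[X][X] := v * ι B' * u with hBs
  have hDB : Bs.map D = -H * Bs - Bs * -H := by
    rw [hBs, hDmul, hDmul, hDι, hDv, hDu, hH]
    rw [mul_zero, add_zero]
    exact conj_deriv_identity huv _ _
  have hconst : derivative (coordEval k p Bs f) = 0 := by
    have := derivation_coordEval ((derivative' (R := Q)).restrictScalars k) Bs (-H)
      (fun i j e => (hD _ _).symm.trans (congrArg (fun M => (M i j).coeff e) hDB)) f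
    simpa [hf] using this
  have := isAddTorsionFree_of_algebra k Q
  have hC := eq_C_of_derivative_eq_zero hconst
  have heval (t : Q) (M : Matrix (Fin n) (Fin n) Q[X])
      (hM : (1 + C (t * c) • G) * M = B' * (1 + C (t * c) • G)) :
      coordEval k p M f = (coordEval k p Bs f).coeff 0 := by
    let φ : Q[X] →ₐ[k] Q := (aeval t).restrictScalars k
    let ψ : Matrix (Fin n) (Fin n) Q[X][X] →+* Matrix (Fin n) (Fin n) Q[X] :=
      (mapRingHom (φ : Q[X] →+* Q)).mapMatrix
    have hψι (M : Matrix (Fin n) (Fin n) Q[X]) : ψ (ι M) = M := by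
      ext1 i j
      refine Polynomial.ext fun e => ?_
      simp [ψ, ι, φ]
    have hψu : ψ u = 1 + C (t * c) • G := by
      have h1 : ψ ((C (X * C c) : Q[X][X]) • ι G) = (C (t * c) : Q[X]) • ψ (ι G) := by
        ext1 i j
        simp [ψ, φ]
        ring
      rw [hu, map_add, map_one, h1, hψι]
    have hψB : ψ Bs = M := by
      rw [hBs, map_mul, map_mul, hψι, mul_assoc, hψu, ← hM, ← hψu, ← mul_assoc, ← map_mul,
        hvu, map_one, one_mul]
    have h1 := map_coordEval φ Bs f
    rw [hC] at h1
    refine (congrArg (fun M => coordEval k p M f) hψB.symm).trans (h1.symm.trans ?_)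
    simp [φ]
  rw [heval 1 B (by rwa [one_mul]), heval 0 B' (by simp)]

end Yangian

end

section

namespace Yangian

open Polynomial

variable {n p : ℕ}

/-- The companion matrix of a polynomial. -/
def companionMatrix {R : Type*} [CommRing R] (n : ℕ) (q : R[X]) : Matrix (Fin n) (Fin n) R :=
  Matrix.of fun i j => if (j : ℕ) + 1 < n then (if (i : ℕ) = j + 1 then 1 else 0)
    else -q.coeff i

/-- The subdiagonal shift. -/
def shiftDown (R : Type*) [CommRing R] (n : ℕ) : Matrix (Fin n) (Fin n) R :=
  Matrix.of fun i j => if (i : ℕ) = j + 1 then 1 else 0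

/-- The matrix with columns `M ^ j e₀`. -/
def krylovMatrix {R : Type*} [CommRing R] (hn : 0 < n) (M : Matrix (Fin n) (Fin n) R) :
    Matrix (Fin n) (Fin n) R :=
  Matrix.of fun i j => (M ^ (j : ℕ)) i ⟨0, hn⟩

section

variable {R : Type*} [CommRing R]

lemma mul_krylovMatrix (hn : 0 < n) (M : Matrix (Fin n) (Fin n) R) :
    M * krylovMatrix hn M = krylovMatrix hn M * companionMatrix n M.charpoly := by
  nontriviality R
  ext1 i j
  have h1 : (M * krylovMatrix hn M) i j = (M ^ ((j : ℕ) + 1)) i ⟨0, hn⟩ := by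
    rw [pow_succ', Matrix.mul_apply, Matrix.mul_apply]
    rfl
  rw [h1, Matrix.mul_apply]
  simp only [krylovMatrix, companionMatrix, Matrix.of_apply]
  split_ifs with h
  · rw [Finset.sum_eq_single ⟨j + 1, h⟩]
    · simp
    · intro l _ hl
      rw [if_neg fun h' => hl (Fin.ext h'), mul_zero]
    · simp
  · have hCH := congrFun (congrFun M.aeval_self_charpoly i) ⟨0, hn⟩
    have hdeg : M.charpoly.natDegree = n := by
      rw [Matrix.charpoly_natDegree_eq_dim, Fintype.card_fin]
    have hlead : M.charpoly.coeff n = 1 := by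
      have := M.charpoly_monic.coeff_natDegree
      rwa [hdeg] at this
    rw [aeval_eq_sum_range, hdeg, Finset.sum_range_succ, hlead, one_smul, Matrix.add_apply,
      Matrix.sum_apply, Matrix.zero_apply,
      ← Fin.sum_univ_eq_sum_range (fun l => (M.charpoly.coeff l • M ^ l) i ⟨0, hn⟩) n] at hCH
    rw [show (j : ℕ) + 1 = n by omega, eq_neg_of_add_eq_zero_right hCH, ← Finset.sum_neg_distrib]
    refine Finset.sum_congr rfl fun l _ => ?_
    rw [Matrix.smul_apply, smul_eq_mul]
    ring

lemma shiftDown_apply (i j : Fin n) :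
    shiftDown R n i j = if (i : ℕ) = j + 1 then 1 else 0 :=
  rfl

lemma shiftDown_pow_apply (hn : 0 < n) (j : ℕ) (i : Fin n) :
    (shiftDown R n ^ j) i ⟨0, hn⟩ = if (i : ℕ) = j then 1 else 0 := by
  induction j generalizing i with
  | zero => simp [Matrix.one_apply, Fin.ext_iff]
  | succ j ih =>
    rw [pow_succ', Matrix.mul_apply]
    simp only [ih, shiftDown_apply]
    rcases Nat.lt_or_ge j n with hj | hj
    · rw [Finset.sum_eq_single ⟨j, hj⟩]
      · simp
      · intro l _ hl
        rw [if_neg fun h' => hl (Fin.ext h'), mul_zero]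
      · simp
    · rw [if_neg (by omega)]
      refine Finset.sum_eq_zero fun l _ => ?_
      rw [if_neg (c := (l : ℕ) = j) (by omega), mul_zero]

lemma exists_krylovMatrix_eq (hn : 0 < n) (c : R) (E : Matrix (Fin n) (Fin n) R) :
    ∃ G, krylovMatrix hn (shiftDown R n + c • E) = 1 + c • G := by
  have h (j : ℕ) : ∃ W, (shiftDown R n + c • E) ^ j = shiftDown R n ^ j + c • W := by
    induction j with
    | zero => exact ⟨0, by simp⟩
    | succ j ih =>
      obtain ⟨W, hW⟩ := ih
      refine ⟨shiftDown R n * W + E * shiftDown R n ^ j + c • (E * W), ?_⟩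
      rw [pow_succ', hW, add_mul, mul_add, mul_add, pow_succ', smul_mul_assoc, smul_mul_assoc,
        mul_smul_comm, mul_smul_comm, smul_add, smul_add]
      abel
  choose W hW using h
  refine ⟨Matrix.of fun i j => W j i ⟨0, hn⟩, ?_⟩
  ext1 i j
  simp only [krylovMatrix, Matrix.of_apply, hW, Matrix.add_apply, Matrix.smul_apply,
    shiftDown_pow_apply, Matrix.one_apply, Fin.ext_iff]

lemma companionMatrix_map {R' : Type*} [CommRing R'] (φ : R →+* R') (q : R[X]) :
    (companionMatrix n q).map φ = companionMatrix n (q.map φ) := by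
  ext1 i j
  simp only [companionMatrix, Matrix.map_apply, Matrix.of_apply, apply_ite φ, map_one, map_zero,
    map_neg, coeff_map]

end

variable {k : Type*} [Field k]

lemma coordEval_neg_currentMatrix (f : MvPolynomial (Fin n × Fin n × Fin p) k) :
    coordEval k p (-currentMatrix k n p) f = f := by
  have : coordEval k p (-currentMatrix k n p) = AlgHom.id k _ := by
    refine MvPolynomial.algHom_ext fun a => ?_
    obtain ⟨i, j, s⟩ := a
    rw [coordEval_X, Matrix.neg_apply, coeff_neg, neg_neg, currentMatrix, Matrix.of_apply,
      finsetSum_coeff, Finset.sum_eq_single s]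
    · simp
    · intro r _ hr
      rw [coeff_C_mul, coeff_X_pow, if_neg, mul_zero]
      have := s.2
      have := r.2
      have := Fin.val_ne_of_ne hr
      simp only
      omega
    · simp
  rw [this, AlgHom.id_apply]

/-- Invariants of the truncated current algebra are functions of the companion matrix. -/
lemma coordEval_companionMatrix [CharZero k] (hn : 0 < n)
    {f : MvPolynomial (Fin n × Fin n × Fin p) k} (hf : ∀ a, coadDer k n p a f = 0)
    {P : Type*} [CommRing P] [Algebra k P] (M : Matrix (Fin n) (Fin n) P[X]) :
    coordEval k p (companionMatrix n M.charpoly) f = coordEval k p M f := by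
  let A : Matrix (Fin n) (Fin n) P[X][X] := shiftDown P[X][X] n
    + (C X : P[X][X]) • (M.map (mapRingHom C) - shiftDown P[X][X] n)
  obtain ⟨G, hG⟩ : ∃ G, krylovMatrix hn A = 1 + (C X : P[X][X]) • G := exists_krylovMatrix_eq hn _ _
  have hA := mul_krylovMatrix hn A
  rw [hG] at hA
  have key : coordEval k p (companionMatrix n A.charpoly) f = coordEval k p A f := by
    rw [← sub_eq_zero]
    refine Polynomial.ext fun N => ?_
    rw [coeff_zero]
    refine (X_pow_dvd_iff (n := N + 1)).1 ?_ N (Nat.lt_succ_self N)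
    rw [← Ideal.mem_span_singleton, ← Ideal.Quotient.eq]
    let π : P[X] →ₐ[k] P[X] ⧸ Ideal.span {(X : P[X]) ^ (N + 1)} := Ideal.Quotient.mkₐ k _
    change π _ = π _
    rw [map_coordEval, map_coordEval]
    have hX : IsNilpotent (π X) := ⟨N + 1, by
      rw [← map_pow]
      exact Ideal.Quotient.eq_zero_iff_mem.2 (Ideal.mem_span_singleton_self _)⟩
    have h1 (M : Matrix (Fin n) (Fin n) P[X][X]) :
      M.map (Polynomial.map (π : P[X] →+* P[X] ⧸ Ideal.span {(X : P[X]) ^ (N + 1)})) = (mapRingHom (π : P[X] →+* P[X] ⧸ Ideal.span {(X : P[X]) ^ (N + 1)})).mapMatrix M := rfl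
    refine coordEval_eq_of_nilpotent_conj hf hX (G.map (Polynomial.map (π : P[X] →+* P[X] ⧸ Ideal.span {(X : P[X]) ^ (N + 1)}))) _ _ ?_
    have h2 : 1 + C (π X) • G.map (Polynomial.map (π : P[X] →+* P[X] ⧸ Ideal.span {(X : P[X]) ^ (N + 1)}))
        = (mapRingHom (π : P[X] →+* P[X] ⧸ Ideal.span {(X : P[X]) ^ (N + 1)})).mapMatrix (1 + (C X : P[X][X]) • G) := by
      rw [map_add, map_one]
      congr 1
      ext1 i j
      simp
    rw [h2, h1, h1, ← map_mul, ← map_mul, hA]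
  let φ : P[X] →ₐ[k] P := (aeval (1 : P)).restrictScalars k
  have h := congrArg φ key
  rw [map_coordEval, map_coordEval] at h
  have hφA : A.map (Polynomial.map (φ : P[X] →+* P)) = M := by
    ext1 i j
    refine Polynomial.ext fun e => ?_
    simp [A, φ]
  have hφK : (companionMatrix n A.charpoly).map (Polynomial.map (φ : P[X] →+* P))
      = companionMatrix n M.charpoly := by
    have := companionMatrix_map (n := n) (mapRingHom (φ : P[X] →+* P)) A.charpoly
    refine this.trans ?_
    rw [← Matrix.charpoly_map]
    exact congrArg (fun M => companionMatrix n (Matrix.charpoly M)) hφA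
  rwa [hφA, hφK] at h

/-- Invariants are generated by the coefficients of the characteristic polynomial. -/
lemma mem_adjoin_of_coadDer_eq_zero [CharZero k] (hn : 0 < n)
    {f : MvPolynomial (Fin n × Fin n × Fin p) k} (hf : ∀ a, coadDer k n p a f = 0) :
    f ∈ Algebra.adjoin k (Set.range fun b : Fin n × Fin p =>
      ((-currentMatrix k n p).charpoly.coeff b.1).coeff b.2) := by
  rw [← coordEval_neg_currentMatrix f, ← coordEval_companionMatrix hn hf]
  have h1 : coordEval k p (companionMatrix n (-currentMatrix k n p).charpoly) f
      ∈ (coordEval k p (companionMatrix n (-currentMatrix k n p).charpoly)).range := ⟨f, rfl⟩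
  rw [coordEval, ← Algebra.adjoin_range_eq_range_aeval] at h1
  refine Algebra.adjoin_le ?_ h1
  rintro _ ⟨⟨i, j, s⟩, rfl⟩
  refine neg_mem ?_
  have hs := s.2
  simp only [companionMatrix, Matrix.of_apply]
  split_ifs
  · rw [coeff_one]
    split_ifs
    · exact one_mem _
    · exact zero_mem _
  · exact zero_mem _
  · rw [coeff_neg]
    exact neg_mem (Algebra.subset_adjoin ⟨(i, ⟨p - 1 - s, by omega⟩), rfl⟩)

end Yangian

end

section

open Polynomial

/-- The ring `U` carries the universal factorization of `f` into monic factors of degrees `d i`,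
together with a universal family of elements indexed by `κ`. -/
structure IsUnivFactorization {R U : Type u} [CommRing R] [CommRing U] (φ₀ : R →+* U) (f : R[X])
    {ι κ : Type} [Fintype ι] (d : ι → ℕ) (g : ι → U[X]) (y : κ → U) : Prop where
  monic : ∀ i, (g i).Monic
  natDegree : ∀ i, (g i).natDegree = d i
  prod : f.map φ₀ = ∏ i, g i
  exists_lift : ∀ (A : Type u) [CommRing A] [Nontrivial A] (ρ : R →+* A) (G : ι → A[X]) (Y : κ → A),
    (∀ i, (G i).Monic) → (∀ i, (G i).natDegree = d i) → f.map ρ = ∏ i, G i →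
    ∃ φ : U →+* A, φ.comp φ₀ = ρ ∧ (∀ i, (g i).map φ = G i) ∧ ∀ j, φ (y j) = Y j
  ext : ∀ (A : Type u) [CommRing A] [Nontrivial A] (φ φ' : U →+* A), φ.comp φ₀ = φ'.comp φ₀ →
    (∀ i, (g i).map φ = (g i).map φ') → (∀ j, φ (y j) = φ' (y j)) → φ = φ'

namespace IsUnivFactorization

lemma nontrivial_adjoinRoot {U : Type*} [CommRing U] [Nontrivial U] {g : U[X]} (hg : g.Monic)
    (hd : 0 < g.natDegree) : Nontrivial (AdjoinRoot g) :=
  have : Nonempty (Fin (AdjoinRoot.powerBasis' hg).dim) := ⟨⟨0, hd⟩⟩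
  (AdjoinRoot.powerBasis' hg).basis.repr.toEquiv.nontrivial

lemma flat_of_adjoinRoot {R U : Type u} [CommRing R] [CommRing U] {φ₀ : R →+* U} {g : U[X]}
    (hg : g.Monic) (hd : 0 < g.natDegree) (h : ((AdjoinRoot.of g).comp φ₀).Flat) : φ₀.Flat := by
  algebraize [φ₀]
  have h1 : Module.Flat R (AdjoinRoot g) := RingHom.flat_algebraMap_iff.1 h
  let b := (AdjoinRoot.powerBasis' hg).basis
  let i0 : Fin (AdjoinRoot.powerBasis' hg).dim := ⟨0, hd⟩
  refine Module.Flat.of_retract (M := AdjoinRoot g)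
    (Algebra.linearMap U (AdjoinRoot g) |>.restrictScalars R) ((b.coord i0).restrictScalars R) ?_
  ext u
  have hb : b i0 = 1 := by
    rw [PowerBasis.coe_basis]
    simp [i0]
  change b.coord i0 (algebraMap U _ u) = u
  rw [Algebra.algebraMap_eq_smul_one, map_smul, ← hb]
  simp

variable {ι κ : Type} [Fintype ι] {d : ι → ℕ}

lemma flat_of_forall_eq_zero {R U : Type u} [CommRing R] [CommRing U] [Nontrivial U]
    {φ₀ : R →+* U} {f : R[X]} {g : ι → U[X]} {y : κ → U}
    (h : IsUnivFactorization φ₀ f d g y) (hf : f.Monic) (hd : ∀ i, d i = 0) : φ₀.Flat := by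
  have : Nontrivial R := φ₀.domain_nontrivial
  have hg (i : ι) : g i = 1 := (h.monic i).natDegree_eq_zero.1 (by rw [h.natDegree, hd])
  have hf1 : f = 1 := by
    refine hf.natDegree_eq_zero.1 ?_
    rw [← hf.natDegree_map φ₀, h.prod]
    simp [hg]
  obtain ⟨φ, h1, h2, h3⟩ := h.exists_lift (MvPolynomial κ R) MvPolynomial.C (fun _ => 1)
    MvPolynomial.X (fun _ => monic_one) (fun i => by rw [hd, natDegree_one]) (by simp [hf1])
  let ψ : MvPolynomial κ R →+* U := MvPolynomial.eval₂Hom φ₀ y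
  have hψφ : ψ.comp φ = RingHom.id U := by
    refine h.ext _ _ _ ?_ (fun i => by simp [hg]) fun j => ?_
    · rw [RingHom.comp_assoc, h1]
      ext r
      simp [ψ]
    · rw [RingHom.comp_apply, h3]
      simp [ψ]
  have hφψ : φ.comp ψ = RingHom.id _ := by
    refine MvPolynomial.ringHom_ext (fun r => ?_) fun j => ?_
    · simpa [ψ] using DFunLike.congr_fun h1 r
    · simp [ψ, h3]
  have hψ : φ₀ = ψ.comp MvPolynomial.C := by
    ext r
    simp [ψ]
  rw [hψ]
  refine RingHom.Flat.comp ?_ (RingHom.Flat.of_bijective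
    (RingEquiv.ofRingHom ψ φ hψφ hφψ).bijective)
  exact RingHom.flat_algebraMap_iff.2 (inferInstanceAs (Module.Flat R (MvPolynomial κ R)))

lemma exists_eq_X_sub_C_mul {R : Type*} [CommRing R] {p : R[X]} {a : R} (hp : p.Monic)
    (ha : p.IsRoot a) : ∃ q : R[X], q.Monic ∧ (X - C a) * q = p :=
  ⟨p /ₘ (X - C a), (monic_X_sub_C a).of_mul_monic_left
    (by rwa [mul_divByMonic_eq_iff_isRoot.2 ha]), mul_divByMonic_eq_iff_isRoot.2 ha⟩

/-- Splitting off a root from a factor of positive degree. -/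
lemma adjoin_root [DecidableEq ι] {R U : Type u} [CommRing R] [CommRing U] [Nontrivial U]
    {φ₀ : R →+* U} {f : R[X]} {g : ι → U[X]} {y : κ → U}
    (h : IsUnivFactorization φ₀ f d g y) (hf : f.Monic) {i0 : ι} {c : ℕ} (hd : d i0 = c + 1) :
    ∃ (φ₁ : AdjoinRoot f →+* AdjoinRoot (g i0)) (f₁ : (AdjoinRoot f)[X])
      (g₁ : ι → (AdjoinRoot (g i0))[X]) (y₁ : κ → AdjoinRoot (g i0)), f₁.Monic ∧
      φ₁.comp (AdjoinRoot.of f) = (AdjoinRoot.of (g i0)).comp φ₀ ∧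
      IsUnivFactorization φ₁ f₁ (Function.update d i0 c) g₁ y₁ := by
  have hr : ((g i0).map (AdjoinRoot.of (g i0))).IsRoot (AdjoinRoot.root (g i0)) := by
    rw [IsRoot, eval_map, AdjoinRoot.eval₂_root]
  have hprod : f.map ((AdjoinRoot.of (g i0)).comp φ₀)
      = ∏ i, (g i).map (AdjoinRoot.of (g i0)) := by
    rw [← Polynomial.map_map, h.prod, Polynomial.map_prod]
  have hfr : (f.map (AdjoinRoot.of f)).IsRoot (AdjoinRoot.root f) := by
    rw [IsRoot, eval_map, AdjoinRoot.eval₂_root]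
  obtain ⟨f₁, hf₁, hff₁⟩ := exists_eq_X_sub_C_mul (hf.map _) hfr
  obtain ⟨q, hq, hgq⟩ := exists_eq_X_sub_C_mul ((h.monic i0).map _) hr
  have hev : f.eval₂ ((AdjoinRoot.of (g i0)).comp φ₀) (AdjoinRoot.root (g i0)) = 0 := by
    rw [← eval_map, hprod, eval_prod]
    exact Finset.prod_eq_zero (Finset.mem_univ i0) hr
  let φ₁ : AdjoinRoot f →+* AdjoinRoot (g i0) := AdjoinRoot.lift _ _ hev
  have hφ₁ : φ₁.comp (AdjoinRoot.of f) = (AdjoinRoot.of (g i0)).comp φ₀ := by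
    ext r
    exact AdjoinRoot.lift_of hev
  have hφr : φ₁ (AdjoinRoot.root f) = AdjoinRoot.root (g i0) := AdjoinRoot.lift_root hev
  have hupd {A : Type u} [CommRing A] (a : A) (G : ι → A[X]) (G' : ι → A[X])
      (hG : ∀ i, i ≠ i0 → G' i = G i) (h0 : G' i0 = (X - C a) * G i0) :
      ∏ i, G' i = (X - C a) * ∏ i, G i := by
    rw [← Finset.mul_prod_erase _ _ (Finset.mem_univ i0), h0,
      ← Finset.mul_prod_erase _ G (Finset.mem_univ i0), mul_assoc]
    congr 2
    exact Finset.prod_congr rfl fun i hi => hG i (Finset.ne_of_mem_erase hi)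
  have : Nontrivial (AdjoinRoot (g i0)) :=
    nontrivial_adjoinRoot (h.monic i0) (by rw [h.natDegree, hd]; omega)
  refine ⟨φ₁, f₁, Function.update (fun i => (g i).map (AdjoinRoot.of (g i0))) i0 q,
    fun j => AdjoinRoot.of (g i0) (y j), hf₁, hφ₁, ?_, ?_, ?_, ?_, ?_⟩
  · intro i
    rcases eq_or_ne i i0 with rfl | hi
    · rwa [Function.update_self]
    · rw [Function.update_of_ne hi]
      exact (h.monic i).map _
  · intro i
    rcases eq_or_ne i i0 with rfl | hi
    · rw [Function.update_self, Function.update_self]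
      have h1 := congrArg Polynomial.natDegree hgq
      rw [(monic_X_sub_C _).natDegree_mul hq, natDegree_X_sub_C, (h.monic i).natDegree_map,
        h.natDegree, hd] at h1
      omega
    · rw [Function.update_of_ne hi, Function.update_of_ne hi, (h.monic i).natDegree_map,
        h.natDegree]
  · refine (monic_X_sub_C (AdjoinRoot.root (g i0))).isRegular.left ?_
    change (X - C _) * _ = (X - C _) * _
    rw [← hupd _ _ (fun i => (g i).map (AdjoinRoot.of (g i0)))
      (fun i hi => by rw [Function.update_of_ne hi]) (by rw [Function.update_self, hgq]),
      ← hprod, ← hφ₁, ← Polynomial.map_map, ← hff₁, Polynomial.map_mul, Polynomial.map_sub, map_X,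
      map_C, hφr]
  · intro A _ _ ρ G Y hG hGd hGp
    obtain ⟨φ, h1, h2, h3⟩ := h.exists_lift A (ρ.comp (AdjoinRoot.of f))
      (Function.update G i0 ((X - C (ρ (AdjoinRoot.root f))) * G i0)) Y (fun i => by
        rcases eq_or_ne i i0 with rfl | hi
        · rw [Function.update_self]
          exact (monic_X_sub_C _).mul (hG _)
        · rw [Function.update_of_ne hi]
          exact hG _) (fun i => by
        rcases eq_or_ne i i0 with rfl | hi
        · rw [Function.update_self, (monic_X_sub_C _).natDegree_mul (hG _), natDegree_X_sub_C,
            hGd, Function.update_self, hd, add_comm]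
        · rw [Function.update_of_ne hi, hGd, Function.update_of_ne hi]) (by
        rw [hupd (ρ (AdjoinRoot.root f)) G _ (fun i hi => Function.update_of_ne hi _ _)
          (Function.update_self _ _ _), ← hGp, ← Polynomial.map_map, ← hff₁, Polynomial.map_mul,
          Polynomial.map_sub, map_X, map_C])
    have h20 := h2 i0
    rw [Function.update_self] at h20
    have hev' : (g i0).eval₂ φ (ρ (AdjoinRoot.root f)) = 0 := by
      rw [← eval_map, h20]
      simp
    let φ' : AdjoinRoot (g i0) →+* A := AdjoinRoot.lift φ _ hev'
    have hφ' : φ'.comp (AdjoinRoot.of (g i0)) = φ := by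
      ext u
      exact AdjoinRoot.lift_of hev'
    have hφ'r : φ' (AdjoinRoot.root (g i0)) = ρ (AdjoinRoot.root f) := AdjoinRoot.lift_root hev'
    refine ⟨φ', AdjoinRoot.ringHom_ext ?_ ?_, fun i => ?_, fun j => ?_⟩
    · rw [RingHom.comp_assoc, hφ₁, ← RingHom.comp_assoc, hφ', h1]
    · rw [RingHom.comp_apply, hφr, hφ'r]
    · rcases eq_or_ne i i0 with rfl | hi
      · rw [Function.update_self]
        refine (monic_X_sub_C (ρ (AdjoinRoot.root f))).isRegular.left ?_
        change (X - C _) * _ = (X - C _) * _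
        rw [← h20, ← hφ', ← Polynomial.map_map, ← hgq, Polynomial.map_mul, Polynomial.map_sub, map_X,
          map_C, hφ'r]
      · rw [Function.update_of_ne hi, Polynomial.map_map, hφ', h2, Function.update_of_ne hi]
    · rw [← h3, ← hφ']
      rfl
  · intro A _ _ φ φ' h1 h2 h3
    have hroot : φ (AdjoinRoot.root (g i0)) = φ' (AdjoinRoot.root (g i0)) := by
      rw [← hφr]
      exact DFunLike.congr_fun h1 _
    refine AdjoinRoot.ringHom_ext (h.ext A _ _ ?_ (fun i => ?_) h3) hroot
    · rw [RingHom.comp_assoc, RingHom.comp_assoc, ← hφ₁, ← RingHom.comp_assoc, h1,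
        RingHom.comp_assoc]
    · rw [← Polynomial.map_map, ← Polynomial.map_map]
      have h2i := h2 i
      rcases eq_or_ne i i0 with rfl | hi
      · rw [Function.update_self] at h2i
        rw [← hgq, Polynomial.map_mul, Polynomial.map_mul, h2i]
        simp [hroot]
      · rwa [Function.update_of_ne hi] at h2i

theorem flat {R U : Type u} [CommRing R] [CommRing U] [Nontrivial U]
    {φ₀ : R →+* U} {f : R[X]} {g : ι → U[X]} {y : κ → U}
    (h : IsUnivFactorization φ₀ f d g y) (hf : f.Monic) : φ₀.Flat := by
  classical
  induction hN : ∑ i, d i generalizing R U d with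
  | zero => exact h.flat_of_forall_eq_zero hf (by simpa using hN)
  | succ N ih =>
    obtain ⟨i0, -, hi0⟩ := Finset.exists_ne_zero_of_sum_ne_zero (by rw [hN]; omega : ∑ i, d i ≠ 0)
    obtain ⟨c, hc⟩ := Nat.exists_eq_succ_of_ne_zero hi0
    obtain ⟨φ₁, f₁, g₁, y₁, hf₁, hφ₁, h₁⟩ := h.adjoin_root hf hc
    have : Nontrivial (AdjoinRoot (g i0)) :=
      nontrivial_adjoinRoot (h.monic i0) (by rw [h.natDegree, hc]; omega)
    have hflat := ih h₁ hf₁ (by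
      have e1 : d i0 + ∑ i ∈ Finset.univ.erase i0, d i = ∑ i, d i :=
        Finset.add_sum_erase Finset.univ d (Finset.mem_univ i0)
      have e2 : c + ∑ i ∈ Finset.univ.erase i0, d i = ∑ i, Function.update d i0 c i := by
        rw [← Finset.add_sum_erase Finset.univ (Function.update d i0 c) (Finset.mem_univ i0),
          Function.update_self]
        exact congrArg _ (Finset.sum_congr rfl fun i hi =>
          (Function.update_of_ne (Finset.ne_of_mem_erase hi) c d).symm)
      omega)
    refine flat_of_adjoinRoot (h.monic i0) (by rw [h.natDegree]; omega) ?_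
    rw [← hφ₁]
    refine RingHom.Flat.comp ?_ hflat
    have := hf.free_adjoinRoot
    exact RingHom.flat_algebraMap_iff.2 (inferInstanceAs (Module.Flat R (AdjoinRoot f)))

end IsUnivFactorization

end

section

section MonicOfCoeff

open Polynomial

/-- The monic polynomial of degree `N` with prescribed lower coefficients. -/
def monicOfCoeff {A : Type*} [CommRing A] {N : ℕ} (c : Fin N → A) : A[X] :=
  X ^ N + ∑ e : Fin N, C (c e) * X ^ (e : ℕ)

variable {A : Type*} [CommRing A] {N : ℕ}

lemma degree_sum_C_mul_X_pow_lt (c : Fin N → A) :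
    (∑ e : Fin N, C (c e) * X ^ (e : ℕ)).degree < (N : WithBot ℕ) := by
  refine lt_of_le_of_lt (degree_sum_le _ _) ((Finset.sup_lt_iff (WithBot.bot_lt_coe N)).2 ?_)
  intro e _
  exact lt_of_le_of_lt (degree_C_mul_X_pow_le _ _) (WithBot.coe_lt_coe.2 (Nat.cast_lt.2 e.2))

lemma monic_monicOfCoeff (c : Fin N → A) : (monicOfCoeff c).Monic :=
  monic_X_pow_add (degree_sum_C_mul_X_pow_lt c)

lemma natDegree_monicOfCoeff [Nontrivial A] (c : Fin N → A) : (monicOfCoeff c).natDegree = N := by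
  rw [monicOfCoeff, natDegree_add_eq_left_of_degree_lt, natDegree_X_pow]
  rw [degree_X_pow]
  exact degree_sum_C_mul_X_pow_lt c

lemma coeff_monicOfCoeff (c : Fin N → A) (e : Fin N) : (monicOfCoeff c).coeff e = c e := by
  rw [monicOfCoeff, coeff_add, coeff_X_pow, if_neg e.2.ne, zero_add, finsetSum_coeff,
    Finset.sum_eq_single e]
  · simp
  · intro b _ hb
    rw [coeff_C_mul, coeff_X_pow, if_neg fun h => hb (Fin.ext h.symm), mul_zero]
  · simp

lemma Polynomial.Monic.eq_monicOfCoeff {F : A[X]} (hF : F.Monic) (hN : F.natDegree = N) :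
    F = monicOfCoeff fun e : Fin N => F.coeff e := by
  subst hN
  rw [monicOfCoeff, Fin.sum_univ_eq_sum_range (fun e => C (F.coeff e) * X ^ e)]
  exact hF.as_sum

lemma map_monicOfCoeff {B : Type*} [CommRing B] (φ : A →+* B) (c : Fin N → A) :
    (monicOfCoeff c).map φ = monicOfCoeff fun e => φ (c e) := by
  simp [monicOfCoeff, Polynomial.map_sum]

end MonicOfCoeff

namespace Yangian

open Polynomial

variable (k : Type u) [Field k] (n p : ℕ)

lemma diagPoly_eq (i : Fin n) :
    diagPoly k n p i = monicOfCoeff fun e : Fin p => MvPolynomial.X (i, i, e.rev) := by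
  rw [diagPoly, monicOfCoeff]
  refine congrArg _ (Fintype.sum_equiv Fin.revPerm _ _ fun r => ?_)
  rw [Fin.revPerm_apply, Fin.rev_rev, Fin.val_rev, show p - (r + 1) = p - 1 - r by omega]

/-- The leading parts, for the weight `diagWeight`, of the generators of the center. -/
def diagCasimir (e : Fin (n * p)) : MvPolynomial (Fin n × Fin n × Fin p) k :=
  (∏ i, diagPoly k n p i).coeff e

/-- The inclusion of the leading parts of the center into all polynomials. -/
def diagCasimirHom : MvPolynomial (Fin (n * p)) k →+* MvPolynomial (Fin n × Fin n × Fin p) k :=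
  (MvPolynomial.aeval (R := k) (diagCasimir k n p)).toRingHom

lemma diagCasimirHom_X (e : Fin (n * p)) :
    diagCasimirHom k n p (MvPolynomial.X e) = diagCasimir k n p e :=
  MvPolynomial.aeval_X _ _

lemma diagCasimirHom_C (r : k) : diagCasimirHom k n p (MvPolynomial.C r) = MvPolynomial.C r :=
  MvPolynomial.aeval_C _ _

theorem isUnivFactorization_diagPoly :
    IsUnivFactorization (diagCasimirHom k n p)
      (monicOfCoeff fun e : Fin (n * p) => (MvPolynomial.X e : MvPolynomial _ k))
      (fun _ => p) (diagPoly k n p)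
      (fun b : {b : Fin n × Fin n × Fin p // b.1 ≠ b.2.1} => MvPolynomial.X b.1) where
  monic i := by
    rw [diagPoly_eq]
    exact monic_monicOfCoeff _
  natDegree i := by
    rw [diagPoly_eq]
    exact natDegree_monicOfCoeff _
  prod := by
    have h (i : Fin n) : (diagPoly k n p i).Monic := by
      rw [diagPoly_eq]
      exact monic_monicOfCoeff _
    rw [map_monicOfCoeff, (monic_prod_of_monic _ _ fun i _ => h i).eq_monicOfCoeff (N := n * p)]
    · simp only [diagCasimirHom_X, diagCasimir]
    · rw [natDegree_prod_of_monic _ _ fun i _ => h i]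
      simp [diagPoly_eq, natDegree_monicOfCoeff]
  exists_lift A _ _ ρ G Y hG hGd hGp := by
    classical
    let φ : MvPolynomial (Fin n × Fin n × Fin p) k →+* A :=
      MvPolynomial.eval₂Hom (ρ.comp MvPolynomial.C) fun b =>
        if h : b.1 = b.2.1 then (G b.1).coeff b.2.2.rev else Y ⟨b, h⟩
    have hφ (i : Fin n) : (diagPoly k n p i).map φ = G i := by
      rw [diagPoly_eq, map_monicOfCoeff, (hG i).eq_monicOfCoeff (hGd i)]
      simp only [φ, MvPolynomial.coe_eval₂Hom, MvPolynomial.eval₂_X, dite_true, Fin.rev_rev]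
    refine ⟨φ, ?_, hφ, fun b => ?_⟩
    · refine MvPolynomial.ringHom_ext (fun r => by simp [φ, diagCasimirHom_C]) fun e => ?_
      have h1 := congrArg (fun F => F.coeff (e : ℕ)) hGp
      simp only [map_monicOfCoeff, coeff_monicOfCoeff] at h1
      rw [h1]
      rw [RingHom.comp_apply, diagCasimirHom_X, diagCasimir, ← coeff_map, Polynomial.map_prod]
      simp [hφ]
    · simp [φ, b.2]
  ext A _ _ φ φ' h1 h2 h3 := by
    refine MvPolynomial.ringHom_ext (fun r => ?_) fun b => ?_
    · have := DFunLike.congr_fun h1 (MvPolynomial.C r)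
      simpa [diagCasimirHom_C] using this
    · by_cases hb : b.1 = b.2.1
      · obtain ⟨i, j, r⟩ := b
        obtain rfl : i = j := hb
        have := congrArg (fun F => F.coeff (r.rev : ℕ)) (h2 i)
        simp only [diagPoly_eq, map_monicOfCoeff, coeff_monicOfCoeff] at this
        simpa using this
      · exact h3 ⟨b, hb⟩

/-- Polynomials are flat over the leading parts of the center. -/
theorem flat_aeval_diagCasimir : (diagCasimirHom k n p).Flat :=
  (isUnivFactorization_diagPoly k n p).flat (monic_monicOfCoeff _)

end Yangian

end

section

/-- A family in a flat module over a domain is linearly independent if its reduction is linearly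
independent over a field to which the domain retracts. -/
lemma linearIndependent_of_flat {K S M Q J : Type*} [Field K] [CommRing S] [IsDomain S]
    [Algebra K S] [AddCommGroup M] [Module S M] [Module.Flat S M] [AddCommGroup Q] [Module K Q]
    (ε : S →ₐ[K] K) (π : M →+ Q) (hπ : ∀ (s : S) (x : M), π (s • x) = ε s • π x) {β : J → M}
    (h : LinearIndependent K (π ∘ β)) : LinearIndependent S β := by
  classical
  rw [linearIndependent_iff_finset_linearIndependent]
  intro F
  rw [Fintype.linearIndependent_iff]
  intro s hs
  obtain ⟨l, a, y, h1, h2⟩ := Module.Flat.isTrivialRelation_of_sum_smul_eq_zero hs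
  have hli : LinearIndependent K ((π ∘ β) ∘ (Subtype.val : F → J)) :=
    h.comp _ Subtype.val_injective
  let T : (F → K) →ₗ[K] (Fin l → K) := (Matrix.of fun i j => ε (a i j)).vecMulLinear
  have hT : LinearMap.ker T = ⊥ := by
    rw [LinearMap.ker_eq_bot']
    intro c hc
    refine funext fun i => Fintype.linearIndependent_iff.1 hli c ?_ i
    calc ∑ i, c i • π (β i) = ∑ i, ∑ j, (c i * ε (a i j)) • π (y j) := by
          refine Finset.sum_congr rfl fun i _ => ?_
          have := h1 i
          simp only [Function.comp_apply] at this
          rw [this, map_sum, Finset.smul_sum]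
          exact Finset.sum_congr rfl fun j _ => by rw [hπ, mul_smul]
      _ = ∑ j, T c j • π (y j) := by
          rw [Finset.sum_comm]
          refine Finset.sum_congr rfl fun j _ => ?_
          rw [← Finset.sum_smul]
          simp [T, Matrix.vecMul, dotProduct]
      _ = 0 := by simp [hc]
  obtain ⟨U, hU⟩ := LinearMap.exists_leftInverse_of_injective T hT
  let B : Matrix F F S := (Matrix.of a) * (Matrix.of fun j i => algebraMap K S (U (Pi.single j 1) i))
  have hB : B.map ε = 1 := by
    ext i i'
    have h3 : U (T (Pi.single i 1)) = Pi.single i 1 := by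
      rw [← LinearMap.comp_apply, hU, LinearMap.id_apply]
    have h4 : T (Pi.single i 1) = ∑ j, ε (a i j) • Pi.single j (1 : K) := by
      ext j
      simp [T, Finset.sum_apply, Pi.single_apply]
    rw [h4, map_sum] at h3
    have h5 := congrFun h3 i'
    simp only [map_smul, Finset.sum_apply, Pi.smul_apply, smul_eq_mul] at h5
    simp only [B, Matrix.map_apply, Matrix.mul_apply, Matrix.of_apply, map_sum, map_mul,
      AlgHom.commutes, Algebra.algebraMap_self_apply]
    rw [h5, Matrix.one_apply, Pi.single_apply]
    simp only [eq_comm]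
  have hdet : B.det ≠ 0 := by
    intro h0
    have := ε.map_det B
    rw [h0, map_zero, AlgHom.mapMatrix_apply, hB, Matrix.det_one] at this
    exact zero_ne_one this
  have hsB : Matrix.vecMul s B = 0 := by
    have h6 : Matrix.vecMul s (Matrix.of a) = 0 := by
      ext j
      simpa [Matrix.vecMul, dotProduct] using h2 j
    rw [← Matrix.vecMul_vecMul, h6, Matrix.zero_vecMul]
  exact congrFun (Matrix.eq_zero_of_vecMul_eq_zero hdet hsB)

end

section

universe v

namespace MvPolynomial

variable {k σ : Type*} [Field k] {w : σ → ℕ}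

lemma weightedHomogeneousComponent_mul_of_le {z : MvPolynomial σ k} {v D : ℕ}
    (hz : IsWeightedHomogeneous w z v) (hD : v ≤ D) (h : MvPolynomial σ k) :
    weightedHomogeneousComponent w D (h * z) = weightedHomogeneousComponent w (D - v) h * z := by
  classical
  induction h using MvPolynomial.induction_on' with
  | monomial e c =>
    have h1 := isWeightedHomogeneous_monomial w e c (rfl : Finsupp.weight w e = _)
    rw [weightedHomogeneousComponent_of_mem (h1.mul hz), weightedHomogeneousComponent_of_mem h1]
    by_cases hd : D - v = Finsupp.weight w e
    · rw [if_pos hd, if_pos (by omega)]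
    · rw [if_neg hd, if_neg (by omega), zero_mul]
  | add p q hp hq => rw [add_mul, map_add, map_add, hp, hq, add_mul]

lemma weightedHomogeneousComponent_mul_of_lt {z : MvPolynomial σ k} {v D : ℕ}
    (hz : IsWeightedHomogeneous w z v) (hD : D < v) (h : MvPolynomial σ k) :
    weightedHomogeneousComponent w D (h * z) = 0 := by
  classical
  induction h using MvPolynomial.induction_on' with
  | monomial e c =>
    have h1 := isWeightedHomogeneous_monomial w e c (rfl : Finsupp.weight w e = _)
    rw [weightedHomogeneousComponent_of_mem (h1.mul hz), if_neg (by omega)]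
  | add p q hp hq => rw [add_mul, map_add, hp, hq, add_zero]

/-- Graded Nakayama lemma: monomials spanning modulo the ideal generated by homogeneous elements of
positive weight generate all polynomials over these elements. -/
lemma span_eq_top_of_span_quotient {ι J : Type*} {z : ι → MvPolynomial σ k} {W : ι → ℕ}
    (hW : ∀ i, 0 < W i) (hz : ∀ i, IsWeightedHomogeneous w (z i) (W i)) {b : J → σ →₀ ℕ}
    (hb : Submodule.span k (Set.range fun j =>
      Ideal.Quotient.mk (Ideal.span (Set.range z)) (monomial (b j) 1)) = ⊤) :
    Submodule.span k (Set.range fun x : (ι →₀ ℕ) × J =>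
      aeval (R := k) z (monomial x.1 1) * monomial (b x.2) (1 : k)) = ⊤ := by
  classical
  set V := Submodule.span k (Set.range fun x : (ι →₀ ℕ) × J =>
      aeval (R := k) z (monomial x.1 1) * monomial (b x.2) (1 : k)) with hV
  have hbV (j : J) : monomial (b j) (1 : k) ∈ V :=
    Submodule.subset_span ⟨(0, j), by simp⟩
  have hVz (i : ι) {f : MvPolynomial σ k} (hf : f ∈ V) : f * z i ∈ V := by
    induction hf using Submodule.span_induction with
    | mem x hx =>
      obtain ⟨⟨α, j⟩, rfl⟩ := hx
      refine Submodule.subset_span ⟨(α + Finsupp.single i 1, j), ?_⟩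
      have : monomial (α + Finsupp.single i 1) (1 : k) = monomial α 1 * X i := by
        rw [X, monomial_mul, one_mul]
      simp only [this, map_mul, aeval_X]
      ring
    | zero => simp
    | add f g _ _ hf hg =>
      rw [add_mul]
      exact add_mem hf hg
    | smul c f _ hf =>
      rw [smul_mul_assoc]
      exact V.smul_mem c hf
  have key (D : ℕ) : ∀ f : MvPolynomial σ k, weightedHomogeneousComponent w D f ∈ V := by
    induction D using Nat.strong_induction_on with
    | _ D ih =>
      intro f
      have hI : ∀ g ∈ Ideal.span (Set.range z), weightedHomogeneousComponent w D g ∈ V := by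
        intro g hg
        obtain ⟨c, rfl⟩ := Finsupp.mem_ideal_span_range_iff_exists_finsupp.1 hg
        rw [Finsupp.sum, map_sum]
        refine V.sum_mem fun i _ => ?_
        rcases Nat.lt_or_ge D (W i) with h | h
        · rw [weightedHomogeneousComponent_mul_of_lt (hz i) h]
          exact V.zero_mem
        · rw [weightedHomogeneousComponent_mul_of_le (hz i) h]
          exact hVz i (ih _ (by have := hW i; omega) _)
      have h1 : Ideal.Quotient.mk (Ideal.span (Set.range z)) f ∈ (⊤ : Submodule k _) :=
        Submodule.mem_top
      rw [← hb, Finsupp.mem_span_range_iff_exists_finsupp] at h1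
      obtain ⟨c, hc⟩ := h1
      have h2 : f - c.sum (fun j a => a • monomial (b j) (1 : k)) ∈ Ideal.span (Set.range z) := by
        rw [← Ideal.Quotient.eq, ← hc, Finsupp.sum, Finsupp.sum, map_sum]
        rfl
      have h3 := hI _ h2
      rw [map_sub, Finsupp.sum, map_sum] at h3
      refine (V.sub_mem_iff_left (V.sum_mem fun j _ => ?_)).1 h3
      rw [map_smul]
      refine V.smul_mem _ ?_
      rw [weightedHomogeneousComponent_of_mem
        (isWeightedHomogeneous_monomial w (b j) (1 : k) rfl)]
      split_ifs
      · exact hbV j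
      · exact V.zero_mem
  rw [eq_top_iff]
  rintro f -
  rw [← sum_weightedHomogeneousComponent w f, finsum_eq_sum _
    (weightedHomogeneousComponent_finsupp f)]
  exact V.sum_mem fun D _ => key D f

/-- If polynomials are flat over the algebra generated by homogeneous elements of positive weight,
they are free over it, on a basis of monomials. -/
theorem exists_monomial_basis {k ι : Type*} {σ : Type v} [Field k] {w : σ → ℕ}
    {z : ι → MvPolynomial σ k} {W : ι → ℕ}
    (hW : ∀ i, 0 < W i) (hz : ∀ i, IsWeightedHomogeneous w (z i) (W i))
    (hflat : (aeval (R := k) z : MvPolynomial ι k →ₐ[k] _).toRingHom.Flat) :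
    ∃ (J : Type v) (b : J → σ →₀ ℕ),
      LinearIndependent k (fun x : (ι →₀ ℕ) × J =>
        aeval (R := k) z (monomial x.1 1) * monomial (b x.2) (1 : k)) ∧
      Submodule.span k (Set.range fun x : (ι →₀ ℕ) × J =>
        aeval (R := k) z (monomial x.1 1) * monomial (b x.2) (1 : k)) = ⊤ := by
  obtain ⟨J, b, -, hsp, hli⟩ := exists_linearIndependent' k fun e : σ →₀ ℕ =>
    Ideal.Quotient.mk (Ideal.span (Set.range z)) (monomial e (1 : k))
  refine ⟨J, b, ?_, span_eq_top_of_span_quotient hW hz ?_⟩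
  · let : Algebra (MvPolynomial ι k) (MvPolynomial σ k) :=
      (aeval (R := k) z : MvPolynomial ι k →ₐ[k] _).toRingHom.toAlgebra
    have hsmul (s : MvPolynomial ι k) (f : MvPolynomial σ k) : s • f = aeval z s * f := rfl
    have : IsScalarTower k (MvPolynomial ι k) (MvPolynomial σ k) :=
      IsScalarTower.of_algebraMap_eq fun r => ((aeval (R := k) z).commutes r).symm
    have : Module.Flat (MvPolynomial ι k) (MvPolynomial σ k) := hflat
    have h1 : LinearIndependent (MvPolynomial ι k) fun j => monomial (b j) (1 : k) := by
      refine linearIndependent_of_flat (aeval (R := k) fun _ => (0 : k))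
        (Ideal.Quotient.mk (Ideal.span (Set.range z))).toAddMonoidHom (fun s f => ?_) hli
      change Ideal.Quotient.mk _ (aeval z s * f) = Ideal.Quotient.mk _ (_ • f)
      rw [map_mul, smul_eq_C_mul, map_mul]
      congr 1
      induction s using MvPolynomial.induction_on with
      | C a =>
        rw [aeval_C, aeval_C]
        rfl
      | add p q hp hq => simp only [map_add, hp, hq]
      | mul_X p i _ =>
        have : Ideal.Quotient.mk (Ideal.span (Set.range z)) (z i) = 0 :=
          Ideal.Quotient.eq_zero_iff_mem.2 (Ideal.subset_span ⟨i, rfl⟩)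
        simp only [map_mul, aeval_X, this, mul_zero, map_zero]
    have h2 := linearIndependent_smul (basisMonomials ι k).linearIndependent h1
    simpa only [hsmul, coe_basisMonomials] using h2
  · refine Eq.trans hsp ?_
    rw [eq_top_iff]
    rintro x -
    obtain ⟨f, rfl⟩ := Ideal.Quotient.mk_surjective x
    rw [f.as_sum, map_sum]
    refine Submodule.sum_mem _ fun e _ => ?_
    rw [← mul_one (coeff e f), ← smul_eq_mul, ← smul_monomial]
    exact Submodule.smul_mem _ (coeff e f) (Submodule.subset_span (Set.mem_range_self e))

end MvPolynomial

end

section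

lemma linearIndependent_of_smul {K Z M I J : Type*} [Field K] [CommRing Z] [Algebra K Z]
    [AddCommGroup M] [Module Z M] [Module K M] [IsScalarTower K Z M] {v : I → Z}
    (hv : Submodule.span K (Set.range v) = ⊤) {c : J → M}
    (h : LinearIndependent K fun x : I × J => v x.1 • c x.2) : LinearIndependent Z c := by
  classical
  have hv' (g : Z) : ∃ a : I →₀ K, a.sum (fun i r => r • v i) = g :=
    Finsupp.mem_span_range_iff_exists_finsupp.1 (hv ▸ Submodule.mem_top)
  rw [linearIndependent_iff']
  intro s g hg j hj
  choose a ha using fun j => hv' (g j)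
  let T := s.biUnion fun j => (a j).support
  have hT {j : J} (hj : j ∈ s) : g j = ∑ i ∈ T, a j i • v i := by
    rw [← ha j, Finsupp.sum_of_support_subset _ (Finset.subset_biUnion_of_mem
      (fun j => (a j).support) hj) _ (fun i _ => zero_smul K (v i))]
  have hsum : ∑ x ∈ T ×ˢ s, a x.2 x.1 • v x.1 • c x.2 = 0 := by
    rw [Finset.sum_product_right, ← hg]
    refine Finset.sum_congr rfl fun j hj => ?_
    rw [hT hj, Finset.sum_smul]
    exact Finset.sum_congr rfl fun i _ => (smul_assoc _ _ _).symm
  have h0 := linearIndependent_iff'.1 h _ (fun x => a x.2 x.1) hsum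
  rw [hT hj]
  refine Finset.sum_eq_zero fun i hi => ?_
  have := h0 (i, j) (Finset.mem_product.2 ⟨hi, hj⟩)
  simp only at this
  rw [this, zero_smul]

namespace Yangian

open MvPolynomial

variable {k : Type u} [Field k] [CharZero k] {n p : ℕ}

variable (k n p) in
/-- The central elements `casimir` as polynomial generators of the center. -/
def casimirHom : MvPolynomial (Fin (n * p)) k →ₐ[k] Subalgebra.center k (Yangian k n p) :=
  aeval fun e => ⟨casimir k n p (n * p - e), casimir_mem_center' _⟩

lemma casimirHom_X (e : Fin (n * p)) :
    (casimirHom k n p (X e) : Yangian k n p) = casimir k n p (n * p - e) := by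
  rw [casimirHom, aeval_X]

lemma exists_isSymb_casimirHom (α : Fin (n * p) →₀ ℕ) :
    ∃ d, IsSymb k (letter k n p) (diagWeight n p) d
      (casimirHom k n p (monomial α 1) : Yangian k n p)
      (aeval (R := k) (diagCasimir k n p) (monomial α 1)) := by
  have mul (f g : MvPolynomial (Fin (n * p)) k)
      (hf : ∃ d, IsSymb k (letter k n p) (diagWeight n p) d
        (casimirHom k n p f : Yangian k n p) (aeval (R := k) (diagCasimir k n p) f))
      (hg : ∃ d, IsSymb k (letter k n p) (diagWeight n p) d
        (casimirHom k n p g : Yangian k n p) (aeval (R := k) (diagCasimir k n p) g)) :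
      ∃ d, IsSymb k (letter k n p) (diagWeight n p) d
        (casimirHom k n p (f * g) : Yangian k n p)
        (aeval (R := k) (diagCasimir k n p) (f * g)) := by
    obtain ⟨d, hf⟩ := hf
    obtain ⟨d', hg⟩ := hg
    refine ⟨d + d', ?_⟩
    rw [map_mul, map_mul]
    exact hf.mul diagWeight_commutator hg
  have one : ∃ d, IsSymb k (letter k n p) (diagWeight n p) d
      (casimirHom k n p 1 : Yangian k n p) (aeval (R := k) (diagCasimir k n p) 1) := by
    refine ⟨0, ?_⟩
    rw [map_one, map_one]
    exact IsSymb.one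
  induction α using Finsupp.induction_linear with
  | zero => exact one
  | add α α' h h' =>
    rw [← one_mul (1 : k), ← monomial_mul]
    exact mul _ _ h h'
  | single e m =>
    rw [← X_pow_eq_monomial]
    induction m with
    | zero =>
      rw [pow_zero]
      exact one
    | succ m ih =>
      rw [pow_succ]
      refine mul _ _ ih ⟨3 * (n * p - e), ?_⟩
      have h := isSymb_casimir_diagWeight (k := k) (n * p - e) (Nat.sub_le _ _)
      rw [show n * p - (n * p - e) = (e : ℕ) by omega] at h
      rwa [casimirHom_X, aeval_X]

lemma casimirHom_surjective (hn : 0 < n) : Function.Surjective (casimirHom k n p) := by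
  have hle : Subalgebra.center k (Yangian k n p) ≤ Algebra.adjoin k (Set.range
      fun b : Fin n × Fin p => casimir k n p ((n - b.1) * p - b.2)) := by
    refine le_adjoin_of_isSymb loopWeight_commutator adjoin_letter
      (ζ := fun b : Fin n × Fin p => ((-currentMatrix k n p).charpoly.coeff b.1).coeff b.2)
      (W := fun b => 2 * ((n - b.1) * p - b.2) - (n - b.1)) (fun b => ?_) _
      (fun b => casimir_mem_center' _) fun y hy D f hf =>
        mem_adjoin_of_coadDer_eq_zero hn (coadDer_eq_zero hy hf)
    obtain ⟨i, e⟩ := b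
    have hp : (n - i) * p = (n - i - 1) * p + p := by
      rw [← Nat.succ_mul, Nat.succ_eq_add_one, Nat.sub_add_cancel (by omega)]
    have h := isSymb_casimir_loopWeight (k := k) (n := n) (p := p) (m := (n - i) * p - e)
      (d := n - i) ((Nat.sub_le _ _).trans (Nat.mul_le_mul_right _ (Nat.sub_le _ _)))
      (Nat.sub_le _ _) (by omega) (by omega) (Nat.sub_le _ _)
    rwa [show n - (n - i) = (i : ℕ) by omega,
      show (n - i) * p - ((n - i) * p - e) = (e : ℕ) by omega] at h
  have hrange : Algebra.adjoin k (Set.range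
      fun b : Fin n × Fin p => casimir k n p ((n - b.1) * p - b.2)) ≤
      ((Subalgebra.center k (Yangian k n p)).val.comp (casimirHom k n p)).range := by
    rw [Algebra.adjoin_le_iff]
    rintro _ ⟨⟨i, e⟩, rfl⟩
    have h1 : (i + 1) * p ≤ n * p := Nat.mul_le_mul_right _ i.2
    rw [add_mul, one_mul] at h1
    refine ⟨X ⟨i * p + e, by omega⟩, ?_⟩
    change (casimirHom k n p (X _) : Yangian k n p) = _
    simp only [casimirHom_X, Nat.sub_mul, Nat.sub_sub]
  intro y
  obtain ⟨q, hq⟩ := hrange (hle y.2)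
  exact ⟨q, Subtype.ext hq⟩

theorem free_center (hn : 0 < n) :
    Module.Free (Subalgebra.center k (Yangian k n p)) (Yangian k n p) := by
  obtain ⟨J, b, hli, hsp⟩ := exists_monomial_basis (w := diagWeight n p)
    (z := diagCasimir k n p) (W := fun e => 3 * (n * p - e)) (fun e => by omega) (fun e => by
      have h := (isSymb_casimir_diagWeight (k := k) (n * p - e) (Nat.sub_le _ _)).1
      rwa [show n * p - (n * p - e) = (e : ℕ) by omega] at h) (flat_aeval_diagCasimir k n p)
  choose d hd using exists_isSymb_casimirHom (k := k) (n := n) (p := p)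
  let β (j : J) : Yangian k n p := wordMap k (letter k n p) (monomial (b j) 1)
  have hsymb (x : (Fin (n * p) →₀ ℕ) × J) : IsSymb k (letter k n p) (diagWeight n p)
      (d x.1 + Finsupp.weight (diagWeight n p) (b x.2))
      (casimirHom k n p (monomial x.1 1) • β x.2)
      (aeval (R := k) (diagCasimir k n p) (monomial x.1 1) * monomial (b x.2) (1 : k)) :=
    (hd x.1).mul diagWeight_commutator
      (IsSymb.wordMap_self (isWeightedHomogeneous_monomial _ _ _ rfl))
  have hli' := linearIndependent_of_isSymb diagWeight_commutator (wordMap_injective n p) hli hsymb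
  have hsp' := span_eq_top_of_isSymb diagWeight_commutator adjoin_letter hsp hsymb
  have hc : Submodule.span k (Set.range fun α : Fin (n * p) →₀ ℕ =>
      casimirHom k n p (monomial α 1)) = ⊤ := by
    have h1 := (basisMonomials (Fin (n * p)) k).span_eq
    have h2 := congrArg (Submodule.map (casimirHom k n p).toLinearMap) h1
    rw [Submodule.map_span, ← Set.range_comp, Submodule.map_top,
      LinearMap.range_eq_top.2 (casimirHom_surjective hn)] at h2
    rw [← h2, coe_basisMonomials]
    rfl
  refine Module.Free.of_basis (Module.Basis.mk (linearIndependent_of_smul hc hli') ?_)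
  rintro y -
  have hy : y ∈ (⊤ : Submodule k (Yangian k n p)) := Submodule.mem_top
  rw [← hsp'] at hy
  refine (Submodule.span_le (p := (Submodule.span _ _).restrictScalars k)).2 ?_ hy
  rintro _ ⟨x, rfl⟩
  exact Submodule.smul_mem _ _ (Submodule.subset_span (Set.mem_range_self x.2))

end Yangian

end

/-- For all `n, p ≥ 1` the level `p` (restricted) Yangian `Y_p(gl_n)` is
a free module over its center. -/
theorem statement18 (k : Type u) [Field k] [IsAlgClosed k] [CharZero k]
    (n p : ℕ) (hn : 1 ≤ n) (hp : 1 ≤ p) :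
    Module.Free ↥(Subalgebra.center k (Yangian k n p)) (Yangian k n p) := by
  exact Yangian.free_center hn

end
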